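/- Let (W, S) be a Coxeter system with W finite and crystallographic (for all distinct s, t ∈ S the order m(s,t) of st lies in {2, 3, 4, 6}, so W is a finite Weyl group), let k be a field of characteristic zero, and let ξ ∈ k be nonzero. Let H_k(W, ξ) be the associative unital k-algebra presented by generators {T_s : s ∈ S} subject to the quadratic relations T_s² = ξ·1 + (ξ−1)·T_s for each s ∈ S, and the braid relations T_s T_t T_s ⋯ = T_t T_s T_t ⋯ (with m(s,t) factors on each side) for all distinct s, t ∈ S. If Σ_{w ∈ W} ξ^{ℓ(w)} ≠ 0 in k, where ℓ denotes the length function of (W, S), then H_k(W, ξ) is a semisimple ring. -/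

import Mathlib

/-- The alternating word `x y x y ⋯` with `m` factors, starting with `x`. -/
def braidWord {A : Type*} [Monoid A] (x y : A) (m : ℕ) : A :=
  ((List.range m).map (fun i => if Even i then x else y)).prod

/-- The defining relations of the Iwahori–Hecke algebra of the Coxeter matrix `M` with
parameter `ξ`: the quadratic relations `T_s² = ξ·1 + (ξ−1)·T_s` and the braid relations
`T_s T_t T_s ⋯ = T_t T_s T_t ⋯` (with `m(s,t)` factors on each side) for `s ≠ t`. -/
def heckeRel (k : Type*) [Field k] {B : Type*} (M : CoxeterMatrix B) (ξ : k) :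
    FreeAlgebra k B → FreeAlgebra k B → Prop := fun a b =>
  (∃ s : B, a = (FreeAlgebra.ι k s) ^ 2 ∧
      b = ξ • (1 : FreeAlgebra k B) + (ξ - 1) • FreeAlgebra.ι k s) ∨
  (∃ s t : B, s ≠ t ∧
      a = braidWord (FreeAlgebra.ι k s) (FreeAlgebra.ι k t) (M.M s t) ∧
      b = braidWord (FreeAlgebra.ι k t) (FreeAlgebra.ι k s) (M.M s t))

section

open Module Polynomial

section TwoReflections

variable {K E : Type*}

theorem preReflection_mul_apply_add [CommRing K] [AddCommGroup E] [Module K E] {a b : E} {f g : Dual K E}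
    {u v : K} (ha : f a = 2) (hb : g b = 2) (hab : f b = u) (hba : g a = v) (x : E) (c d : K) :
    (preReflection a f * preReflection b g) (x + c • a + d • b) =
      x + (-c - f x + u * (g x + d + v * c)) • a + (-d - g x - v * c) • b := by
  simp only [Module.End.mul_apply, preReflection_apply, map_add, map_sub, map_smul, ha, hb, hab, hba]
  module

theorem pow_preReflection_mul_of_isPrimitiveRoot [Field K] [AddCommGroup E] [Module K E] {a b : E}
    {f g : Dual K E} {z : K} (hz : z ≠ 0) (ha : f a = 2) (hb : g b = 2)
    (hab : f b = -(z + z⁻¹)) (hba : g a = -(z + z⁻¹)) {m : ℕ} (hm : 3 ≤ m)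
    (hzm : IsPrimitiveRoot (z ^ 2) m) : (preReflection a f * preReflection b g) ^ m = 1 := by
  set A := preReflection a f * preReflection b g with hA
  set y := z ^ 2 with hy
  have hy0 : y ≠ 0 := pow_ne_zero _ hz
  have h1 : y ≠ 1 := hzm.ne_one (by omega)
  have h2 : y⁻¹ ≠ 1 := by simpa using h1
  have h3 : y ≠ y⁻¹ := by
    intro h
    have h4 : y ^ 2 = 1 := by
      rw [pow_two]; nth_rewrite 2 [h]; exact mul_inv_cancel₀ hy0
    have := Nat.le_of_dvd (by norm_num) (hzm.dvd_of_pow_eq_one 2 h4)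
    omega
  have hcub : aeval A ((X - C y) * (X - C y⁻¹) * (X - C 1) : K[X]) = 0 := by
    ext x
    have e1 : A x = x + (- f x - (z + z⁻¹) * (g x)) • a + (- g x) • b := by
      have := preReflection_mul_apply_add ha hb hab hba x 0 0
      simp only [zero_smul, add_zero] at this
      rw [hA, this]
      module
    have key : ∀ c d : K, A (c • a + d • b) =
        (-c  -(z + z⁻¹) * ( d  -(z + z⁻¹) * c)) • a + (-d  + (z + z⁻¹) * c) • b := by
      intro c d
      have := preReflection_mul_apply_add ha hb hab hba 0 c d
      simp only [zero_add, map_zero] at this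
      rw [hA, this]
      module
    have e2 : (A - 1) x = (- f x - (z + z⁻¹) * (g x)) • a + (- g x) • b := by
      rw [LinearMap.sub_apply, e1, Module.End.one_apply]; module
    simp only [map_mul, map_sub, aeval_X, aeval_C, Module.End.mul_apply, map_one, e2]
    simp only [LinearMap.sub_apply, Module.algebraMap_end_apply, key, smul_add, smul_smul,
      LinearMap.zero_apply]
    rw [show ∀ c1 d1 c2 d2 : K, c1 • a + d1 • b - (c2 • a + d2 • b) = (c1 - c2) • a + (d1 - d2) • b by
      intros; module, key, smul_add, smul_smul, smul_smul]
    rw [show ∀ c1 d1 c2 d2 : K, c1 • a + d1 • b - (c2 • a + d2 • b) = (c1 - c2) • a + (d1 - d2) • b by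
      intros; module]
    convert (show (0 : K) • a + (0 : K) • b = 0 by simp) using 3 <;> rw [hy] <;> field_simp <;> ring
  have hdvd : ((X - C y) * (X - C y⁻¹) * (X - C 1) : K[X]) ∣ X ^ m - 1 := by
    have hr : ∀ w : K, w ^ m = 1 → (X - C w) ∣ (X ^ m - 1 : K[X]) := by
      intro w hw
      rw [dvd_iff_isRoot]; simp [hw]
    refine IsCoprime.mul_dvd (IsCoprime.mul_left ?_ ?_) (IsCoprime.mul_dvd ?_ ?_ ?_) ?_
    · exact isCoprime_X_sub_C_of_isUnit_sub (sub_ne_zero.2 h1).isUnit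
    · exact isCoprime_X_sub_C_of_isUnit_sub (sub_ne_zero.2 h2).isUnit
    · exact isCoprime_X_sub_C_of_isUnit_sub (sub_ne_zero.2 h3).isUnit
    · exact hr _ hzm.pow_eq_one
    · exact hr _ (by rw [inv_pow, hzm.pow_eq_one, inv_one])
    · exact hr _ (one_pow _)
  obtain ⟨q, hq⟩ := hdvd
  have := congrArg (aeval A) hq
  rw [map_mul, hcub, zero_mul] at this
  simpa [sub_eq_zero] using this

theorem preReflection_mul_self' [CommRing K] [AddCommGroup E] [Module K E] {a : E} {f : Dual K E}
    (ha : f a = 2) : preReflection a f * preReflection a f = 1 := by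
  ext x
  simp only [Module.End.mul_apply, preReflection_apply, map_sub, map_smul, ha,
    Module.End.one_apply]
  module

end TwoReflections

namespace CoxeterSystem

variable {B W : Type*} [Group W] {M : CoxeterMatrix B} (cs : CoxeterSystem M W)

private noncomputable def geomRoot (m : ℕ) : ℂ :=
  if m = 0 then 1 else Complex.exp (Real.pi * Complex.I / m)

open Classical in
private noncomputable def geomForm (M : CoxeterMatrix B) (i : B) : Dual ℂ (B →₀ ℂ) :=
  Finsupp.lift ℂ ℂ B (fun j => if i = j then 2 else -(geomRoot (M i j) + (geomRoot (M i j))⁻¹))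

private theorem geomForm_single (i j : B) : geomForm M i (Finsupp.single j 1) =
    open Classical in if i = j then 2 else -(geomRoot (M i j) + (geomRoot (M i j))⁻¹) := by
  simp [geomForm]

private theorem geomRoot_ne_zero (m : ℕ) : geomRoot m ≠ 0 := by
  unfold geomRoot; split_ifs
  · exact one_ne_zero
  · exact Complex.exp_ne_zero _

private theorem isPrimitiveRoot_geomRoot {m : ℕ} (hm : m ≠ 0) :
    IsPrimitiveRoot (geomRoot m ^ 2) m := by
  have := Complex.isPrimitiveRoot_exp m hm
  convert this using 1
  rw [geomRoot, if_neg hm, ← Complex.exp_nat_mul]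
  congr 1; push_cast; ring

private theorem geom_isLiftable : M.IsLiftable
    (fun i => preReflection (Finsupp.single i 1) (geomForm M i)) := by
  intro i j
  have hs : ∀ i : B, geomForm M i (Finsupp.single i 1) = 2 := fun i => by simp [geomForm_single]
  by_cases hij : i = j
  · subst hij
    rw [M.diagonal, pow_one, preReflection_mul_self' (hs i)]
  have h1 : geomForm M i (Finsupp.single j 1) = -(geomRoot (M i j) + (geomRoot (M i j))⁻¹) := by
    rw [geomForm_single, if_neg hij]
  have h2 : geomForm M j (Finsupp.single i 1) = -(geomRoot (M i j) + (geomRoot (M i j))⁻¹) := by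
    rw [geomForm_single, if_neg (Ne.symm hij), M.symmetric j i]
  have hne := M.off_diagonal i j hij
  rcases Nat.lt_or_ge (M i j) 3 with h | h
  · have : M i j = 0 ∨ M i j = 2 := by omega
    rcases this with h0 | h0
    · rw [h0, pow_zero]
    · have hz : geomRoot (M i j) + (geomRoot (M i j))⁻¹ = 0 := by
        have hp := isPrimitiveRoot_geomRoot (m := M i j) (by omega)
        rw [h0] at hp ⊢
        have := hp.eq_neg_one_of_two_right
        have hn := geomRoot_ne_zero 2
        field_simp
        rw [this]; ring
      rw [hz, neg_zero] at h1 h2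
      rw [h0, pow_two]
      ext x : 2
      simp only [Module.End.mul_apply, preReflection_apply, map_sub, map_smul, h1, h2, hs,
        LinearMap.comp_apply, Module.End.one_apply]
      module
  · exact pow_preReflection_mul_of_isPrimitiveRoot (geomRoot_ne_zero _) (hs i) (hs j) h1 h2 h
      (isPrimitiveRoot_geomRoot (by omega))

/-- In a Coxeter group the order of the product of two simple reflections is the corresponding
entry of the Coxeter matrix, provided that order is positive. -/
theorem orderOf_simple_mul_simple (i j : B) (h0 : orderOf (cs.simple i * cs.simple j) ≠ 0) :
    orderOf (cs.simple i * cs.simple j) = M i j := by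
  refine Nat.dvd_antisymm (orderOf_dvd_of_pow_eq_one (cs.simple_mul_simple_pow i j)) ?_
  by_cases hij : i = j
  · subst hij; rw [M.diagonal]; exact one_dvd _
  set d := orderOf (cs.simple i * cs.simple j) with hd
  have hs : ∀ i : B, geomForm M i (Finsupp.single i 1) = 2 := fun i => by simp [geomForm_single]
  set z := geomRoot (M i j) with hzdef
  have hz := geomRoot_ne_zero (M i j)
  rw [← hzdef] at hz
  have h1 : geomForm M i (Finsupp.single j 1) = -(z + z⁻¹) := by
    rw [geomForm_single, if_neg hij]
  have h2 : geomForm M j (Finsupp.single i 1) = -(z + z⁻¹) := by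
    rw [geomForm_single, if_neg (Ne.symm hij), M.symmetric j i]
  set a : B →₀ ℂ := Finsupp.single i 1 with hadef
  set b : B →₀ ℂ := Finsupp.single j 1 with hbdef
  set A := preReflection a (geomForm M i) * preReflection b (geomForm M j) with hA
  have hAd : A ^ d = 1 := by
    have : A = cs.lift ⟨_, geom_isLiftable⟩ (cs.simple i * cs.simple j) := by
      rw [map_mul, cs.lift_apply_simple, cs.lift_apply_simple]
    rw [this, ← map_pow, hd, pow_orderOf_eq_one, map_one]
  have key : ∀ c d : ℂ, A (c • a + d • b) =
      (-c  -(z + z⁻¹) * ( d  -(z + z⁻¹) * c)) • a + (-d  + (z + z⁻¹) * c) • b := by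
    intro c d
    have := preReflection_mul_apply_add (hs i) (hs j) h1 h2 0 c d
    simp only [zero_add, map_zero] at this
    rw [hA, this]
    module
  have hv : A ((1 : ℂ) • a + z⁻¹ • b) = z ^ 2 • ((1 : ℂ) • a + z⁻¹ • b) := by
    rw [key, smul_add, smul_smul, smul_smul]
    congr 2 <;> field_simp <;> ring
  have hji : ¬ (j = i) := fun h => hij h.symm
  by_cases hM : M i j = 0
  · exfalso
    have hz1 : z = 1 := by rw [hzdef, geomRoot, if_pos hM]
    have hn : ∀ n : ℕ, (A ^ n) a = (1 + 2 * n : ℂ) • a + (2 * n : ℂ) • b := by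
      intro n
      induction n with
      | zero => simp
      | succ n ih =>
        rw [pow_succ', Module.End.mul_apply, ih, key, hz1]
        push_cast
        congr 2 <;> norm_num <;> ring
    have := hn d
    rw [hAd] at this
    have h3 := DFunLike.congr_fun this j
    simp [hadef, hbdef, hji] at h3
    exact h0 h3
  · have hn : ∀ n : ℕ, (A ^ n) ((1 : ℂ) • a + z⁻¹ • b) = (z ^ 2) ^ n • ((1 : ℂ) • a + z⁻¹ • b) := by
      intro n
      induction n with
      | zero => simp
      | succ n ih => rw [pow_succ', Module.End.mul_apply, ih, map_smul, hv, smul_smul, pow_succ (z ^ 2)]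
    have := hn d
    rw [hAd] at this
    have h3 := DFunLike.congr_fun this i
    simp [hadef, hbdef, hij] at h3
    exact (isPrimitiveRoot_geomRoot hM).dvd_of_pow_eq_one d (by simpa [hzdef] using h3.symm)

end CoxeterSystem

end

section

open Module

namespace CoxeterSystem

variable {B W : Type*} [Group W] {M : CoxeterMatrix B} (cs : CoxeterSystem M W)

/-- If `t` is a right descent of `w`, then `w` factors as a reduced product of an element `v` and an
alternating word in `s, t` which either is the longest one or starts at an element `v` having neither
`s` nor `t` as a right descent. -/
theorem exists_eq_mul_alternatingWord {w : W} {s t : B} (hM : 1 ≤ M s t) (ht : cs.IsRightDescent w t) :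
    ∃ (k : ℕ) (v : W), 1 ≤ k ∧ k ≤ M s t ∧ w = v * cs.wordProd (alternatingWord s t k) ∧
      cs.length w = cs.length v + k ∧
      (k = M s t ∨ (¬ cs.IsRightDescent v s ∧ ¬ cs.IsRightDescent v t)) := by
  classical
  let P : ℕ → Prop := fun k => ∃ v : W, w = v * cs.wordProd (alternatingWord s t k) ∧
    cs.length w = cs.length v + k
  have hP1 : P 1 := by
    refine ⟨w * cs.simple t, ?_, ?_⟩
    · simp [alternatingWord]
    · exact ((cs.isRightDescent_iff).1 ht).symm
  set k := Nat.findGreatest P (M s t) with hk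
  have hk1 : 1 ≤ k := Nat.le_findGreatest hM hP1
  have hkM : k ≤ M s t := Nat.findGreatest_le _
  obtain ⟨v, hv, hl⟩ : P k := Nat.findGreatest_spec (P := P) hM hP1
  refine ⟨k, v, hk1, hkM, hv, hl, ?_⟩
  rcases hkM.eq_or_lt with h | h
  · exact Or.inl h
  right
  obtain ⟨k', hk'⟩ : ∃ k', k = k' + 1 := ⟨k - 1, by omega⟩
  have hstart : ¬ cs.IsRightDescent v (if Even k' then t else s) := by
    intro hd
    have h1 := (cs.isRightDescent_iff).1 hd
    have h2 : w = (v * cs.simple (if Even k' then t else s)) *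
        cs.wordProd (alternatingWord s t k') := by
      rw [hv, hk', alternatingWord_succ', wordProd_cons, mul_assoc]
    have h3 := cs.length_mul_le (v * cs.simple (if Even k' then t else s))
      (cs.wordProd (alternatingWord s t k'))
    have h4 := cs.length_wordProd_le (alternatingWord s t k')
    rw [← h2] at h3
    rw [length_alternatingWord] at h4
    omega
  have hnext : ¬ cs.IsRightDescent v (if Even k then t else s) := by
    intro hd
    have h1 := (cs.isRightDescent_iff).1 hd
    have : k + 1 ≤ k := by
      refine Nat.le_findGreatest (P := P) h ⟨v * cs.simple (if Even k then t else s), ?_, ?_⟩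
      · rw [alternatingWord_succ', wordProd_cons, ← mul_assoc, simple_mul_simple_cancel_right]
        exact hv
      · omega
    omega
  rw [hk'] at hnext
  by_cases he : Even k'
  · have : ¬ Even (k' + 1) := by rw [Nat.even_add_one]; simpa using he
    rw [if_pos he] at hstart; rw [if_neg this] at hnext
    exact ⟨hnext, hstart⟩
  · have : Even (k' + 1) := by rw [Nat.even_add_one]; exact he
    rw [if_neg he] at hstart; rw [if_pos this] at hnext
    exact ⟨hstart, hnext⟩

end CoxeterSystem

/-- The integer matrix `a` is a Cartan matrix with Coxeter matrix `M`. -/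
structure IsCartanOf {B : Type*} (M : CoxeterMatrix B) (a : B → B → ℤ) : Prop where
  diag : ∀ i, a i i = 2
  off : ∀ i j, i ≠ j → (M i j = 2 ∧ a i j = 0 ∧ a j i = 0) ∨ (M i j = 3 ∧ a i j = -1 ∧ a j i = -1) ∨
    (M i j = 4 ∧ a i j = -1 ∧ a j i = -2) ∨ (M i j = 4 ∧ a i j = -2 ∧ a j i = -1) ∨
    (M i j = 6 ∧ a i j = -1 ∧ a j i = -3) ∨ (M i j = 6 ∧ a i j = -3 ∧ a j i = -1)

theorem exists_isCartanOf {B : Type*} (M : CoxeterMatrix B)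
    (hM : ∀ i j, i ≠ j → M i j = 2 ∨ M i j = 3 ∨ M i j = 4 ∨ M i j = 6) :
    ∃ a : B → B → ℤ, IsCartanOf M a := by
  classical
  let _ : LinearOrder B := linearOrderOfSTO (WellOrderingRel : B → B → Prop)
  refine ⟨fun i j => if i = j then 2 else if M i j = 2 then 0 else if M i j = 3 then -1 else
    if i < j then -1 else if M i j = 4 then -2 else -3, ⟨fun i => by simp, fun i j hij => ?_⟩⟩
  rcases lt_or_gt_of_ne hij with h | h <;> rcases hM i j hij with h1 | h1 | h1 | h1 <;>
    simp [M.symmetric j i, h1, hij, hij.symm, h, h.not_gt]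

theorem IsCartanOf.off_nonpos {B : Type*} {M : CoxeterMatrix B} {a : B → B → ℤ} (h : IsCartanOf M a)
    {i j : B} (hij : i ≠ j) : a i j ≤ 0 := by
  rcases h.off i j hij with h | h | h | h | h | h <;> omega

namespace CartanRep

variable {B : Type*} [Fintype B] [DecidableEq B] (a : B → B → ℤ)

/-- The pairing with the `i`-th simple coroot on the root lattice. -/
def coroot (i : B) : Dual ℤ (B → ℤ) := Fintype.linearCombination ℤ (a i)

omit [DecidableEq B] in
theorem coroot_apply (i : B) (x : B → ℤ) : coroot a i x = ∑ j, x j * a i j := by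
  simp [coroot, Fintype.linearCombination_apply]

/-- The `i`-th simple root. -/
abbrev root (i : B) : B → ℤ := Pi.single i 1

theorem coroot_root (i j : B) : coroot a i (root j) = a i j := by
  simp [coroot_apply, Pi.single_apply]

variable {a} {W : Type*} [Group W] {M : CoxeterMatrix B}

theorem isLiftable (ha : IsCartanOf M a) :
    M.IsLiftable (fun i => preReflection (root i) (coroot a i)) := by
  intro i j
  have hs : ∀ i : B, coroot a i (root i) = 2 := fun i => by rw [coroot_root, ha.diag]
  by_cases hij : i = j
  · subst hij
    rw [M.diagonal, pow_one, preReflection_mul_self' (hs i)]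
  have key := preReflection_mul_apply_add (hs i) (hs j) (coroot_root a i j) (coroot_root a j i)
  refine LinearMap.ext fun x => ?_
  have key' := key x
  have h0 : x = x + (0 : ℤ) • root i + (0 : ℤ) • root j := by simp
  rcases ha.off i j hij with ⟨h, h1, h2⟩ | ⟨h, h1, h2⟩ | ⟨h, h1, h2⟩ | ⟨h, h1, h2⟩ | ⟨h, h1, h2⟩ |
    ⟨h, h1, h2⟩ <;>
  · rw [h1, h2] at key'
    rw [h]
    conv_lhs => rw [h0]
    simp only [pow_succ', pow_zero, mul_one, Module.End.mul_apply (_ * _) (_ ), key', Module.End.one_apply]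
    conv_rhs => rw [h0]
    congr 2
    · congr 2; ring
    · ring

variable (ha : IsCartanOf M a) (cs : CoxeterSystem M W)

/-- The action of the Coxeter group on the root lattice. -/
noncomputable def rep : W →* Module.End ℤ (B → ℤ) := cs.lift ⟨_, isLiftable ha⟩

theorem rep_simple (i : B) : rep ha cs (cs.simple i) = preReflection (root i) (coroot a i) :=
  cs.lift_apply_simple _ _

theorem rep_simple_root_self (i : B) : rep ha cs (cs.simple i) (root i) = -root i := by
  rw [rep_simple, preReflection_apply, coroot_root, ha.diag, two_smul]; abel

theorem rep_simple_combination (i j : B) (c d : ℤ) :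
    rep ha cs (cs.simple j) (c • root i + d • root j) =
      c • root i + (-d - a j i * c) • root j := by
  rw [rep_simple, preReflection_apply, map_add, map_smul, map_smul, coroot_root, coroot_root, ha.diag]
  simp only [smul_eq_mul]
  module

theorem rep_injective (w : W) : Function.Injective (rep ha cs w) := by
  intro x y h
  have := congrArg (rep ha cs w⁻¹) h
  simpa only [← Module.End.mul_apply, ← map_mul, inv_mul_cancel, map_one, Module.End.one_apply] using this

theorem rep_root_ne_zero (w : W) (i : B) : rep ha cs w (root i) ≠ 0 := by
  intro h
  have := rep_injective ha cs w (h.trans (map_zero _).symm)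
  simpa using congrFun this i

theorem rep_alternatingWord_root {s t : B} (hst : s ≠ t) {k : ℕ} (hk : k < M s t) :
    ∃ c d : ℤ, 0 ≤ c ∧ 0 ≤ d ∧
      rep ha cs (cs.wordProd (CoxeterSystem.alternatingWord s t k)) (root s) = c • root s + d • root t := by
  have h0 : root s = (1 : ℤ) • root s + (0 : ℤ) • root t := by simp
  have k1 := rep_simple_combination ha cs s t
  have k2 : ∀ c d : ℤ, rep ha cs (cs.simple s) (c • root s + d • root t) =
      (-c - a s t * d) • root s + d • root t := by
    intro c d
    rw [add_comm, rep_simple_combination ha cs t s, add_comm]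
  have hw0 : CoxeterSystem.alternatingWord s t 0 = [] := rfl
  have hc := ha.off s t hst
  have hk6 : k < 6 := by omega
  conv =>
    enter [1, c, 1, d, 2, 2, 1]
    rw [h0]
  interval_cases k
  · exact ⟨1, 0, by simp, by simp, by simp [CoxeterSystem.alternatingWord]⟩
  all_goals
    rcases hc with ⟨h, h1, h2⟩ | ⟨h, h1, h2⟩ | ⟨h, h1, h2⟩ | ⟨h, h1, h2⟩ | ⟨h, h1, h2⟩ |
      ⟨h, h1, h2⟩ <;> first | omega | skip
  all_goals
    rw [h1] at k2; rw [h2] at k1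
    refine ⟨?_, ?_, ?_, ?_, ?_⟩
    rotate_left 4
    · simp only [CoxeterSystem.alternatingWord_succ', hw0, Nat.even_add_one, Even.zero,
        not_true_eq_false, not_false_eq_true, if_true, if_false,
        CoxeterSystem.wordProd_cons, CoxeterSystem.wordProd_nil, map_mul, map_one, Module.End.mul_apply, Module.End.one_apply, k1, k2]
      rfl
    · norm_num
    · norm_num

theorem rep_root_nonneg {w : W} {s : B} (h : ¬ cs.IsRightDescent w s) :
    0 ≤ rep ha cs w (root s) := by
  induction hn : cs.length w using Nat.strong_induction_on generalizing w s with
  | _ n ih =>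
    by_cases hw : w = 1
    · subst hw
      rw [map_one, Module.End.one_apply]
      exact Pi.single_nonneg.2 zero_le_one
    obtain ⟨t, ht⟩ := cs.exists_rightDescent_of_ne_one hw
    have hst : s ≠ t := by rintro rfl; exact h ht
    have hM1 : 1 ≤ M s t := by have := ha.off s t hst; omega
    obtain ⟨k, v, hk1, hkM, hv, hl, hk⟩ := cs.exists_eq_mul_alternatingWord hM1 ht
    rcases hkM.eq_or_lt with hk' | hk'
    · exfalso
      apply h
      have hb : cs.wordProd (CoxeterSystem.alternatingWord s t k) =
          cs.wordProd (CoxeterSystem.alternatingWord t s k) := by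
        have := cs.wordProd_braidWord_eq s t
        rwa [CoxeterSystem.braidWord, CoxeterSystem.braidWord, M.symmetric t s, ← hk'] at this
      obtain ⟨k', rfl⟩ : ∃ k', k = k' + 1 := ⟨k - 1, by omega⟩
      have h2 : w * cs.simple s = v * cs.wordProd (CoxeterSystem.alternatingWord s t k') := by
        rw [hv, hb, CoxeterSystem.alternatingWord_succ, CoxeterSystem.wordProd_concat,
          ← mul_assoc, CoxeterSystem.simple_mul_simple_cancel_right]
      have h3 := cs.length_mul_le v (cs.wordProd (CoxeterSystem.alternatingWord s t k'))
      have h4 := cs.length_wordProd_le (CoxeterSystem.alternatingWord s t k')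
      rw [CoxeterSystem.length_alternatingWord] at h4
      rw [CoxeterSystem.IsRightDescent, h2]
      omega
    · obtain ⟨hs', ht'⟩ := hk.resolve_left hk'.ne
      obtain ⟨c, d, hc, hd, he⟩ := rep_alternatingWord_root ha cs hst hk'
      rw [hv, map_mul, Module.End.mul_apply, he, map_add, map_smul, map_smul]
      exact add_nonneg (smul_nonneg hc (ih _ (by omega) hs' rfl)) (smul_nonneg hd (ih _ (by omega) ht' rfl))

theorem rep_root_nonpos {w : W} {s : B} (h : cs.IsRightDescent w s) :
    rep ha cs w (root s) ≤ 0 := by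
  have h1 := rep_root_nonneg ha cs ((cs.isRightDescent_iff_not_isRightDescent_mul).1 h)
  rwa [map_mul, Module.End.mul_apply, rep_simple_root_self, map_neg, Left.nonneg_neg_iff] at h1

end CartanRep

end

section

open Module

namespace CoxeterSystem

variable {B W : Type*} [Group W] {M : CoxeterMatrix B} (cs : CoxeterSystem M W)

/-- The family `T` satisfies the braid relations of the Coxeter matrix `M`. -/
def IsBraid {A : Type*} [Monoid A] (M : CoxeterMatrix B) (T : B → A) : Prop :=
  ∀ s t, s ≠ t → ((alternatingWord s t (M s t)).map T).prod = ((alternatingWord t s (M s t)).map T).prod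

variable {cs} in
theorem IsReduced.of_concat {ω : List B} {s : B} (h : cs.IsReduced (ω.concat s)) : cs.IsReduced ω := by
  have := h.take ω.length
  simpa [List.concat_eq_append] using this

variable {cs} in
theorem IsReduced.isRightDescent_concat {ω : List B} {s : B} (h : cs.IsReduced (ω.concat s)) :
    cs.IsRightDescent (cs.wordProd (ω.concat s)) s := by
  have h1 := h.of_concat.eq
  have h2 := h.eq
  rw [IsRightDescent, wordProd_concat, simple_mul_simple_cancel_right, h1, ← wordProd_concat, h2]
  simp

variable {cs} in
theorem IsReduced.concat {ω : List B} {s : B} (h : cs.IsReduced ω)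
    (hs : ¬ cs.IsRightDescent (cs.wordProd ω) s) : cs.IsReduced (ω.concat s) := by
  rw [IsReduced, wordProd_concat, (cs.not_isRightDescent_iff).1 hs, h.eq]
  simp

variable {cs} in
theorem IsReduced.append_of_length {ω ω' : List B} (h : cs.IsReduced ω)
    (hl : cs.length (cs.wordProd ω * cs.wordProd ω') = cs.length (cs.wordProd ω) + ω'.length) :
    cs.IsReduced (ω ++ ω') := by
  rw [IsReduced, wordProd_append, hl, h.eq, List.length_append]

/-- **Matsumoto's theorem**. -/
theorem prod_map_eq_of_isReduced [Fintype B] {a : B → B → ℤ} (ha : IsCartanOf M a) {A : Type*} [Monoid A] {T : B → A} (hT : IsBraid M T)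
    {ω ω' : List B} (h : cs.IsReduced ω) (h' : cs.IsReduced ω')
    (he : cs.wordProd ω = cs.wordProd ω') : (ω.map T).prod = (ω'.map T).prod := by
  classical
  have hM : ∀ s t, s ≠ t → 1 ≤ M s t := fun s t hst => by have := ha.off s t hst; omega
  induction hn : ω.length using Nat.strong_induction_on generalizing ω ω' with
  | _ n ih =>
    have hl : ω.length = ω'.length := by rw [← h.eq, ← h'.eq, he]
    rcases List.eq_nil_or_concat ω with rfl | ⟨σ, s, rfl⟩
    · have : ω' = [] := by simpa using hl.symm
      rw [this]
    rcases List.eq_nil_or_concat ω' with rfl | ⟨σ', t, rfl⟩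
    · simp at hl
    have hn' : σ.length < n := by simp at hn; omega
    have hn'' : σ'.length < n := by simp at hn hl; omega
    have same : ∀ (τ τ' : List B) (u : B), τ.length < n → cs.IsReduced (τ.concat u) →
        cs.IsReduced (τ'.concat u) → cs.wordProd (τ.concat u) = cs.wordProd (τ'.concat u) →
        ((τ.concat u).map T).prod = ((τ'.concat u).map T).prod := by
      intro τ τ' u hτ h1 h2 h3
      rw [wordProd_concat, wordProd_concat, mul_left_inj] at h3
      simp only [List.concat_eq_append, List.map_append, List.prod_append]
      rw [ih _ hτ h1.of_concat h2.of_concat h3 rfl]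
    by_cases hst : s = t
    · subst hst
      exact same σ σ' s hn' h h' he
    set w := cs.wordProd (σ.concat s) with hw
    have ds : cs.IsRightDescent w s := h.isRightDescent_concat
    have dt : cs.IsRightDescent w t := he ▸ h'.isRightDescent_concat
    obtain ⟨k, v, hk1, hkM, hv, hlv, hk⟩ := cs.exists_eq_mul_alternatingWord (hM s t hst) dt
    have hkm : k = M s t := by
      by_contra hkm
      obtain ⟨hvs, hvt⟩ := hk.resolve_left hkm
      obtain ⟨c, d, hc, hd, hcd⟩ := CartanRep.rep_alternatingWord_root ha cs hst
        (lt_of_le_of_ne hkM hkm)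
      refine CartanRep.rep_root_ne_zero ha cs w s
        (le_antisymm (CartanRep.rep_root_nonpos ha cs ds) ?_)
      rw [hv, map_mul, Module.End.mul_apply, hcd, map_add, map_smul, map_smul]
      exact add_nonneg (smul_nonneg hc (CartanRep.rep_root_nonneg ha cs hvs))
        (smul_nonneg hd (CartanRep.rep_root_nonneg ha cs hvt))
    subst hkm
    obtain ⟨ν, hν, rfl⟩ := cs.exists_isReduced v
    have hb : cs.wordProd (alternatingWord s t (M s t)) = cs.wordProd (alternatingWord t s (M s t)) := by
      have := cs.wordProd_braidWord_eq s t
      rwa [braidWord, braidWord, M.symmetric t s] at this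
    obtain ⟨m, hm⟩ : ∃ m, M s t = m + 1 := ⟨M s t - 1, by have := hM s t hst; omega⟩
    have r1 : cs.IsReduced (ν ++ alternatingWord s t (M s t)) :=
      hν.append_of_length (by rw [← hv, hlv, length_alternatingWord])
    have r2 : cs.IsReduced (ν ++ alternatingWord t s (M s t)) :=
      hν.append_of_length (by rw [← hb, ← hv, hlv, length_alternatingWord])
    have e1 : w = cs.wordProd (ν ++ alternatingWord s t (M s t)) := by rw [wordProd_append, hv]
    have e2 : w = cs.wordProd (ν ++ alternatingWord t s (M s t)) := by rw [wordProd_append, hv, hb]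
    have f1 : ∀ i j, ν ++ alternatingWord i j (m + 1) = (ν ++ alternatingWord j i m).concat j := by
      intro i j; rw [alternatingWord_succ]; simp
    have g1 : ((ν ++ alternatingWord s t (M s t)).map T).prod =
        ((ν ++ alternatingWord t s (M s t)).map T).prod := by
      rw [List.map_append, List.map_append, List.prod_append, List.prod_append, hT s t hst]
    rw [hm, f1] at r1 r2 e1 e2 g1
    rw [f1] at g1
    rw [same _ _ _ hn' h r2 e2, ← g1]
    exact same _ _ _ (by have := r1.eq; rw [← e1] at this; have h5 := h.eq; rw [← hw] at h5; simp at *; omega) r1 h' (e1.symm.trans he)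

end CoxeterSystem

end

section

open Module

namespace CoxeterSystem

variable {B W : Type*} [Group W] {M : CoxeterMatrix B} (cs : CoxeterSystem M W)

theorem isReduced_alternatingWord [Fintype B] {a : B → B → ℤ} (ha : IsCartanOf M a)
    {s t : B} (hst : s ≠ t) {k : ℕ} (hk : k ≤ M s t) : cs.IsReduced (alternatingWord s t k) := by
  classical
  induction k generalizing s t with
  | zero => simp [alternatingWord, IsReduced]
  | succ k ih =>
    rw [alternatingWord_succ]
    rw [M.symmetric] at hk
    refine (ih hst.symm (by omega)).concat fun hd => ?_
    obtain ⟨c, d, hc, hd', hcd⟩ := CartanRep.rep_alternatingWord_root ha cs hst.symm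
        (Nat.lt_of_succ_le hk)
    refine CartanRep.rep_root_ne_zero ha cs _ t
        (le_antisymm (CartanRep.rep_root_nonpos ha cs hd) ?_)
    rw [hcd]
    exact add_nonneg (smul_nonneg hc (Pi.single_nonneg.2 zero_le_one))
        (smul_nonneg hd' (Pi.single_nonneg.2 zero_le_one))

/-- A product of values of `T` along a reduced word of `w`. -/
noncomputable def redProd {A : Type*} [Monoid A] (T : B → A) (w : W) : A :=
  ((cs.exists_isReduced w).choose.map T).prod

theorem exists_redProd_eq (w : W) : ∃ ω, cs.IsReduced ω ∧ w = cs.wordProd ω ∧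
    ∀ {A : Type _} [Monoid A] (T : B → A), cs.redProd T w = (ω.map T).prod :=
  ⟨_, (cs.exists_isReduced w).choose_spec.1, (cs.exists_isReduced w).choose_spec.2, fun _ => rfl⟩

section

variable [Fintype B] {a : B → B → ℤ} (ha : IsCartanOf M a) {A : Type*} [Monoid A] {T : B → A}

include ha in
theorem redProd_wordProd (hT : IsBraid M T) {ω : List B} (h : cs.IsReduced ω) :
    cs.redProd T (cs.wordProd ω) = (ω.map T).prod := by
  obtain ⟨ω', h', he, hp⟩ := cs.exists_redProd_eq (cs.wordProd ω)
  rw [hp, cs.prod_map_eq_of_isReduced ha hT h h' he]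

include ha in
theorem redProd_simple_mul (hT : IsBraid M T) {w : W} {s : B} (h : ¬ cs.IsLeftDescent w s) :
    cs.redProd T (cs.simple s * w) = T s * cs.redProd T w := by
  obtain ⟨ω, hr, he, hp⟩ := cs.exists_redProd_eq w
  have : cs.IsReduced (s :: ω) := by
    rw [IsReduced, wordProd_cons, ← he, (cs.not_isLeftDescent_iff).1 h, he, hr.eq, List.length_cons]
  rw [hp, he, ← wordProd_cons, cs.redProd_wordProd ha hT this, List.map_cons, List.prod_cons]

omit [Fintype B] in
theorem redProd_one : cs.redProd T 1 = 1 := by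
  obtain ⟨ω, hr, he, hp⟩ := cs.exists_redProd_eq (1 : W)
  have : ω = [] := by rw [← List.length_eq_zero_iff, ← hr.eq, ← he, cs.length_one]
  rw [hp, this]; simp

omit [Fintype B] in
theorem map_redProd {A' F : Type*} [Monoid A'] [FunLike F A A'] [MonoidHomClass F A A'] (φ : F) (w : W) :
    φ (cs.redProd T w) = cs.redProd (fun s => φ (T s)) w := by
  rw [redProd, map_list_prod, List.map_map]; rfl

end

section Regular

variable [Fintype W] [DecidableEq W]

/-- The quadratic relations of the Hecke algebra with parameter `q`. -/
def IsQuadratic {R A : Type*} [CommRing R] [Ring A] [Algebra R A] (q : R) (T : B → A) : Prop :=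
  ∀ s, T s ^ 2 = q • 1 + (q - 1) • T s

variable {R : Type*} [CommRing R]

open Classical in
/-- The matrix of left multiplication by the generator `s` on the standard basis of the Hecke
algebra with parameter `q`. -/
noncomputable def regMat (q : R) (s : B) : Matrix W W R := fun x w =>
  if cs.IsLeftDescent w s then (if x = cs.simple s * w then q else 0) + (if x = w then q - 1 else 0)
  else if x = cs.simple s * w then 1 else 0

omit [Fintype W] in
theorem map_regMat {R' : Type*} [CommRing R'] (φ : R →+* R') (q : R) (s : B) :
    (cs.regMat q s).map φ = cs.regMat (φ q) s := by
  ext x w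
  simp only [regMat, Matrix.map_apply]
  split_ifs <;> simp

theorem isQuadratic_regMat (q : R) : IsQuadratic q (cs.regMat q) := by
  intro s
  ext x w
  rw [pow_two, Matrix.mul_apply]
  by_cases h : cs.IsLeftDescent w s
  · have h' := (cs.isLeftDescent_iff_not_isLeftDescent_mul).1 h
    have e : ∀ y, cs.regMat q s y w = (if y = cs.simple s * w then q else 0) +
      (if y = w then q - 1 else 0) := fun y => by rw [regMat, if_pos h]
    simp only [e, mul_add, mul_ite, mul_zero, Finset.sum_add_distrib, Finset.sum_ite_eq',
      Finset.mem_univ, if_true, Matrix.add_apply, Matrix.smul_apply, Matrix.one_apply, smul_eq_mul]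
    rw [regMat, if_neg h', simple_mul_simple_cancel_left]
    split_ifs <;> ring
  · have h' : cs.IsLeftDescent (cs.simple s * w) s := by
      by_contra hc
      exact h ((cs.isLeftDescent_iff_not_isLeftDescent_mul).2 hc)
    have e : ∀ y, cs.regMat q s y w = (if y = cs.simple s * w then 1 else 0) :=
      fun y => by rw [regMat, if_neg h]
    simp only [e, mul_ite, mul_zero, Finset.sum_ite_eq',
      Finset.mem_univ, if_true, Matrix.add_apply, Matrix.smul_apply, Matrix.one_apply, smul_eq_mul]
    rw [regMat, if_pos h', simple_mul_simple_cancel_left]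
    split_ifs <;> ring

theorem prod_regMat_one_apply (q : R) {ω : List B} (h : cs.IsReduced ω) (v : W) :
    (ω.map (cs.regMat q)).prod 1 v = if v = (cs.wordProd ω)⁻¹ then q ^ ω.length else 0 := by
  induction ω using List.reverseRecOn generalizing v with
  | nil => simp [Matrix.one_apply, eq_comm]
  | append_singleton ω s ih =>
    rw [← List.concat_eq_append] at h
    have h1 := h.isRightDescent_concat
    rw [← cs.isLeftDescent_inv_iff] at h1
    set u := (cs.wordProd (ω.concat s))⁻¹ with hu
    have hu' : (cs.wordProd ω)⁻¹ = cs.simple s * u := by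
      rw [hu, wordProd_concat, mul_inv_rev, inv_simple, simple_mul_simple_cancel_left]
    rw [← List.concat_eq_append, ← hu, List.concat_eq_append, List.map_append, List.prod_append, Matrix.mul_apply]
    simp only [ih h.of_concat, hu', ite_mul, zero_mul, Finset.sum_ite_eq', Finset.mem_univ, if_true,
      List.map_cons, List.map_nil, List.prod_singleton]
    have h2 := (cs.isLeftDescent_iff_not_isLeftDescent_mul).1 h1
    rw [regMat, List.length_append, List.length_singleton, pow_succ]
    by_cases hv : v = u
    · subst hv
      have : ¬ (cs.simple s * u = u) := fun he => cs.length_simple_mul_ne u s (by rw [he])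
      rw [if_pos h1, if_pos rfl, if_neg this, if_pos rfl, add_zero]
    · have n1 : ¬ (cs.simple s * u = cs.simple s * v) := by simpa using Ne.symm hv
      rw [if_neg n1, if_neg n1, if_neg hv]
      split_ifs with c1 c2
      · exact absurd (c2 ▸ c1) h2
      · simp
      · simp

theorem prod_regMat_apply_one  (q : R) {ω : List B} (h : cs.IsReduced ω) (x : W) :
    (ω.map (cs.regMat q)).prod x 1 = if x = cs.wordProd ω then 1 else 0 := by
  induction ω generalizing x with
  | nil => simp [Matrix.one_apply]
  | cons s ω ih =>
    have h2 : cs.IsReduced ω := by simpa using h.drop 1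
    have h1 : ¬ cs.IsLeftDescent (cs.wordProd ω) s := by
      rw [IsLeftDescent, ← wordProd_cons, h.eq, h2.eq]; simp
    rw [List.map_cons, List.prod_cons, Matrix.mul_apply]
    simp only [ih h2, mul_ite, mul_one, mul_zero, Finset.sum_ite_eq', Finset.mem_univ, if_true]
    rw [regMat, if_neg h1, wordProd_cons]

section Algebra

variable [Fintype B] {a : B → B → ℤ} (ha : IsCartanOf M a) {A : Type*} [Ring A] [Algebra R A] {T : B → A}
  {q : R}

include ha in
theorem mul_redProd (hT : IsBraid M T) (hq : IsQuadratic q T) (s : B) (w : W) :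
    T s * cs.redProd T w = ∑ x, cs.regMat q s x w • cs.redProd T x := by
  classical
  by_cases h : cs.IsLeftDescent w s
  · have h' := (cs.isLeftDescent_iff_not_isLeftDescent_mul).1 h
    have e : ∀ y, cs.regMat q s y w = (if y = cs.simple s * w then q else 0) +
      (if y = w then q - 1 else 0) := fun y => by rw [regMat, if_pos h]
    simp only [e, add_smul, ite_smul, zero_smul, Finset.sum_add_distrib, Finset.sum_ite_eq',
      Finset.mem_univ, if_true]
    have h2 := cs.redProd_simple_mul ha hT h'
    rw [simple_mul_simple_cancel_left] at h2
    rw [h2, ← mul_assoc, ← pow_two, hq s, add_mul, smul_mul_assoc, smul_mul_assoc, one_mul]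
  · have e : ∀ y, cs.regMat q s y w = (if y = cs.simple s * w then 1 else 0) :=
      fun y => by rw [regMat, if_neg h]
    simp only [e, ite_smul, zero_smul, one_smul, Finset.sum_ite_eq', Finset.mem_univ, if_true]
    rw [cs.redProd_simple_mul ha hT h]

include ha in
theorem prod_mul_redProd (hT : IsBraid M T) (hq : IsQuadratic q T) (ω : List B) (w : W) :
    (ω.map T).prod * cs.redProd T w =
      ∑ x, (ω.map (cs.regMat q)).prod x w • cs.redProd T x := by
  induction ω with
  | nil => simp [Matrix.one_apply]
  | cons s ω ih =>
    rw [List.map_cons, List.prod_cons, mul_assoc, ih, Finset.mul_sum]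
    simp only [mul_smul_comm, cs.mul_redProd ha hT hq, List.map_cons, List.prod_cons, Matrix.mul_apply,
      Finset.smul_sum, Finset.sum_smul, smul_smul]
    rw [Finset.sum_comm]
    simp only [mul_comm]

include ha in
theorem redProd_mul_redProd (hT : IsBraid M T) (hq : IsQuadratic q T) (u w : W) :
    cs.redProd T u * cs.redProd T w =
      ∑ x, cs.redProd (cs.regMat q) u x w • cs.redProd T x :=
  cs.prod_mul_redProd ha hT hq _ w

end Algebra

theorem redProd_regMat_one_apply (q : R) (u v : W) :
    cs.redProd (cs.regMat q) u 1 v = if v = u⁻¹ then q ^ cs.length u else 0 := by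
  obtain ⟨ω, hr, he, hp⟩ := cs.exists_redProd_eq u
  have := cs.prod_regMat_one_apply q hr v
  rw [← he, ← hr.eq, ← he] at this
  rw [hp, this]

theorem redProd_regMat_apply_one  (q : R) (u x : W) :
    cs.redProd (cs.regMat q) u x 1 = if x = u then 1 else 0 := by
  obtain ⟨ω, hr, he, hp⟩ := cs.exists_redProd_eq u
  have := cs.prod_regMat_apply_one q hr x
  rw [← he] at this
  rw [hp, this]

end Regular

end CoxeterSystem

end

section

open Polynomial

namespace Polynomial

/-- Schur: the values of a nonconstant integer polynomial have arbitrarily large prime divisors. -/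
theorem exists_prime_gt_dvd_eval {F : ℤ[X]} (hF : F.natDegree ≠ 0) (N : ℕ) :
    ∃ p : ℕ, p.Prime ∧ N < p ∧ ∃ x : ℤ, (p : ℤ) ∣ F.eval x := by
  set c := F.coeff 0 with hc
  by_cases h0 : c = 0
  · obtain ⟨p, hp, hp'⟩ := Nat.exists_infinite_primes (N + 1)
    exact ⟨p, hp', hp, 0, by rw [← coeff_zero_eq_eval_zero, ← hc, h0]; exact dvd_zero _⟩
  obtain ⟨G, hG⟩ : ∃ G, F = X * G + C c := ⟨F.divX, (X_mul_divX_add F).symm⟩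
  have hfin : ∀ b : ℤ, {y : ℤ | F.eval y = b}.Finite := by
    intro b
    have hne : F - C b ≠ 0 := by
      intro h
      rw [sub_eq_zero] at h
      exact hF (by rw [h, natDegree_C])
    refine (F - C b).rootSet_finite ℤ |>.subset fun y hy => ?_
    rw [mem_rootSet_of_ne hne]
    simpa [sub_eq_zero] using hy
  have hinj : Function.Injective (fun y : ℤ => c * (N.factorial : ℤ) * y) := by
    intro y z h
    have : c * (N.factorial : ℤ) ≠ 0 := mul_ne_zero h0 (by exact_mod_cast N.factorial_ne_zero)
    exact mul_left_cancel₀ this h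
  obtain ⟨y, hy⟩ := (((hfin c).union (hfin (-c))).preimage hinj.injOn).exists_notMem
  simp only [Set.mem_preimage, Set.mem_union, Set.mem_ofPred_eq, not_or] at hy
  set t := c * (N.factorial : ℤ) * y with ht
  have hval : F.eval t = c * (1 + N.factorial * (y * G.eval t)) := by
    rw [hG]
    simp only [eval_add, eval_mul, eval_X, eval_C]
    rw [ht]; ring
  set e := 1 + (N.factorial : ℤ) * (y * G.eval t) with he
  have he1 : e.natAbs ≠ 1 := by
    intro h
    rcases Int.natAbs_eq e with h' | h' <;> rw [h] at h'
    · exact hy.1 (by rw [hval, h']; simp)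
    · exact hy.2 (by rw [hval, h']; simp)
  obtain ⟨p, hp, hpe⟩ := Nat.exists_prime_and_dvd he1
  have hpe' : (p : ℤ) ∣ e := Int.natCast_dvd.2 hpe
  refine ⟨p, hp, ?_, t, hval ▸ hpe'.mul_left c⟩
  by_contra hle
  have h1 : (p : ℤ) ∣ N.factorial := by exact_mod_cast hp.dvd_factorial.2 (not_lt.1 hle)
  have h2 : (p : ℤ) ∣ 1 := by
    have := dvd_sub hpe' (h1.mul_right (y * G.eval t))
    rwa [he, add_sub_cancel_right] at this
  have := Int.natCast_dvd_natCast.1 (by exact_mod_cast h2 : (p : ℤ) ∣ (1 : ℕ))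
  exact hp.one_lt.ne' (Nat.dvd_one.1 this)

theorem exists_int_smul_eq_map (m : ℚ[X]) : ∃ c : ℤ, c ≠ 0 ∧ ∃ F : ℤ[X], F.map (Int.castRingHom ℚ) = C (c : ℚ) * m := by
  obtain ⟨b, hb0, hb⟩ := IsLocalization.integerNormalization_spec (nonZeroDivisors ℤ) m
  refine ⟨b, nonZeroDivisors.ne_zero hb0, IsLocalization.integerNormalization (nonZeroDivisors ℤ) m, ?_⟩
  rw [← smul_eq_C_mul]
  have : algebraMap ℤ ℚ = Int.castRingHom ℚ := rfl
  rw [← this, hb]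
  ext i
  simp

/-- If nonvanishing of `g` forces nonvanishing of `f` at all points of all large prime fields, then
it does so over every field of characteristic zero. -/
theorem aeval_ne_zero_of_zmod {f g : ℤ[X]} (N : ℕ)
    (h : ∀ p : ℕ, p.Prime → N < p → ∀ x : ℤ, ¬ (p : ℤ) ∣ g.eval x → ¬ (p : ℤ) ∣ f.eval x)
    {k : Type*} [Field k] [CharZero k] {ξ : k} (hg : aeval ξ g ≠ 0) : aeval ξ f ≠ 0 := by
  intro hf
  by_cases hf0 : f = 0
  · have hg0 : g ≠ 0 := by rintro rfl; simp at hg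
    obtain ⟨x, hx⟩ := (g.rootSet_finite ℤ).exists_notMem
    rw [mem_rootSet_of_ne hg0] at hx
    obtain ⟨p, hp, hp'⟩ := Nat.exists_infinite_primes (N + (g.eval x).natAbs + 1)
    refine h p hp' (by omega) x (fun hd => ?_) (by simp [hf0])
    have := Nat.le_of_dvd (Int.natAbs_pos.2 (by simpa using hx)) (Int.natCast_dvd.1 hd)
    omega
  have hQ : ∀ u : ℤ[X], aeval ξ (u.map (Int.castRingHom ℚ)) = aeval ξ u := fun u => by
    have := aeval_map_algebraMap ℚ ξ u
    simpa using this
  have hint : IsIntegral ℚ ξ := by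
    rw [← isAlgebraic_iff_isIntegral]
    refine ⟨f.map (Int.castRingHom ℚ), ?_, by rw [hQ, hf]⟩
    rwa [Ne, Polynomial.map_eq_zero_iff (Int.cast_injective)]
  obtain ⟨h1, hh1⟩ := minpoly.dvd ℚ ξ (p := f.map (Int.castRingHom ℚ)) (by rw [hQ, hf])
  have hcop : IsCoprime (minpoly ℚ ξ) (g.map (Int.castRingHom ℚ)) := by
    rw [(minpoly.irreducible hint).coprime_iff_not_dvd]
    rintro ⟨q, hq⟩
    apply hg
    rw [← hQ, hq, map_mul, minpoly.aeval, zero_mul]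
  obtain ⟨u, v, huv⟩ := hcop
  obtain ⟨c, hc, F, hF⟩ := exists_int_smul_eq_map (minpoly ℚ ξ)
  obtain ⟨c1, hc1, H, hH⟩ := exists_int_smul_eq_map h1
  obtain ⟨c2, hc2, U, hU⟩ := exists_int_smul_eq_map u
  obtain ⟨c3, hc3, V, hV⟩ := exists_int_smul_eq_map v
  have hinj : Function.Injective (Polynomial.map (Int.castRingHom ℚ)) :=
    Polynomial.map_injective _ Int.cast_injective
  have e1 : C (c * c1) * f = F * H := by
    apply hinj
    simp only [Polynomial.map_mul, hF, hH, hh1, map_C]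
    simp; ring
  have e2 : C (c * c2 * c3) = C c3 * (F * U) + C (c * c2) * (V * g) := by
    apply hinj
    simp only [Polynomial.map_mul, Polynomial.map_add, hF, hU, hV, map_C]
    have : C ((c : ℚ) * c2 * c3) = C ((c : ℚ) * c2 * c3) * (u * minpoly ℚ ξ + v * g.map (Int.castRingHom ℚ)) := by
      rw [huv, mul_one]
    simp only [map_mul, eq_intCast] at this ⊢
    rw [this]; ring
  have hdeg : F.natDegree ≠ 0 := by
    have : (F.map (Int.castRingHom ℚ)).natDegree = F.natDegree :=
      natDegree_map_eq_of_injective Int.cast_injective _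
    rw [← this, hF, natDegree_C_mul (by exact_mod_cast hc)]
    exact (minpoly.natDegree_pos hint).ne'
  obtain ⟨p, hp, hpN, x, hx⟩ := exists_prime_gt_dvd_eval hdeg (N + (c * c1).natAbs + (c * c2 * c3).natAbs)
  have hndvd : ∀ d : ℤ, d ≠ 0 → d.natAbs < p → ¬ (p : ℤ) ∣ d := by
    intro d hd hlt hdvd
    have := Nat.le_of_dvd (Int.natAbs_pos.2 hd) (Int.natCast_dvd.1 hdvd)
    omega
  have hpi : Prime (p : ℤ) := Nat.prime_iff_prime_int.1 hp
  refine h p hp (by omega) x (fun hgx => ?_) ?_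
  · have := congrArg (eval x) e2
    simp only [eval_add, eval_mul, eval_C] at this
    refine hndvd (c * c2 * c3) (by positivity) (by omega) ?_
    rw [this]
    exact dvd_add ((hx.mul_right _).mul_left _) ((hgx.mul_left _).mul_left _)
  · have := congrArg (eval x) e1
    simp only [eval_mul, eval_C] at this
    have h5 : (p : ℤ) ∣ c * c1 * eval x f := by rw [this]; exact hx.mul_right _
    exact (hpi.dvd_or_dvd h5).resolve_left (hndvd _ (by positivity) (by omega))

end Polynomial

end

section

open Module Polynomial

namespace CoxeterSystem

variable {B W : Type*} [Group W] [Fintype W] [DecidableEq W] {M : CoxeterMatrix B} (cs : CoxeterSystem M W)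

section Trace

variable [Fintype B] {a : B → B → ℤ} (ha : IsCartanOf M a) {R X : Type*} [CommRing R] [Fintype X]
  [DecidableEq X]

include ha in
theorem trace_redProd_mul_redProd {q : R} {A : B → Matrix X X R} (hT : IsBraid M A) (hq : IsQuadratic q A)
    (htr : ∀ w, w ≠ 1 → (cs.redProd A w).trace = 0) (u v : W) :
    (cs.redProd A u * cs.redProd A v).trace =
      if v = u⁻¹ then q ^ cs.length u * Fintype.card X else 0 := by
  rw [cs.redProd_mul_redProd ha hT hq, Matrix.trace_sum, Finset.sum_eq_single 1]
  · rw [Matrix.trace_smul, redProd_one, Matrix.trace_one, redProd_regMat_one_apply, smul_eq_mul,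
      ite_mul, zero_mul]
  · intro w _ hw
    rw [Matrix.trace_smul, htr w hw, smul_zero]
  · simp

end Trace

/-- Over `ℤ` there is a permutation-like matrix representation of the Hecke algebra with parameter `r`
whose character vanishes on all nontrivial standard basis elements. -/
def HasBuilding (r : ℕ) : Prop :=
  ∃ (X : Type) (_ : Fintype X) (_ : DecidableEq X) (A : B → Matrix X X ℤ),
    IsBraid M A ∧ IsQuadratic (r : ℤ) A ∧ (∀ w : W, w ≠ 1 → (cs.redProd A w).trace = 0) ∧
      (Fintype.card X : ℤ) = ∑ w : W, (r : ℤ) ^ cs.length w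

variable [Fintype B] {a : B → B → ℤ} (ha : IsCartanOf M a)

include ha in
theorem HasBuilding.isBraid_regMat {r : ℕ} (hr : r ≠ 0) (h : cs.HasBuilding r) :
    IsBraid M (cs.regMat (r : ℤ)) := by
  obtain ⟨X, _, _, A, hT, hq, htr, hcard⟩ := h
  have hr' : (0 : ℤ) < r := by positivity
  have hc : (Fintype.card X : ℤ) ≠ 0 := by
    rw [hcard]
    exact (Finset.sum_pos (fun w _ => by positivity) ⟨1, Finset.mem_univ _⟩).ne'
  intro s t hst
  ext y w
  rw [← sub_eq_zero]
  set d : W → ℤ := fun x => ((alternatingWord s t (M s t)).map (cs.regMat (r : ℤ))).prod x w -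
    ((alternatingWord t s (M s t)).map (cs.regMat (r : ℤ))).prod x w with hd
  have h0 : ∑ x, d x • cs.redProd A x = 0 := by
    simp only [hd, sub_smul, Finset.sum_sub_distrib]
    rw [← cs.prod_mul_redProd ha hT hq, ← cs.prod_mul_redProd ha hT hq, hT s t hst, sub_self]
  have h1 := congrArg (fun N => (N * cs.redProd A y⁻¹).trace) h0
  simp only [Finset.sum_mul, Matrix.trace_sum, smul_mul_assoc, Matrix.trace_smul,
    cs.trace_redProd_mul_redProd ha hT hq htr, inv_inj, smul_eq_mul, mul_ite, mul_zero, zero_mul,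
    Matrix.trace_zero, Finset.sum_ite_eq, Finset.mem_univ, if_true] at h1
  exact (mul_eq_zero.1 h1).resolve_right (mul_ne_zero (pow_ne_zero _ hr'.ne') hc)

include ha in
theorem isBraid_regMat (C : ℕ) (h : ∀ r : ℕ, r.Prime → C < r → cs.HasBuilding r)
    {R : Type*} [CommRing R] (q : R) : IsBraid M (cs.regMat q) := by
  have key : IsBraid M (cs.regMat (X : ℤ[X])) := by
    intro s t hst
    ext1 x w
    refine Polynomial.eq_of_infinite_eval_eq _ _ (Set.Infinite.mono (s := (fun n : ℕ => (n : ℤ)) '' {r | r.Prime ∧ C < r}) ?_ ?_)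
    · rintro _ ⟨r, ⟨hr, hC⟩, rfl⟩
      have hev : ∀ ω : List B, ((ω.map (cs.regMat (X : ℤ[X]))).prod x w).eval (r : ℤ) =
          (ω.map (cs.regMat (r : ℤ))).prod x w := by
        intro ω
        have : (ω.map (cs.regMat (r : ℤ))).prod =
            ((evalRingHom (r : ℤ)).mapMatrix) (ω.map (cs.regMat (X : ℤ[X]))).prod := by
          rw [map_list_prod, List.map_map]
          congr 2
          ext1 s
          rw [Function.comp_apply, RingHom.mapMatrix_apply, map_regMat, coe_evalRingHom, eval_X]
        rw [this]; simp
      show eval _ _ = eval _ _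
      rw [hev, hev, (h r hr hC).isBraid_regMat cs ha hr.ne_zero s t hst]
    · refine Set.Infinite.image (Nat.cast_injective.injOn) ?_
      have : {r : ℕ | r.Prime ∧ C < r} = {r | r.Prime} \ Set.Iic C := by
        ext; simp
      rw [this]
      exact Nat.infinite_setOfPred_prime.sdiff (Set.finite_Iic C)
  intro s t hst
  have := congrArg (eval₂RingHom (Int.castRingHom R) q).mapMatrix (key s t hst)
  rw [map_list_prod, map_list_prod, List.map_map, List.map_map] at this
  convert this using 4 <;>
  · ext1 s
    rw [Function.comp_apply, RingHom.mapMatrix_apply, map_regMat, coe_eval₂RingHom, eval₂_X]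

end CoxeterSystem

end

section

open Module Polynomial

theorem braidWord_succ {A : Type*} [Monoid A] (x y : A) (m : ℕ) :
    braidWord x y (m + 1) = x * braidWord y x m := by
  simp only [braidWord, List.range_succ_eq_map, List.map_cons, List.map_map, List.prod_cons, Even.zero, if_true]
  congr 3
  ext1 i
  simp only [Function.comp_apply, Nat.even_add_one, Nat.succ_eq_add_one]
  split_ifs <;> simp_all

theorem prod_map_alternatingWord {A B : Type*} [Monoid A] (T : B → A) (s t : B) (m : ℕ) :
    ((CoxeterSystem.alternatingWord s t m).map T).prod =
      if Even m then braidWord (T s) (T t) m else braidWord (T t) (T s) m := by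
  induction m with
  | zero => simp [CoxeterSystem.alternatingWord, braidWord]
  | succ m ih =>
    rw [CoxeterSystem.alternatingWord_succ', List.map_cons, List.prod_cons, ih]
    by_cases h : Even m
    · simp [h, Nat.even_add_one, braidWord_succ]
    · simp [h, Nat.even_add_one, braidWord_succ]

theorem isBraid_iff {A B : Type*} [Monoid A] {M : CoxeterMatrix B} {T : B → A} :
    CoxeterSystem.IsBraid M T ↔
      ∀ s t, s ≠ t → braidWord (T s) (T t) (M s t) = braidWord (T t) (T s) (M s t) := by
  refine forall₃_congr fun s t _ => ?_
  rw [prod_map_alternatingWord, prod_map_alternatingWord]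
  split_ifs
  · rfl
  · exact eq_comm

/-- The Iwahori–Hecke algebra with parameter `q`. -/
abbrev HeckeAlg (K : Type*) [Field K] {B : Type*} (M : CoxeterMatrix B) (q : K) := RingQuot (heckeRel K M q)

namespace HeckeAlg

variable {K : Type*} [Field K] {B : Type*} (M : CoxeterMatrix B) (q : K)

/-- The standard generators of the Hecke algebra. -/
def gen (s : B) : HeckeAlg K M q := RingQuot.mkAlgHom K _ (FreeAlgebra.ι K s)

theorem map_braidWord {A A' F : Type*} [Monoid A] [Monoid A'] [FunLike F A A'] [MonoidHomClass F A A']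
    (φ : F) (x y : A) (m : ℕ) : φ (braidWord x y m) = braidWord (φ x) (φ y) m := by
  induction m generalizing x y with
  | zero => simp [braidWord]
  | succ m ih => rw [braidWord_succ, braidWord_succ, map_mul, ih]

theorem isBraid_gen : CoxeterSystem.IsBraid M (gen M q) := by
  rw [isBraid_iff]
  intro s t hst
  have := RingQuot.mkAlgHom_rel K (s := heckeRel K M q) (Or.inr ⟨s, t, hst, rfl, rfl⟩)
  rwa [map_braidWord, map_braidWord] at this

theorem isQuadratic_gen : CoxeterSystem.IsQuadratic q (gen M q) := by
  intro s
  have := RingQuot.mkAlgHom_rel K (s := heckeRel K M q) (Or.inl ⟨s, rfl, rfl⟩)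
  simp only [map_pow, map_add, map_smul, map_one] at this
  exact this

variable {M q} in
/-- The homomorphism from the Hecke algebra given by a family satisfying its relations. -/
def lift {A : Type*} [Ring A] [Algebra K A] {T : B → A} (hT : CoxeterSystem.IsBraid M T)
    (hq : CoxeterSystem.IsQuadratic q T) : HeckeAlg K M q →ₐ[K] A :=
  RingQuot.liftAlgHom K ⟨FreeAlgebra.lift K T, by
    rintro _ _ (⟨s, rfl, rfl⟩ | ⟨s, t, hst, rfl, rfl⟩)
    · simpa using hq s
    · rw [map_braidWord, map_braidWord, FreeAlgebra.lift_ι_apply, FreeAlgebra.lift_ι_apply]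
      exact isBraid_iff.1 hT s t hst⟩

variable {M q} in
theorem lift_gen {A : Type*} [Ring A] [Algebra K A] {T : B → A} (hT : CoxeterSystem.IsBraid M T)
    (hq : CoxeterSystem.IsQuadratic q T) (s : B) : lift hT hq (gen M q s) = T s := by
  simp [lift, gen]

variable {M q} in
theorem lift_redProd {W : Type*} [Group W] (cs : CoxeterSystem M W)
    {A : Type*} [Ring A] [Algebra K A] {T : B → A} (hT : CoxeterSystem.IsBraid M T)
    (hq : CoxeterSystem.IsQuadratic q T) (w : W) :
    lift hT hq (cs.redProd (gen M q) w) = cs.redProd T w := by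
  rw [cs.map_redProd]
  simp only [lift_gen]

section

variable {W : Type*} [Group W] [Fintype W] [DecidableEq W] [Fintype B] (cs : CoxeterSystem M W)
  {a : B → B → ℤ} (ha : IsCartanOf M a)

include ha in
theorem span_redProd : Submodule.span K (Set.range (cs.redProd (gen M q))) = ⊤ := by
  set S := Submodule.span K (Set.range (cs.redProd (gen M q))) with hS
  have hmul : ∀ (x : FreeAlgebra K B) (y : HeckeAlg K M q), y ∈ S → RingQuot.mkAlgHom K _ x * y ∈ S := by
    intro x
    induction x using FreeAlgebra.induction with
    | grade0 r =>
      intro y hy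
      rw [AlgHom.commutes, ← Algebra.smul_def]
      exact S.smul_mem r hy
    | grade1 s =>
      intro y hy
      change gen M q s * y ∈ S
      induction hy using Submodule.span_induction with
      | mem y hy =>
        obtain ⟨w, rfl⟩ := hy
        rw [cs.mul_redProd ha (isBraid_gen M q) (isQuadratic_gen M q)]
        exact Submodule.sum_mem _ fun x _ => S.smul_mem _ (Submodule.subset_span ⟨x, rfl⟩)
      | zero => rw [mul_zero]; exact S.zero_mem
      | add y z _ _ hy hz => rw [mul_add]; exact S.add_mem hy hz
      | smul c y _ hy => rw [mul_smul_comm]; exact S.smul_mem c hy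
    | mul x x' hx hx' => intro y hy; rw [map_mul, mul_assoc]; exact hx _ (hx' _ hy)
    | add x x' hx hx' => intro y hy; rw [map_add, add_mul]; exact S.add_mem (hx _ hy) (hx' _ hy)
  rw [eq_top_iff]
  intro h _
  obtain ⟨x, rfl⟩ := RingQuot.mkAlgHom_surjective K (heckeRel K M q) h
  have := hmul x 1 (Submodule.subset_span ⟨1, cs.redProd_one⟩)
  rwa [mul_one] at this

include ha in
theorem exists_eq_sum (h : HeckeAlg K M q) : ∃ c : W → K, h = ∑ w, c w • cs.redProd (gen M q) w := by
  have : h ∈ Submodule.span K (Set.range (cs.redProd (gen M q))) := by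
    rw [span_redProd M q cs ha]; trivial
  obtain ⟨c, hc⟩ := (Submodule.mem_span_range_iff_exists_fun K).1 this
  exact ⟨c, hc.symm⟩

include cs ha in
theorem finite : Module.Finite K (HeckeAlg K M q) :=
  ⟨Submodule.fg_def.2 ⟨_, Set.finite_range _, span_redProd M q cs ha⟩⟩

end

end HeckeAlg

end

section

open Module Polynomial

/-- Every element of a finite monoid has an idempotent power. -/
theorem exists_pow_isIdempotentElem {A : Type*} [Monoid A] [Finite A] (a : A) :
    ∃ m : ℕ, 0 < m ∧ IsIdempotentElem (a ^ m) := by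
  obtain ⟨i, j, hij, h⟩ : ∃ i j : ℕ, i < j ∧ a ^ i = a ^ j := by
    obtain ⟨i, j, hij, h⟩ := Finite.exists_ne_map_eq_of_infinite (fun n : ℕ => a ^ n)
    rcases lt_or_gt_of_ne hij with h' | h'
    · exact ⟨i, j, h', h⟩
    · exact ⟨j, i, h', h.symm⟩
  obtain ⟨d, rfl⟩ := Nat.exists_eq_add_of_lt hij
  have key : ∀ k, i ≤ k → ∀ t, a ^ (k + (d + 1) * t) = a ^ k := by
    intro k hk t
    induction t with
    | zero => simp
    | succ t ih =>
      rw [← ih]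
      obtain ⟨c, hc⟩ := Nat.exists_eq_add_of_le (hk.trans (Nat.le_add_right k ((d + 1) * t)))
      rw [show k + (d + 1) * (t + 1) = (i + d + 1) + c by rw [mul_add, ← add_assoc, hc]; ring, hc,
        pow_add, ← h, ← pow_add]
  refine ⟨(d + 1) * (i + 1), by positivity, ?_⟩
  rw [IsIdempotentElem, ← pow_add]
  exact key _ (by nlinarith) (i + 1)

theorem Matrix.eq_zero_of_isIdempotentElem_of_trace_eq_zero {p : ℕ} [Fact p.Prime] {n : Type*} [Fintype n]
    [DecidableEq n] (hn : Fintype.card n < p) {E : Matrix n n (ZMod p)} (hE : IsIdempotentElem E)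
    (ht : E.trace = 0) : E = 0 := by
  have hE' : IsIdempotentElem (Matrix.toLin' E) := by
    rw [IsIdempotentElem, Module.End.mul_eq_comp, ← Matrix.toLin'_mul, hE.eq]
  have h1 := (LinearMap.IsIdempotentElem.isProj_range _ hE').trace
  rw [Matrix.trace_toLin'_eq, ht] at h1
  have h2 := (ZMod.natCast_eq_zero_iff _ _).1 h1.symm
  have h3 : finrank (ZMod p) (LinearMap.range (Matrix.toLin' E)) < p :=
    (Submodule.finrank_le _).trans_lt (by simpa using hn)
  have h4 := Nat.eq_zero_of_dvd_of_lt h2 h3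
  rw [Submodule.finrank_eq_zero, LinearMap.range_eq_bot] at h4
  simpa using h4

namespace HeckeAlg

variable {B W : Type*} [Group W] [Fintype W] [DecidableEq W] [Fintype B] {M : CoxeterMatrix B}
  (cs : CoxeterSystem M W) {a : B → B → ℤ} (ha : IsCartanOf M a)

/-- The Gram matrix of the trace form of the regular representation. -/
noncomputable def gram {R : Type*} [CommRing R] (q : R) : Matrix W W R :=
  Matrix.of fun v w => (cs.redProd (cs.regMat q) v * cs.redProd (cs.regMat q) w).trace

omit [Fintype B] in
theorem gram_map {R R' : Type*} [CommRing R] [CommRing R'] (φ : R →+* R') (q : R) :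
    (gram cs q).map φ = gram cs (φ q) := by
  ext v w
  simp only [gram, Matrix.map_apply, Matrix.of_apply]
  have h (w : W) : cs.redProd (cs.regMat (φ q)) w = (cs.redProd (cs.regMat q) w).map φ := by
    rw [← RingHom.mapMatrix_apply, cs.map_redProd]
    simp only [RingHom.mapMatrix_apply, cs.map_regMat]
  rw [h, h, ← Matrix.map_mul]
  exact AddMonoidHom.map_trace φ _

section

variable {K : Type*} [Field K] {q : K} (hreg : CoxeterSystem.IsBraid M (cs.regMat q))

/-- The regular representation of the Hecke algebra. -/
noncomputable def reg : HeckeAlg K M q →ₐ[K] Matrix W W K := lift hreg (cs.isQuadratic_regMat q)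

include ha in
theorem reg_injective : Function.Injective (reg cs hreg) := by
  rw [injective_iff_map_eq_zero]
  intro h hh
  obtain ⟨c, rfl⟩ := exists_eq_sum M q cs ha h
  refine Finset.sum_eq_zero fun x _ => ?_
  have := congrFun (congrFun hh x) 1
  simp only [map_sum, map_smul, reg, lift_redProd, Matrix.sum_apply, Matrix.smul_apply,
    cs.redProd_regMat_apply_one, smul_eq_mul, mul_ite, mul_one, mul_zero, Finset.sum_ite_eq,
    Finset.mem_univ, if_true, Matrix.zero_apply] at this
  rw [this, zero_smul]

omit [Fintype B] in
theorem trace_reg (c : W → K) (v : W) :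
    (reg cs hreg (cs.redProd (gen M q) v * ∑ w, c w • cs.redProd (gen M q) w)).trace =
      (gram cs q).mulVec c v := by
  simp only [map_mul, map_sum, map_smul, reg, lift_redProd, Finset.mul_sum, mul_smul_comm, Matrix.trace_sum,
    Matrix.trace_smul, Matrix.mulVec, dotProduct, gram, Matrix.of_apply, smul_eq_mul, mul_comm]

include hreg ha in
theorem isSemisimpleRing_of_det_ne_zero (hdet : (gram cs q).det ≠ 0) :
    IsSemisimpleRing (HeckeAlg K M q) := by
  have := finite M q cs ha
  have : IsArtinianRing (HeckeAlg K M q) := IsArtinianRing.of_finite K _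
  rw [IsArtinianRing.isSemisimpleRing_iff_jacobson, eq_bot_iff]
  intro h hh
  obtain ⟨n, hn⟩ := IsSemiprimaryRing.isNilpotent (R := HeckeAlg K M q)
  obtain ⟨c, rfl⟩ := exists_eq_sum M q cs ha h
  have h1 : (gram cs q).mulVec c = 0 := by
    ext v
    rw [← trace_reg cs hreg]
    have h2 : (cs.redProd (gen M q) v * ∑ w, c w • cs.redProd (gen M q) w) ^ n = 0 := by
      have := Ideal.pow_mem_pow (Ideal.mul_mem_left _ (cs.redProd (gen M q) v) hh) n
      rw [hn] at this
      exact this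
    have h3 : IsNilpotent (reg cs hreg (cs.redProd (gen M q) v * ∑ w, c w • cs.redProd (gen M q) w)) :=
      ⟨n, by rw [← map_pow, h2, map_zero]⟩
    exact (Matrix.isNilpotent_trace_of_isNilpotent h3).eq_zero
  rw [Matrix.eq_zero_of_mulVec_eq_zero hdet h1]
  simp

end

include ha in
theorem det_gram_ne_zero (C : ℕ) (hC : ∀ r : ℕ, r.Prime → C < r → cs.HasBuilding r) {p : ℕ} [Fact p.Prime]
    (hp : Fintype.card W < p) {q : ZMod p} (hq : q ≠ 0) (hP : ∑ w : W, q ^ cs.length w ≠ 0) :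
    (gram cs q).det ≠ 0 := by
  intro hdet
  have hreg := cs.isBraid_regMat ha C hC q
  obtain ⟨c, hc, hGc⟩ := Matrix.exists_mulVec_eq_zero_iff.2 hdet
  set x := ∑ w, c w • cs.redProd (gen M q) w with hx
  have htr : ∀ y, (reg cs hreg (y * x)).trace = 0 := by
    intro y
    obtain ⟨d, rfl⟩ := exists_eq_sum M q cs ha y
    rw [Finset.sum_mul, map_sum, Matrix.trace_sum]
    refine Finset.sum_eq_zero fun v _ => ?_
    rw [smul_mul_assoc, map_smul, Matrix.trace_smul, trace_reg cs hreg, hGc, Pi.zero_apply, smul_zero]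
  have hnil : ∀ y, IsNilpotent (y * x) := by
    intro y
    obtain ⟨m, hm, hid⟩ := exists_pow_isIdempotentElem (reg cs hreg (y * x))
    refine ⟨m, reg_injective cs ha hreg ?_⟩
    rw [map_zero, map_pow]
    refine Matrix.eq_zero_of_isIdempotentElem_of_trace_eq_zero hp hid ?_
    obtain ⟨m, rfl⟩ := Nat.exists_eq_add_of_lt hm
    rw [← map_pow, zero_add, pow_succ, ← mul_assoc]
    exact htr _
  obtain ⟨r, hrC, hr, hrq⟩ := Nat.forall_exists_prime_gt_and_eq_mod (q := p) (a := q) (isUnit_iff_ne_zero.2 hq) C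
  obtain ⟨X, _, _, A, hT, hA, hAtr, hcard⟩ := hC r hr hrC
  set φ : Matrix X X ℤ →+* Matrix X X (ZMod p) := (Int.castRingHom (ZMod p)).mapMatrix with hφ
  have hT' : CoxeterSystem.IsBraid M (fun s => φ (A s)) := by
    intro s t hst
    have := congrArg φ (hT s t hst)
    rwa [map_list_prod, map_list_prod, List.map_map, List.map_map] at this
  have hA' : CoxeterSystem.IsQuadratic q (fun s => φ (A s)) := by
    intro s
    have := congrArg φ (hA s)
    rw [map_pow] at this
    simp only [this, map_add, ← hrq, Algebra.smul_def, map_mul, map_one]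
    simp
  have hAtr' : ∀ w, w ≠ 1 → (cs.redProd (fun s => φ (A s)) w).trace = 0 := by
    intro w hw
    rw [← cs.map_redProd φ, hφ, RingHom.mapMatrix_apply]
    have := congrArg (Int.cast (R := ZMod p)) (hAtr w hw)
    simpa [Matrix.trace] using this
  have hcard' : (Fintype.card X : ZMod p) = ∑ w, q ^ cs.length w := by
    have := congrArg (Int.cast (R := ZMod p)) hcard
    simpa [hrq] using this
  refine hc (funext fun v => ?_)
  have h1 : (lift hT' hA' (cs.redProd (gen M q) v⁻¹ * x)).trace = 0 :=
    (Matrix.isNilpotent_trace_of_isNilpotent ((hnil _).map (lift hT' hA'))).eq_zero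
  simp only [hx, map_mul, map_sum, map_smul, lift_redProd, Finset.mul_sum, mul_smul_comm, Matrix.trace_sum,
    Matrix.trace_smul, cs.trace_redProd_mul_redProd ha hT' hA' hAtr', inv_inv, smul_eq_mul, mul_ite, mul_zero,
    Finset.sum_ite_eq', Finset.mem_univ, if_true] at h1
  refine (mul_eq_zero.1 h1).resolve_right (mul_ne_zero (pow_ne_zero _ hq) ?_)
  rwa [hcard']

include ha in
theorem isSemisimpleRing (C : ℕ) (hC : ∀ r : ℕ, r.Prime → C < r → cs.HasBuilding r)
    {k : Type*} [Field k] [CharZero k] {ξ : k} (hξ : ξ ≠ 0) (hP : ∑ w : W, ξ ^ cs.length w ≠ 0) :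
    IsSemisimpleRing (HeckeAlg k M ξ) := by
  refine isSemisimpleRing_of_det_ne_zero cs ha (hreg := cs.isBraid_regMat ha C hC ξ) ?_
  have := Polynomial.aeval_ne_zero_of_zmod (ξ := ξ) (f := (gram cs (X : ℤ[X])).det)
    (g := X * ∑ w : W, X ^ cs.length w) (Fintype.card W) ?_ ?_
  · have h := RingHom.map_det (aeval ξ : ℤ[X] →ₐ[ℤ] k).toRingHom (gram cs (X : ℤ[X]))
    rw [RingHom.mapMatrix_apply, gram_map] at h
    simp only [AlgHom.toRingHom_eq_coe, RingHom.coe_coe, aeval_X] at h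
    rwa [← h]
  · intro p hp hWp x hx
    have := Fact.mk hp
    rw [← ZMod.intCast_zmod_eq_zero_iff_dvd] at hx ⊢
    have h := RingHom.map_det ((Int.castRingHom (ZMod p)).comp (evalRingHom x)) (gram cs (X : ℤ[X]))
    rw [RingHom.mapMatrix_apply, gram_map] at h
    simp only [RingHom.comp_apply, coe_evalRingHom, eval_X, eq_intCast] at h
    rw [h]
    simp only [eval_mul, eval_X, eval_finsetSum, eval_pow, Int.cast_mul, Int.cast_sum, Int.cast_pow,
      mul_eq_zero, not_or] at hx
    exact det_gram_ne_zero cs ha C hC hWp hx.1 hx.2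
  · simpa using ⟨hξ, hP⟩

end HeckeAlg

end

section

open Module

namespace CoxeterSystem

variable {B W : Type*} [Group W] {M : CoxeterMatrix B} (cs : CoxeterSystem M W)

/-- A finite thick chamber system with a distance valued in `W` (a building) whose panels all have
`q + 1` chambers. -/
structure IsWDist {X : Type*} (q : ℕ) (d : X → X → W) : Prop where
  eq_one_iff : ∀ x y, d x y = 1 ↔ x = y
  symm : ∀ x y s, d x y = cs.simple s → d y x = cs.simple s
  of_not_descent : ∀ x y z s, d x y = cs.simple s → ¬ cs.IsLeftDescent (d y z) s →
    d x z = cs.simple s * d y z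
  eq_or : ∀ x y z s, d x y = cs.simple s → d x z = d y z ∨ d x z = cs.simple s * d y z
  exists_adj : ∀ x z s, ∃ y, d x y = cs.simple s ∧ d y z = cs.simple s * d x z
  card_adj : ∀ x s, Nat.card {y // d x y = cs.simple s} = q

namespace IsWDist

variable {cs} {X : Type*} {q : ℕ} {d : X → X → W} (hd : cs.IsWDist q d)
include hd

theorem comap {Y : Type*} (e : Y ≃ X) : cs.IsWDist q (fun x y => d (e x) (e y)) where
  eq_one_iff x y := by rw [hd.eq_one_iff, e.apply_eq_iff_eq]
  symm x y := hd.symm _ _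
  of_not_descent x y z := hd.of_not_descent _ _ _
  eq_or x y z := hd.eq_or _ _ _
  exists_adj x z s := by
    obtain ⟨y, h1, h2⟩ := hd.exists_adj (e x) (e z) s
    exact ⟨e.symm y, by simpa using h1, by simpa using h2⟩
  card_adj x s := by
    rw [← hd.card_adj (e x) s]
    exact Nat.card_congr (e.subtypeEquiv fun _ => Iff.rfl)

theorem adj_unique {x y y' z : X} {s : B} {w : W} (h : ¬ cs.IsLeftDescent w s) (hy : d x y = cs.simple s)
    (hy' : d x y' = cs.simple s) (hw : d y z = w) (hw' : d y' z = w) : y = y' := by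
  rcases hd.eq_or y x y' s (hd.symm _ _ _ hy) with h1 | h1
  · rw [hy'] at h1
    have := hd.of_not_descent y y' z s h1 (by rwa [hw'])
    rw [hw, hw'] at this
    have h2 := cs.length_simple_mul_ne w s
    rw [← this] at h2
    exact absurd rfl h2
  · rw [hy', cs.simple_mul_simple_self, hd.eq_one_iff] at h1
    exact h1

variable [Fintype X] [DecidableEq X] [DecidableEq W]

theorem prod_map_adj {ω : List B} (h : cs.IsReduced ω) :
    (ω.map fun s => (Matrix.of fun x y => if d x y = cs.simple s then (1 : ℤ) else 0)).prod =
      Matrix.of fun x y => if d x y = cs.wordProd ω then 1 else 0 := by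
  induction ω with
  | nil =>
    ext x y
    simp [Matrix.one_apply, hd.eq_one_iff]
  | cons s ω ih =>
    have hω : cs.IsReduced ω := by simpa using h.drop 1
    have hs : ¬ cs.IsLeftDescent (cs.wordProd ω) s := by
      rw [cs.not_isLeftDescent_iff, ← cs.wordProd_cons, h.eq, hω.eq, List.length_cons]
    ext x z
    rw [List.map_cons, List.prod_cons, ih hω, Matrix.mul_apply]
    simp only [Matrix.of_apply, cs.wordProd_cons]
    split_ifs with hxz
    · obtain ⟨y, hy, hyz⟩ := hd.exists_adj x z s
      rw [hxz, cs.simple_mul_simple_cancel_left] at hyz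
      rw [Finset.sum_eq_single y]
      · simp [hy, hyz]
      · intro y' _ hne
        by_contra! hcon
        simp only [ne_eq, mul_eq_zero, ite_eq_right_iff, one_ne_zero, imp_false, not_or, not_not] at hcon
        exact hne (hd.adj_unique hs hcon.1 hy hcon.2 hyz)
      · simp
    · refine Finset.sum_eq_zero fun y _ => ?_
      by_contra! hcon
      simp only [ne_eq, mul_eq_zero, ite_eq_right_iff, one_ne_zero, imp_false, not_or, not_not] at hcon
      exact hxz (by rw [hd.of_not_descent x y z s hcon.1 (by rwa [hcon.2]), hcon.2])

omit [DecidableEq X] in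
theorem sum_adj (x : X) (s : B) : ∑ y, (if d x y = cs.simple s then (1 : ℤ) else 0) = q := by
  rw [Finset.sum_boole, ← hd.card_adj x s, Nat.card_eq_fintype_card, Fintype.card_subtype]

theorem sum_prod_map_adj (ω : List B) (x : X) :
    ∑ z, (ω.map fun s => (Matrix.of fun x y => if d x y = cs.simple s then (1 : ℤ) else 0)).prod x z =
      (q : ℤ) ^ ω.length := by
  induction ω generalizing x with
  | nil => simp [Matrix.one_apply]
  | cons s ω ih =>
    simp only [List.map_cons, List.prod_cons, Matrix.mul_apply]
    rw [Finset.sum_comm]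
    simp only [← Finset.mul_sum, ih, Matrix.of_apply]
    rw [← Finset.sum_mul, hd.sum_adj, List.length_cons, pow_succ']

theorem isQuadratic_adj :
    IsQuadratic (q : ℤ) fun s => (Matrix.of fun x y => if d x y = cs.simple s then (1 : ℤ) else 0) := by
  intro s
  ext x z
  have hs1 : cs.simple s ≠ 1 := fun h => by simpa [h] using cs.length_simple s
  rw [pow_two, Matrix.mul_apply]
  simp only [Matrix.of_apply, Matrix.add_apply, Matrix.smul_apply, Matrix.one_apply, smul_eq_mul, mul_ite, mul_one,
    mul_zero]
  by_cases hxz : x = z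
  · subst hxz
    rw [if_pos rfl, if_neg (by rw [(hd.eq_one_iff x x).2 rfl]; exact hs1.symm), add_zero, ← hd.sum_adj x s]
    refine Finset.sum_congr rfl fun y _ => ?_
    by_cases h : d x y = cs.simple s
    · simp [h, hd.symm _ _ _ h]
    · simp [h]
  · rw [if_neg hxz, zero_add]
    split_ifs with h
    · rw [← hd.sum_adj x s, ← Finset.sum_erase_add _ (fun y => if d x y = cs.simple s then (1 : ℤ) else 0)
        (Finset.mem_univ z), if_pos h, add_sub_cancel_right, ← Finset.sum_erase Finset.univ (a := z)]
      · refine Finset.sum_congr rfl fun y hy => ?_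
        by_cases h' : d x y = cs.simple s
        · rcases hd.eq_or y x z s (hd.symm _ _ _ h') with h1 | h1
          · rw [h] at h1; simp [h1, h']
          · rw [h, cs.simple_mul_simple_self, hd.eq_one_iff] at h1
            exact absurd h1 (Finset.ne_of_mem_erase hy)
        · simp [h']
      · rw [(hd.eq_one_iff z z).2 rfl, if_neg hs1.symm]
    · refine Finset.sum_eq_zero fun y _ => ?_
      by_cases h1 : d y z = cs.simple s <;> by_cases h2 : d x y = cs.simple s <;> simp only [h1, h2, if_true, if_false]
      rcases hd.eq_or x y z s h2 with h3 | h3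
      · exact absurd (h3.trans h1) h
      · rw [h1, cs.simple_mul_simple_self, hd.eq_one_iff] at h3
        exact absurd h3 hxz

omit [DecidableEq X] in
theorem hasBuilding [Fintype W] [Nonempty X] [Fintype B] {a : B → B → ℤ} (ha : IsCartanOf M a) :
    cs.HasBuilding q := by
  classical
  suffices H : ∀ (Y : Type) [Fintype Y] [DecidableEq Y] [Nonempty Y] (d : Y → Y → W), cs.IsWDist q d →
      cs.HasBuilding q by
    have e := (Fintype.equivFin X).symm
    have : Nonempty (Fin (Fintype.card X)) := ⟨Fintype.equivFin X (Classical.arbitrary X)⟩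
    exact H _ _ (hd.comap e)
  intro Y _ _ _ d hd
  refine ⟨Y, inferInstance, inferInstance, fun s => Matrix.of fun x y => if d x y = cs.simple s then 1 else 0,
    ?_, hd.isQuadratic_adj, ?_, ?_⟩
  · intro s t hst
    have hb : cs.wordProd (alternatingWord s t (M s t)) = cs.wordProd (alternatingWord t s (M s t)) := by
      have := cs.wordProd_braidWord_eq s t
      rwa [braidWord, braidWord, M.symmetric t s] at this
    rw [hd.prod_map_adj (cs.isReduced_alternatingWord ha hst le_rfl), hd.prod_map_adj
      (cs.isReduced_alternatingWord ha hst.symm (M.symmetric s t).le), hb]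
  · intro w hw
    obtain ⟨ω, hω, rfl, h⟩ := cs.exists_redProd_eq w
    rw [h, hd.prod_map_adj hω]
    refine Finset.sum_eq_zero fun x _ => ?_
    rw [Matrix.diag_apply, Matrix.of_apply, (hd.eq_one_iff x x).2 rfl, if_neg hw.symm]
  · obtain ⟨x⟩ := ‹Nonempty Y›
    have h1 : ∀ z, ∑ w, cs.redProd (fun s => Matrix.of fun x y => if d x y = cs.simple s then (1 : ℤ) else 0) w x z = 1 := by
      intro z
      rw [Finset.sum_eq_single (d x z)]
      · obtain ⟨ω, hω, hw, h⟩ := cs.exists_redProd_eq (d x z)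
        rw [h, hd.prod_map_adj hω, ← hw]; simp
      · intro w _ hw'
        obtain ⟨ω, hω, hw, h⟩ := cs.exists_redProd_eq w
        rw [h, hd.prod_map_adj hω, ← hw]; simp [hw'.symm]
      · simp
    rw [Fintype.card, Finset.card_eq_sum_ones, Nat.cast_sum]
    simp only [Nat.cast_one]
    rw [← Finset.sum_congr rfl fun z _ => h1 z, Finset.sum_comm]
    refine Finset.sum_congr rfl fun w _ => ?_
    obtain ⟨ω, hω, hw, h⟩ := cs.exists_redProd_eq w
    rw [h, hd.sum_prod_map_adj, hw, hω.eq]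

end IsWDist

end CoxeterSystem

end

section

namespace CoxeterSystem

variable {B W : Type*} [Group W] {M : CoxeterMatrix B} (cs : CoxeterSystem M W)

/-- A split group with a `BN`-pair, described through representatives `n s` of the simple reflections and `ν w` of
all elements of the Weyl group `W`, and root group coordinates `x s : F → P`. -/
structure IsBNPair {G F : Type*} [Group G] (P : Subgroup G) (n : B → G) (ν : W → G) (x : B → F → G) : Prop where
  one : ν 1 ∈ P
  simple_mul : ∀ s w, (ν (cs.simple s * w))⁻¹ * n s * ν w ∈ P
  of_not_descent : ∀ s w, ¬ cs.IsLeftDescent w s → ∀ b ∈ P, ∃ b₁ ∈ P, ∃ b₂ ∈ P,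
    n s * b * ν w = b₁ * n s * ν w * b₂
  simple : ∀ s, ∀ b ∈ P, n s * b * n s ∈ P ∨ ∃ b₁ ∈ P, ∃ b₂ ∈ P, n s * b * n s = b₁ * n s * b₂
  not_mem : ∀ w, w ≠ 1 → ν w ∉ P
  mem : ∀ s t, x s t ∈ P
  existsUnique : ∀ s, ∀ b ∈ P, ∃! t, n s * (x s t)⁻¹ * b * (n s)⁻¹ ∈ P
  gen : Subgroup.closure (P ∪ Set.range n) = ⊤

namespace IsBNPair

variable {cs} {G F : Type*} [Group G] {P : Subgroup G} {n : B → G} {ν : W → G} {x : B → F → G}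

/-- The double coset attached to `w`. -/
def InCell (P : Subgroup G) (ν : W → G) (w : W) (g : G) : Prop :=
  ∃ b₁ ∈ P, ∃ b₂ ∈ P, g = b₁ * ν w * b₂

omit [Group W] in
theorem InCell.mul_left {w : W} {g b : G} (h : InCell P ν w g) (hb : b ∈ P) : InCell P ν w (b * g) := by
  obtain ⟨b₁, h₁, b₂, h₂, rfl⟩ := h
  exact ⟨b * b₁, P.mul_mem hb h₁, b₂, h₂, by group⟩

omit [Group W] in
theorem InCell.mul_right {w : W} {g b : G} (h : InCell P ν w g) (hb : b ∈ P) : InCell P ν w (g * b) := by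
  obtain ⟨b₁, h₁, b₂, h₂, rfl⟩ := h
  exact ⟨b₁, h₁, b₂ * b, P.mul_mem h₂ hb, by group⟩

omit [Group W] in
theorem inCell_self (w : W) : InCell P ν w (ν w) := ⟨1, P.one_mem, 1, P.one_mem, by group⟩

variable (h : cs.IsBNPair P n ν x)
include h

theorem inCell_one_iff {g : G} : InCell P ν 1 g ↔ g ∈ P := by
  refine ⟨?_, fun hg => ⟨g * (ν 1)⁻¹, P.mul_mem hg (P.inv_mem h.one), 1, P.one_mem, by group⟩⟩
  rintro ⟨b₁, h₁, b₂, h₂, rfl⟩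
  exact P.mul_mem (P.mul_mem h₁ h.one) h₂

theorem inCell_simple_mul (s : B) (w : W) : InCell P ν (cs.simple s * w) (n s * ν w) :=
  ⟨1, P.one_mem, _, h.simple_mul s w, by group⟩

theorem inv_mul_mem (s : B) (w : W) : (ν w)⁻¹ * n s * ν (cs.simple s * w) ∈ P := by
  simpa using h.simple_mul s (cs.simple s * w)

theorem inCell_simple (s : B) : InCell P ν (cs.simple s) (n s) := by
  have := (h.inCell_simple_mul s 1).mul_right (P.inv_mem h.one)
  simpa using this

theorem mul_self_mem (s : B) : n s * n s ∈ P := by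
  have h1 := h.inv_mul_mem s 1
  have h2 := h.simple_mul s 1
  have := P.mul_mem (P.mul_mem (P.mul_mem h.one h1) h2) (P.inv_mem h.one)
  rw [mul_one] at this
  convert this using 1
  group

theorem inCell_simple_iff {s : B} {g : G} :
    InCell P ν (cs.simple s) g ↔ ∃ b₁ ∈ P, ∃ b₂ ∈ P, g = b₁ * n s * b₂ := by
  constructor
  · rintro ⟨b₁, h₁, b₂, h₂, rfl⟩
    have := h.inv_mul_mem s 1
    have h3 := h.simple_mul s 1
    rw [mul_one] at h3
    exact ⟨b₁, h₁, ν 1 * ((ν (cs.simple s))⁻¹ * n s * ν 1)⁻¹ * b₂,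
      P.mul_mem (P.mul_mem h.one (P.inv_mem h3)) h₂, by group⟩
  · rintro ⟨b₁, h₁, b₂, h₂, rfl⟩
    exact ((h.inCell_simple s).mul_left h₁).mul_right h₂

theorem inCell_inv_simple {s : B} {g : G} (hg : InCell P ν (cs.simple s) g) : InCell P ν (cs.simple s) g⁻¹ := by
  rw [h.inCell_simple_iff] at hg ⊢
  obtain ⟨b₁, h₁, b₂, h₂, rfl⟩ := hg
  exact ⟨b₂⁻¹, P.inv_mem h₂, (n s * n s)⁻¹ * b₁⁻¹, P.mul_mem (P.inv_mem (h.mul_self_mem s)) (P.inv_mem h₁), by group⟩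

theorem inCell_mul_of_not_descent {s : B} {w : W} (hs : ¬ cs.IsLeftDescent w s) {g : G} (hg : InCell P ν w g) :
    InCell P ν (cs.simple s * w) (n s * g) := by
  obtain ⟨b₁, h₁, b₂, h₂, rfl⟩ := hg
  obtain ⟨c₁, k₁, c₂, k₂, he⟩ := h.of_not_descent s w hs b₁ h₁
  have := (((h.inCell_simple_mul s w).mul_left k₁).mul_right k₂).mul_right h₂
  convert this using 1
  rw [← mul_assoc, ← mul_assoc, he]
  group

theorem inCell_mul (s : B) {w : W} {g : G} (hg : InCell P ν w g) :
    InCell P ν w (n s * g) ∨ InCell P ν (cs.simple s * w) (n s * g) := by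
  by_cases hs : cs.IsLeftDescent w s
  · obtain ⟨w, rfl⟩ : ∃ w', w = cs.simple s * w' := ⟨cs.simple s * w, by simp⟩
    have hs' : ¬ cs.IsLeftDescent w s := by
      intro hw
      have := cs.isLeftDescent_iff_not_isLeftDescent_mul.1 hw
      exact this hs
    obtain ⟨b₁, h₁, b₂, h₂, rfl⟩ := hg
    have e : n s * (b₁ * ν (cs.simple s * w) * b₂) = (n s * b₁ * n s) * ν w *
        (((ν (cs.simple s * w))⁻¹ * n s * ν w)⁻¹ * b₂) := by group
    have hb : ((ν (cs.simple s * w))⁻¹ * n s * ν w)⁻¹ * b₂ ∈ P := P.mul_mem (P.inv_mem (h.simple_mul s w)) h₂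
    rw [e, cs.simple_mul_simple_cancel_left]
    rcases h.simple s b₁ h₁ with hc | ⟨c₁, k₁, c₂, k₂, he⟩
    · right
      exact ⟨_, hc, _, hb, rfl⟩
    · left
      rw [he]
      have := ((h.inCell_mul_of_not_descent hs' ((inCell_self (P := P) (ν := ν) w).mul_left k₂)).mul_left
        k₁).mul_right hb
      convert this using 1
      group
  · exact Or.inr (h.inCell_mul_of_not_descent hs hg)

theorem inCell_mul_simple {s : B} {w : W} {g g' : G} (hg' : InCell P ν (cs.simple s) g') (hg : InCell P ν w g) :
    InCell P ν w (g' * g) ∨ InCell P ν (cs.simple s * w) (g' * g) := by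
  obtain ⟨b₁, h₁, b₂, h₂, rfl⟩ := h.inCell_simple_iff.1 hg'
  rw [mul_assoc, mul_assoc]
  exact (h.inCell_mul s (hg.mul_left h₂)).imp (·.mul_left h₁) (·.mul_left h₁)

theorem inCell_mul_simple_of_not_descent {s : B} {w : W} (hs : ¬ cs.IsLeftDescent w s) {g g' : G}
    (hg' : InCell P ν (cs.simple s) g') (hg : InCell P ν w g) :
    InCell P ν (cs.simple s * w) (g' * g) := by
  obtain ⟨b₁, h₁, b₂, h₂, rfl⟩ := h.inCell_simple_iff.1 hg'
  rw [mul_assoc, mul_assoc]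
  exact (h.inCell_mul_of_not_descent hs (hg.mul_left h₂)).mul_left h₁

theorem inCell_unique_of_le (m : ℕ) : ∀ {u v : W} {g : G}, cs.length u = m → cs.length u ≤ cs.length v →
    InCell P ν u g → InCell P ν v g → u = v := by
  induction m with
  | zero =>
    intro u v g hu _ hgu hgv
    rw [cs.length_eq_zero_iff] at hu
    subst hu
    by_contra hv
    rw [h.inCell_one_iff] at hgu
    obtain ⟨b₁, h₁, b₂, h₂, rfl⟩ := hgv
    refine h.not_mem v (Ne.symm hv) ?_
    rwa [P.mul_mem_cancel_right h₂, P.mul_mem_cancel_left h₁] at hgu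
  | succ m ih =>
    intro u v g hu huv hgu hgv
    obtain ⟨s, hs⟩ := cs.exists_leftDescent_of_ne_one (w := u) (by rintro rfl; simp at hu)
    have hl := cs.isLeftDescent_iff.1 hs
    have hlv := cs.length_simple_mul v s
    have hg1 : InCell P ν (cs.simple s * u) ((n s)⁻¹ * (hgu.choose⁻¹ * g)) := by
      obtain ⟨h₁, b₂, h₂, he⟩ := hgu.choose_spec
      refine ⟨1, P.one_mem, ((ν (cs.simple s * u))⁻¹ * (n s)⁻¹ * ν u) * b₂, P.mul_mem ?_ h₂, ?_⟩
      · have := P.inv_mem (h.inv_mul_mem s u)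
        convert this using 1
        group
      · nth_rewrite 2 [he]
        group
    have hg2 := h.inCell_mul_simple (h.inCell_inv_simple (h.inCell_simple s))
      (hgv.mul_left (P.inv_mem hgu.choose_spec.1))
    rcases hg2 with hg2 | hg2
    · have := ih (by omega) (by omega) hg1 hg2
      rw [this] at hl
      omega
    · have := ih (by omega) (by omega) hg1 hg2
      exact mul_left_cancel this

theorem inCell_unique {u v : W} {g : G} (hu : InCell P ν u g) (hv : InCell P ν v g) : u = v := by
  rcases le_total (cs.length u) (cs.length v) with hl | hl
  · exact h.inCell_unique_of_le _ rfl hl hu hv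
  · exact (h.inCell_unique_of_le _ rfl hl hv hu).symm

theorem exists_inCell (g : G) : ∃ w, InCell P ν w g := by
  have hg : g ∈ Subgroup.closure (P ∪ Set.range n) := by rw [h.gen]; trivial
  have hs : ∀ s g, (∃ w, InCell P ν w g) → ∃ w, InCell P ν w (n s * g) := by
    rintro s g ⟨w, hw⟩
    rcases h.inCell_mul s hw with h' | h' <;> exact ⟨_, h'⟩
  induction hg using Subgroup.closure_induction_left with
  | one => exact ⟨1, h.inCell_one_iff.2 P.one_mem⟩
  | mul_left y hy z _ ih =>
    rcases hy with hy | ⟨s, rfl⟩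
    · exact ih.imp fun w hw => hw.mul_left hy
    · exact hs s z ih
  | inv_mul_cancel y hy z _ ih =>
    rcases hy with hy | ⟨s, rfl⟩
    · exact ih.imp fun w hw => hw.mul_left (P.inv_mem hy)
    · obtain ⟨w, hw⟩ := ih
      rcases h.inCell_mul_simple (h.inCell_inv_simple (h.inCell_simple s)) hw with h' | h' <;> exact ⟨_, h'⟩

theorem exists_isWDist : ∃ d : G ⧸ P → G ⧸ P → W, cs.IsWDist (Nat.card F) d := by
  choose c hc using h.exists_inCell
  have hcu : ∀ g w, c g = w ↔ InCell P ν w g := fun g w =>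
    ⟨fun e => e ▸ hc g, fun e => h.inCell_unique (hc g) e⟩
  let d : G ⧸ P → G ⧸ P → W := fun x y => c (x.out⁻¹ * y.out)
  have hd : ∀ (g k : G) (w : W), d g k = w ↔ InCell P ν w (g⁻¹ * k) := by
    intro g k w
    obtain ⟨p, hp⟩ := QuotientGroup.mk_out_eq_mul P g
    obtain ⟨p', hp'⟩ := QuotientGroup.mk_out_eq_mul P k
    simp only [d]
    rw [hcu, hp, hp', mul_inv_rev]
    constructor
    · intro e
      have := (e.mul_left p.2).mul_right (P.inv_mem p'.2)
      convert this using 1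
      group
    · intro e
      have := (e.mul_left (P.inv_mem p.2)).mul_right p'.2
      convert this using 1
      group
  refine ⟨d, ⟨?_, ?_, ?_, ?_, ?_, ?_⟩⟩
  · intro X Y
    induction X using QuotientGroup.induction_on with | H g
    induction Y using QuotientGroup.induction_on with | H k
    rw [hd, h.inCell_one_iff, QuotientGroup.eq]
  · intro X Y s
    induction X using QuotientGroup.induction_on with | H g
    induction Y using QuotientGroup.induction_on with | H k
    rw [hd, hd]
    intro e
    simpa using h.inCell_inv_simple e
  · intro X Y Z s
    induction X using QuotientGroup.induction_on with | H g
    induction Y using QuotientGroup.induction_on with | H k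
    induction Z using QuotientGroup.induction_on with | H l
    rw [hd, hd]
    intro e hs
    have := h.inCell_mul_simple_of_not_descent hs e ((hd k l _).1 rfl)
    simpa [mul_assoc] using this
  · intro X Y Z s
    induction X using QuotientGroup.induction_on with | H g
    induction Y using QuotientGroup.induction_on with | H k
    induction Z using QuotientGroup.induction_on with | H l
    rw [hd, hd, hd]
    intro e
    have := h.inCell_mul_simple e ((hd k l _).1 rfl)
    simpa [mul_assoc] using this
  · intro X Z s
    induction X using QuotientGroup.induction_on with | H g
    induction Z using QuotientGroup.induction_on with | H l
    set w := d g l with hw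
    obtain ⟨b₁, h₁, b₂, h₂, he⟩ := (hd g l w).1 hw.symm
    refine ⟨((g * b₁ * n s : G) : G ⧸ P), (hd _ _ _).2 ?_, (hd _ _ _).2 ?_⟩
    · have := (h.inCell_simple s).mul_left h₁
      convert this using 1
      group
    · refine ⟨1, P.one_mem, ((ν w)⁻¹ * n s * ν (cs.simple s * w))⁻¹ * b₂,
        P.mul_mem (P.inv_mem (h.inv_mul_mem s w)) h₂, ?_⟩
      have : l = g * (b₁ * ν w * b₂) := by rw [← he]; group
      rw [this]
      group
  · intro X s
    induction X using QuotientGroup.induction_on with | H g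
    symm
    refine Nat.card_congr (Equiv.ofBijective (fun t => ⟨((g * x s t * (n s)⁻¹ : G) : G ⧸ P), (hd _ _ _).2 ?_⟩) ⟨?_, ?_⟩)
    · have := (h.inCell_inv_simple (h.inCell_simple s)).mul_left (h.mem s t)
      convert this using 1
      group
    · intro t t' e
      simp only [Subtype.mk.injEq] at e
      rw [QuotientGroup.eq] at e
      refine (h.existsUnique s _ (h.mem s t')).unique ?_ ?_
      · convert e using 1; group
      · convert P.one_mem using 1; group
    · rintro ⟨Y, hY⟩
      induction Y using QuotientGroup.induction_on with | H k
      obtain ⟨b₁, h₁, b₂, h₂, he⟩ := h.inCell_simple_iff.1 ((hd _ _ _).1 hY)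
      obtain ⟨t, ht, -⟩ := h.existsUnique s b₁ h₁
      refine ⟨t, Subtype.ext (QuotientGroup.eq.2 ?_)⟩
      have : k = g * (b₁ * n s * b₂) := by rw [← he]; group
      rw [this]
      have := P.mul_mem (P.mul_mem ht (h.mul_self_mem s)) h₂
      convert this using 1
      group

theorem hasBuilding [Finite (G ⧸ P)] [Finite W] [Finite B] {a : B → B → ℤ} (ha : IsCartanOf M a) [Fintype W]
    [DecidableEq W] : cs.HasBuilding (Nat.card F) := by
  classical
  obtain ⟨d, hd⟩ := h.exists_isWDist
  have := Fintype.ofFinite (G ⧸ P)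
  have := Fintype.ofFinite B
  exact hd.hasBuilding ha

end IsBNPair

end CoxeterSystem

end

section

/-- The commutator `y ↦ x y - y x`. -/
def commutatorMap (F : Type*) {A : Type*} [CommRing F] [Ring A] [Algebra F A] (x : A) : A →ₗ[F] A :=
  LinearMap.mulLeft F x - LinearMap.mulRight F x

theorem commutatorMap_apply {F A : Type*} [CommRing F] [Ring A] [Algebra F A] (x y : A) :
    commutatorMap F x y = x * y - y * x := rfl

open Finset Nat in
/-- The exponential series, truncated to the terms of degree less than `m`. -/
noncomputable def truncExp (F : Type*) {A : Type*} [Field F] [Ring A] [Algebra F A] (m : ℕ) (x : A) : A :=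
  ∑ k ∈ range m, (k ! : F)⁻¹ • x ^ k

namespace truncExp

open Finset
open scoped Nat

variable {F A : Type*} [Field F] [Ring A] [Algebra F A] {m n : ℕ}

theorem add (hm : ∀ k < m, (k ! : F) ≠ 0) {a b : A} (h : Commute a b) (ha : a ^ n = 0) (hb : b ^ n = 0)
    (hn : 2 * n ≤ m + 1) : truncExp F m (a + b) = truncExp F m a * truncExp F m b := by
  set Φ : ℕ × ℕ → A := fun p => ((p.1 ! : F)⁻¹ * (p.2 ! : F)⁻¹) • (a ^ p.1 * b ^ p.2) with hΦ
  have h1 : truncExp F m a * truncExp F m b = ∑ p ∈ range m ×ˢ range m, Φ p := by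
    rw [truncExp, truncExp, sum_mul_sum, sum_product]
    refine sum_congr rfl fun i _ => sum_congr rfl fun j _ => ?_
    rw [smul_mul_smul_comm]
  have h2 : truncExp F m (a + b) = ∑ k ∈ range m, ∑ p ∈ antidiagonal k, Φ p := by
    refine sum_congr rfl fun k hk => ?_
    rw [h.add_pow', smul_sum]
    refine sum_congr rfl fun p hp => ?_
    rw [HasAntidiagonal.mem_antidiagonal] at hp
    rw [hΦ, ← Nat.cast_smul_eq_nsmul F, smul_smul]
    congr 1
    rw [mem_range] at hk
    have h3 : (k.choose p.1 : F) * p.1 ! * p.2 ! = k ! := by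
      rw [← hp]; exact_mod_cast congrArg (Nat.cast (R := F)) (show (p.1 + p.2).choose p.1 * p.1 ! * p.2 ! = (p.1 + p.2)! by
        rw [Nat.choose_symm_add]; exact Nat.add_choose_mul_factorial_mul_factorial p.1 p.2)
    have := hm k hk
    have := hm p.1 (by omega)
    have := hm p.2 (by omega)
    field_simp
    rw [← h3, mul_assoc]
  rw [h1, h2, sum_sigma', ← sum_filter_of_ne (s := range m ×ˢ range m) (p := fun p => p.1 + p.2 < m)]
  · refine sum_nbij' (fun q => q.2) (fun p => ⟨p.1 + p.2, p⟩) ?_ ?_ ?_ ?_ ?_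
    · rintro ⟨k, p⟩ hp
      simp only [mem_sigma, mem_range, HasAntidiagonal.mem_antidiagonal, mem_filter, mem_product] at hp ⊢
      omega
    · intro p hp
      simp only [mem_sigma, mem_range, HasAntidiagonal.mem_antidiagonal, mem_filter, mem_product] at hp ⊢
      exact ⟨hp.2, trivial⟩
    · rintro ⟨k, p⟩ hp
      simp only [mem_sigma, mem_range, HasAntidiagonal.mem_antidiagonal] at hp
      obtain ⟨-, rfl⟩ := hp
      rfl
    · intro p _
      rfl
    · intro p _
      rfl
  · intro p _ hp
    by_contra hlt
    refine hp ?_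
    rcases le_or_gt n p.1 with h3 | h3
    · rw [hΦ]; simp [pow_eq_zero_of_le h3 ha]
    · rw [hΦ]; simp [pow_eq_zero_of_le (show n ≤ p.2 by omega) hb]

theorem zero (hm : 0 < m) : truncExp F m (0 : A) = 1 := by
  rw [truncExp, sum_eq_single_of_mem 0 (by simpa using hm)]
  · simp
  · intro k _ hk
    simp [hk]

theorem map {A' : Type*} [Ring A'] [Algebra F A'] (f : A →ₐ[F] A') (x : A) :
    f (truncExp F m x) = truncExp F m (f x) := by
  simp [truncExp]

theorem mul_truncExp_mul (hm : ∀ k < m, (k ! : F) ≠ 0) {x : A} (hx : x ^ n = 0) (hn : 2 * n ≤ m + 1) (y : A) :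
    truncExp F m x * y * truncExp F m (-x) = truncExp F m (commutatorMap F x) y := by
  have h1 : commutatorMap F x = LinearMap.mulLeft F x + LinearMap.mulRight F (-x) := by
    ext z
    simp [commutatorMap, sub_eq_add_neg]
  rw [h1, add hm (n := n) (LinearMap.commute_mulLeft_right x (-x)) _ _ hn]
  · have h2 : truncExp F m (LinearMap.mulLeft F x) = LinearMap.mulLeft F (truncExp F m x) :=
      (map (Algebra.lmul F A) x).symm
    have h3 : truncExp F m (LinearMap.mulRight F (-x)) = LinearMap.mulRight F (truncExp F m (-x)) := by
      ext z
      simp [truncExp, LinearMap.pow_mulRight, LinearMap.sum_apply, mul_sum]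
    rw [h2, h3]
    simp [mul_assoc]
  · rw [LinearMap.pow_mulLeft, hx, LinearMap.mulLeft_zero_eq_zero]
  · rw [LinearMap.pow_mulRight, neg_pow, hx, mul_zero, LinearMap.mulRight_zero_eq_zero]

theorem apply_eq {M : Type*} [AddCommGroup M] [Module F M] (f : Module.End F M) (y : M) (hy : (f ^ 3) y = 0)
    (hm : 3 ≤ m) : truncExp F m f y = y + f y + (2 : F)⁻¹ • f (f y) := by
  rw [truncExp, ← sum_range_add_sum_Ico _ hm, LinearMap.add_apply]
  have : (∑ k ∈ Ico 3 m, (k ! : F)⁻¹ • f ^ k) y = 0 := by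
    rw [LinearMap.sum_apply]
    refine sum_eq_zero fun k hk => ?_
    rw [LinearMap.smul_apply, ← Nat.sub_add_cancel (mem_Ico.1 hk).1, pow_add, Module.End.mul_apply, hy, map_zero,
      smul_zero]
  rw [this, add_zero]
  simp [sum_range_succ, pow_two]

theorem mem_of_mapsTo {M : Type*} [AddCommGroup M] [Module F M] {f : Module.End F M} {L : Submodule F M}
    (h : ∀ y ∈ L, f y ∈ L) {y : M} (hy : y ∈ L) : truncExp F m f y ∈ L := by
  rw [truncExp, LinearMap.sum_apply]
  refine L.sum_mem fun k hk => L.smul_mem _ ?_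
  clear hk
  induction k with
  | zero => exact hy
  | succ k ih => rw [pow_succ', Module.End.mul_apply]; exact h _ ih

end truncExp

end

section

open scoped Nat in
/-- Bounds which make exponentials of elements with vanishing `n`-th power behave well when the exponential series
is truncated at `m`. -/
structure ExpBound (F : Type*) [Field F] (m n : ℕ) : Prop where
  fact : ∀ k < m, (k ! : F) ≠ 0
  le : 2 * n ≤ m + 1
  three : 3 ≤ m

namespace ExpBound

variable {F A : Type*} [Field F] [Ring A] [Algebra F A] {m n : ℕ} (hb : ExpBound F m n)

/-- The one-parameter subgroup `t ↦ exp (t x)` for nilpotent `x`. -/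
noncomputable def oneParam {x : A} (hx : x ^ n = 0) (t : F) : Aˣ where
  val := truncExp F m (t • x)
  inv := truncExp F m (-(t • x))
  val_inv := by
    rw [← truncExp.add hb.fact (Commute.neg_right (Commute.refl _)) (by rw [smul_pow, hx, smul_zero])
      (by rw [neg_pow, smul_pow, hx, smul_zero, mul_zero]) hb.le, add_neg_cancel, truncExp.zero (by have := hb.three; omega)]
  inv_val := by
    rw [← truncExp.add hb.fact (Commute.neg_left (Commute.refl _)) (by rw [neg_pow, smul_pow, hx, smul_zero, mul_zero])
      (by rw [smul_pow, hx, smul_zero]) hb.le, neg_add_cancel, truncExp.zero (by have := hb.three; omega)]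

theorem coe_oneParam {x : A} (hx : x ^ n = 0) (t : F) : (hb.oneParam hx t : A) = truncExp F m (t • x) := rfl

theorem oneParam_neg {x : A} (hx : x ^ n = 0) (t : F) : hb.oneParam hx (-t) = (hb.oneParam hx t)⁻¹ := by
  ext
  change truncExp F m (-t • x) = truncExp F m (-(t • x))
  rw [neg_smul]

theorem oneParam_zero {x : A} (hx : x ^ n = 0) : hb.oneParam hx 0 = 1 := by
  ext
  rw [coe_oneParam, zero_smul, truncExp.zero (by have := hb.three; omega), Units.val_one]

theorem conj_oneParam_eq {x : A} (hx : x ^ n = 0) (t : F) (y : A) :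
    (hb.oneParam hx t : A) * y * ↑(hb.oneParam hx t)⁻¹ = truncExp F m (commutatorMap F (t • x)) y := by
  rw [← oneParam_neg, coe_oneParam, coe_oneParam, neg_smul, truncExp.mul_truncExp_mul hb.fact _ hb.le]
  rw [smul_pow, hx, smul_zero]

theorem commutatorMap_smul (t : F) (x : A) : commutatorMap F (t • x) = t • commutatorMap F x := by
  ext y
  simp [commutatorMap_apply, smul_sub]

theorem conj_oneParam {x : A} (hx : x ^ n = 0) (t : F) {y z v : A} (hz : x * y - y * x = z)
    (hv : x * z - z * x = v) (h3 : x * v - v * x = 0) :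
    (hb.oneParam hx t : A) * y * ↑(hb.oneParam hx t)⁻¹ = y + t • z + ((2 : F)⁻¹ * t ^ 2) • v := by
  rw [conj_oneParam_eq, commutatorMap_smul, truncExp.apply_eq _ _ _ hb.three]
  · simp only [LinearMap.smul_apply, map_smul, commutatorMap_apply, hz, hv, smul_smul]
    rw [pow_two]
  · rw [smul_pow, LinearMap.smul_apply, pow_succ' (commutatorMap F x) 2, pow_two (commutatorMap F x), Module.End.mul_apply,
      Module.End.mul_apply]
    simp only [commutatorMap_apply, hz, hv, h3, smul_zero]

theorem conj_oneParam_mem {x : A} (hx : x ^ n = 0) (t : F) {L : Submodule F A}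
    (h : ∀ y ∈ L, x * y - y * x ∈ L) {y : A} (hy : y ∈ L) :
    (hb.oneParam hx t : A) * y * ↑(hb.oneParam hx t)⁻¹ ∈ L := by
  rw [conj_oneParam_eq, commutatorMap_smul]
  exact truncExp.mem_of_mapsTo (fun y hy => L.smul_mem _ (h y hy)) hy

include hb in
theorem two_ne_zero : (2 : F) ≠ 0 := by
  simpa using hb.fact 2 (by have := hb.three; omega)

section Weyl

variable {e f : A} (he : e ^ n = 0) (hf : f ^ n = 0)

/-- The representative `exp (t e) exp (-t⁻¹ f) exp (t e)` of the nontrivial Weyl group element of `SL₂`. -/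
noncomputable def weylUnit (t : F) : Aˣ :=
  hb.oneParam he t * hb.oneParam hf (-t⁻¹) * hb.oneParam he t

theorem weylUnit_neg (t : F) : hb.weylUnit he hf (-t) = (hb.weylUnit he hf t)⁻¹ := by
  simp only [weylUnit, inv_neg, oneParam_neg, neg_neg, inv_inv, mul_inv_rev, mul_assoc]

theorem conj_weylUnit (t : F) (y : A) : (hb.weylUnit he hf t : A) * y * ↑(hb.weylUnit he hf t)⁻¹ =
    (hb.oneParam he t : A) * ((hb.oneParam hf (-t⁻¹) : A) * ((hb.oneParam he t : A) * y * ↑(hb.oneParam he t)⁻¹) *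
      ↑(hb.oneParam hf (-t⁻¹))⁻¹) * ↑(hb.oneParam he t)⁻¹ := by
  simp [weylUnit, mul_assoc]

theorem conj_weylUnit_mem (t : F) {L : Submodule F A} (h₁ : ∀ y ∈ L, e * y - y * e ∈ L)
    (h₂ : ∀ y ∈ L, f * y - y * f ∈ L) {y : A} (hy : y ∈ L) :
    (hb.weylUnit he hf t : A) * y * ↑(hb.weylUnit he hf t)⁻¹ ∈ L := by
  rw [conj_weylUnit]
  exact hb.conj_oneParam_mem he t h₁ (hb.conj_oneParam_mem hf _ h₂ (hb.conj_oneParam_mem he t h₁ hy))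

theorem conj_add {A : Type*} [Ring A] (g : Aˣ) (x y : A) :
    (g : A) * (x + y) * ↑g⁻¹ = (g : A) * x * ↑g⁻¹ + (g : A) * y * ↑g⁻¹ := by
  rw [mul_add, add_mul]

theorem conj_smul (g : Aˣ) (c : F) (x : A) : (g : A) * (c • x) * ↑g⁻¹ = c • ((g : A) * x * ↑g⁻¹) := by
  rw [mul_smul_comm, smul_mul_assoc]

variable {h : A}

theorem conj_pos_e (t : F) : (hb.oneParam he t : A) * e * ↑(hb.oneParam he t)⁻¹ = e := by
  rw [hb.conj_oneParam he t (z := 0) (v := 0)] <;> simp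

theorem conj_pos_h (hhe : h * e - e * h = (2 : F) • e) (t : F) : (hb.oneParam he t : A) * h * ↑(hb.oneParam he t)⁻¹ = h - (2 * t) • e := by
  rw [hb.conj_oneParam he t (z := -(2 : F) • e) (v := 0)]
  · module
  · rw [← neg_sub, hhe, neg_smul]
  · simp
  · simp

theorem conj_pos_f (hef : e * f - f * e = h) (hhe : h * e - e * h = (2 : F) • e) (t : F) : (hb.oneParam he t : A) * f * ↑(hb.oneParam he t)⁻¹ = f + t • h - t ^ 2 • e := by
  rw [hb.conj_oneParam he t hef (v := -(2 : F) • e)]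
  · have := hb.two_ne_zero
    match_scalars <;> field_simp
  · rw [← neg_sub, hhe, neg_smul]
  · simp

theorem conj_neg_e (hef : e * f - f * e = h) (hhf : h * f - f * h = -(2 : F) • f) (t : F) : (hb.oneParam hf t : A) * e * ↑(hb.oneParam hf t)⁻¹ = e - t • h - t ^ 2 • f := by
  rw [hb.conj_oneParam hf t (z := -h) (v := -(2 : F) • f)]
  · have := hb.two_ne_zero
    match_scalars <;> field_simp
  · rw [← neg_sub, hef]
  · rw [← hhf]; noncomm_ring
  · simp

theorem conj_weylUnit_e (hef : e * f - f * e = h) (hhe : h * e - e * h = (2 : F) • e)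
    (hhf : h * f - f * h = -(2 : F) • f) {t : F} (ht : t ≠ 0) : (hb.weylUnit he hf t : A) * e * ↑(hb.weylUnit he hf t)⁻¹ = -(t⁻¹ ^ 2) • f := by
  rw [conj_weylUnit, hb.conj_pos_e he, hb.conj_neg_e hf hef hhf]
  simp only [sub_eq_add_neg, conj_add, ← neg_smul, conj_smul, hb.conj_pos_e he,
    hb.conj_pos_h he hhe, hb.conj_pos_f he hef hhe]
  match_scalars <;> field [ht]

theorem conj_weylUnit_of_commutator (hef : e * f - f * e = h)
    (hhe : h * e - e * h = (2 : F) • e) (hhf : h * f - f * h = -(2 : F) • f) {t : F} (ht : t ≠ 0) {d : A} {c : F} (hde : d * e - e * d = c • e) (hdf : d * f - f * d = -c • f) :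
    (hb.weylUnit he hf t : A) * d * ↑(hb.weylUnit he hf t)⁻¹ = d - c • h := by
  have h1 : ∀ t, (hb.oneParam he t : A) * d * ↑(hb.oneParam he t)⁻¹ = d - (t * c) • e := by
    intro t
    rw [hb.conj_oneParam he t (z := -c • e) (v := 0)]
    · module
    · rw [← neg_sub, hde, neg_smul]
    · simp
    · simp
  have h2 : ∀ t, (hb.oneParam hf t : A) * d * ↑(hb.oneParam hf t)⁻¹ = d + (t * c) • f := by
    intro t
    rw [hb.conj_oneParam hf t (z := c • f) (v := 0)]
    · module
    · rw [← neg_sub, hdf, neg_smul, neg_neg]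
    · simp
    · simp
  rw [conj_weylUnit, h1]
  simp only [sub_eq_add_neg, conj_add, ← neg_smul, conj_smul, hb.conj_pos_e he,
    hb.conj_pos_h he hhe, hb.conj_pos_f he hef hhe, hb.conj_neg_e hf hef hhf, h1, h2]
  match_scalars <;> field [ht]

end Weyl

end ExpBound

end

section

namespace WtMatrix

variable {ι Λ F : Type*} [AddCommGroup Λ] [CommRing F] (wt : ι → Λ)

/-- A matrix is homogeneous of degree `δ` if it shifts weights by `δ`. -/
def IsHom (δ : Λ) (x : Matrix ι ι F) : Prop := ∀ a b, x a b ≠ 0 → wt a - wt b = δ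

open Classical in
/-- The homogeneous component of degree `δ` of a matrix. -/
noncomputable def comp (δ : Λ) : Matrix ι ι F →ₗ[F] Matrix ι ι F where
  toFun x := Matrix.of fun a b => if wt a - wt b = δ then x a b else 0
  map_add' x y := by ext a b; by_cases h : wt a - wt b = δ <;> simp [h]
  map_smul' c x := by ext a b; by_cases h : wt a - wt b = δ <;> simp [h]

variable {wt} {δ δ' : Λ} {x y : Matrix ι ι F} {a b : ι}

theorem comp_apply_of_eq (h : wt a - wt b = δ) : comp wt δ x a b = x a b := if_pos h

theorem comp_apply_of_ne (h : wt a - wt b ≠ δ) : comp wt δ x a b = 0 := if_neg h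

theorem IsHom.eq_zero (hx : IsHom wt δ x) (h : wt a - wt b ≠ δ) : x a b = 0 := by
  by_contra h'
  exact h (hx a b h')

theorem isHom_comp : IsHom wt δ (comp wt δ x) := by
  intro a b h
  by_contra h'
  exact h (comp_apply_of_ne h')

theorem IsHom.comp_eq (hx : IsHom wt δ x) : comp wt δ x = x := by
  ext a b
  by_cases h : wt a - wt b = δ
  · exact comp_apply_of_eq h
  · rw [comp_apply_of_ne h, hx.eq_zero h]

theorem IsHom.comp_eq_zero (hx : IsHom wt δ x) (hne : δ ≠ δ') : comp wt δ' x = 0 := by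
  ext a b
  by_cases h : wt a - wt b = δ'
  · rw [comp_apply_of_eq h, hx.eq_zero (by rw [h]; exact hne.symm)]; rfl
  · rw [comp_apply_of_ne h]; rfl

theorem IsHom.add (hx : IsHom wt δ x) (hy : IsHom wt δ y) : IsHom wt δ (x + y) := by
  intro a b h
  by_contra h'
  exact h (by rw [Matrix.add_apply, hx.eq_zero h', hy.eq_zero h', add_zero])

theorem IsHom.smul (c : F) (hx : IsHom wt δ x) : IsHom wt δ (c • x) := by
  intro a b h
  by_contra h'
  exact h (by rw [Matrix.smul_apply, hx.eq_zero h', smul_zero])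

theorem IsHom.neg (hx : IsHom wt δ x) : IsHom wt δ (-x) := by
  simpa using hx.smul (-1)

theorem IsHom.sub (hx : IsHom wt δ x) (hy : IsHom wt δ y) : IsHom wt δ (x - y) := by
  rw [sub_eq_add_neg]; exact hx.add hy.neg

theorem isHom_neg_wt : IsHom (-wt) δ x ↔ IsHom wt (-δ) x := by
  refine forall₂_congr fun a b => imp_congr_right fun _ => ?_
  rw [Pi.neg_apply, Pi.neg_apply, ← neg_inj, neg_sub_neg, neg_sub]

theorem isHom_diagonal [DecidableEq ι] (φ : ι → F) : IsHom wt 0 (Matrix.diagonal φ) := by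
  intro a b h
  by_cases hab : a = b
  · rw [hab, sub_self]
  · exact absurd (Matrix.diagonal_apply_ne _ hab) h

theorem isHom_one [DecidableEq ι] : IsHom wt 0 (1 : Matrix ι ι F) := by
  rw [← Matrix.diagonal_one]; exact isHom_diagonal _

theorem isHom_single [DecidableEq ι] (a b : ι) (c : F) : IsHom wt (wt a - wt b) (Matrix.single a b c) := by
  intro a' b' h
  rw [Matrix.single_apply] at h
  split_ifs at h with h'
  · rw [h'.1, h'.2]
  · exact absurd rfl h

/-- All homogeneous components have nonnegative degree. -/
def IsNonneg [LE Λ] (wt : ι → Λ) (x : Matrix ι ι F) : Prop := ∀ a b, x a b ≠ 0 → 0 ≤ wt a - wt b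

theorem IsHom.isNonneg [LE Λ] (hx : IsHom wt δ x) (h : 0 ≤ δ) : IsNonneg wt x := fun a b hab => by
  rwa [hx a b hab]

section Fintype

variable [Fintype ι]

theorem IsHom.mul (hx : IsHom wt δ x) (hy : IsHom wt δ' y) : IsHom wt (δ + δ') (x * y) := by
  intro a b h
  obtain ⟨c, -, hc⟩ := Finset.exists_ne_zero_of_sum_ne_zero h
  rw [← hx a c (left_ne_zero_of_mul hc), ← hy c b (right_ne_zero_of_mul hc), sub_add_sub_cancel]

theorem IsHom.commutator (hx : IsHom wt δ x) (hy : IsHom wt δ' y) : IsHom wt (δ + δ') (x * y - y * x) :=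
  (hx.mul hy).sub (add_comm δ δ' ▸ hy.mul hx)

theorem IsHom.pow [DecidableEq ι] (hx : IsHom wt δ x) (k : ℕ) : IsHom wt (k • δ) (x ^ k) := by
  induction k with
  | zero => simpa using isHom_one
  | succ k ih => rw [pow_succ, succ_nsmul]; exact ih.mul hx

theorem comp_mul_of_forall (hδ : δ ≠ 0)
    (h : ∀ a c b, wt a - wt b = δ → wt c ≠ wt a → wt c ≠ wt b → x a c * y c b = 0) :
    comp wt δ (x * y) = comp wt δ x * comp wt 0 y + comp wt 0 x * comp wt δ y := by
  ext a b
  by_cases hab : wt a - wt b = δ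
  · rw [comp_apply_of_eq hab, Matrix.add_apply, Matrix.mul_apply, Matrix.mul_apply, Matrix.mul_apply,
      ← Finset.sum_add_distrib]
    refine Finset.sum_congr rfl fun c _ => ?_
    by_cases h1 : wt c = wt b
    · rw [comp_apply_of_eq (by rw [h1, hab]), comp_apply_of_eq (by rw [h1, sub_self]),
        comp_apply_of_ne (a := c) (δ := δ) (by rw [h1, sub_self]; exact hδ.symm), mul_zero, add_zero]
    · by_cases h2 : wt c = wt a
      · rw [comp_apply_of_ne (a := a) (δ := δ) (by rw [h2, sub_self]; exact hδ.symm),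
          comp_apply_of_eq (δ := δ) (by rw [h2, hab]),
          comp_apply_of_eq (a := a) (b := c) (by rw [h2, sub_self]), zero_mul, zero_add]
      · rw [h a c b hab h2 h1, comp_apply_of_ne (a := c) (δ := 0) (by rwa [sub_ne_zero]),
          comp_apply_of_ne (a := a) (δ := 0) (by rw [sub_ne_zero]; exact Ne.symm h2), mul_zero, zero_mul, zero_add]
  · rw [comp_apply_of_ne hab]
    by_contra h0
    have h1 : IsHom wt δ (comp wt δ x * comp wt 0 y) := by
      simpa using (isHom_comp (wt := wt) (δ := δ) (x := x)).mul (isHom_comp (δ := 0) (x := y))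
    have h2 : IsHom wt δ (comp wt 0 x * comp wt δ y) := by
      simpa using (isHom_comp (wt := wt) (δ := 0) (x := x)).mul (isHom_comp (δ := δ) (x := y))
    exact hab (h1.add h2 a b (Ne.symm h0))

theorem comp_mul_of_isHom_zero (hy : IsHom wt 0 y) : comp wt δ (x * y) = comp wt δ x * y := by
  ext a b
  by_cases hab : wt a - wt b = δ
  · rw [comp_apply_of_eq hab, Matrix.mul_apply, Matrix.mul_apply]
    refine Finset.sum_congr rfl fun c _ => ?_
    by_cases h : wt c - wt b = 0
    · rw [comp_apply_of_eq (by rw [← hab, sub_eq_zero.1 h])]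
    · rw [hy.eq_zero h, mul_zero, mul_zero]
  · rw [comp_apply_of_ne hab]
    by_contra h0
    have := (isHom_comp (δ := δ) (x := x)).mul hy a b (Ne.symm h0)
    rw [add_zero] at this
    exact hab this

section Order

variable [PartialOrder Λ] [IsOrderedAddMonoid Λ]

theorem IsNonneg.mul (hx : IsNonneg wt x) (hy : IsNonneg wt y) : IsNonneg wt (x * y) := by
  intro a b h
  obtain ⟨c, -, hc⟩ := Finset.exists_ne_zero_of_sum_ne_zero h
  rw [← sub_add_sub_cancel _ (wt c)]
  exact add_nonneg (hx a c (left_ne_zero_of_mul hc)) (hy c b (right_ne_zero_of_mul hc))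

theorem IsNonneg.comp_zero_mul (hx : IsNonneg wt x) (hy : IsNonneg wt y) :
    comp wt 0 (x * y) = comp wt 0 x * comp wt 0 y := by
  ext a b
  by_cases hab : wt a - wt b = 0
  · rw [comp_apply_of_eq hab, Matrix.mul_apply, Matrix.mul_apply]
    refine Finset.sum_congr rfl fun c _ => ?_
    by_cases h : wt c - wt b = 0
    · rw [comp_apply_of_eq h, comp_apply_of_eq (by rw [← hab, sub_eq_zero.1 h])]
    · rw [comp_apply_of_ne h, mul_zero]
      by_contra h0
      have h1 := hx a c (left_ne_zero_of_mul h0)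
      have h2 := hy c b (right_ne_zero_of_mul h0)
      rw [sub_eq_zero.1 hab, ← neg_sub, neg_nonneg] at h1
      exact h (le_antisymm h1 h2)
  · rw [comp_apply_of_ne hab]
    by_contra h0
    have := (isHom_comp (x := x)).mul (isHom_comp (x := y)) a b (Ne.symm h0)
    rw [add_zero] at this
    exact hab this

theorem isNonneg_truncExp {F : Type*} [Field F] {x : Matrix ι ι F} [DecidableEq ι] (hx : IsHom wt δ x) (h : 0 ≤ δ)
    (m : ℕ) : IsNonneg wt (truncExp F m x) := by
  intro a b hab
  rw [truncExp, Matrix.sum_apply] at hab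
  obtain ⟨k, -, hk⟩ := Finset.exists_ne_zero_of_sum_ne_zero hab
  exact ((hx.pow k).smul _).isNonneg (nsmul_nonneg h k) a b hk

end Order

theorem comp_truncExp {F : Type*} [Field F] {x : Matrix ι ι F} [DecidableEq ι] [IsAddTorsionFree Λ]
    (hx : IsHom wt δ x) (h : δ ≠ 0) {m : ℕ} (hm : 2 ≤ m) : comp wt δ (truncExp F m x) = x := by
  rw [truncExp, map_sum, Finset.sum_eq_single_of_mem 1 (Finset.mem_range.2 hm)]
  · simpa using hx.comp_eq
  · intro k _ hk
    refine ((hx.pow k).smul _).comp_eq_zero fun h' => hk ?_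
    obtain _ | _ | k := k
    · exact absurd (by simpa using h'.symm) h
    · rfl
    · rw [succ_nsmul, add_eq_right] at h'
      exact absurd ((nsmul_eq_zero_iff_right (Nat.succ_ne_zero k)).1 h') h

end Fintype

end WtMatrix

end

section

open CartanRep

/-- Iterated commutators of the elements `e s`. -/
inductive IsBracket {B A : Type*} [Ring A] (e : B → A) : A → Prop
  | base (s : B) : IsBracket e (e s)
  | step (s : B) (x : A) : IsBracket e x → IsBracket e (e s * x - x * e s)

namespace IsBracket

section Algebra

variable {B F A : Type*} [Field F] [Ring A] [Algebra F A] (f : B → A) (L₀ : Submodule F A)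

theorem commutator_mem_span {y : A} (hy : y ∈ Submodule.span F {x | IsBracket f x}) (t : B) :
    f t * y - y * f t ∈ Submodule.span F {x | IsBracket f x} := by
  refine (Submodule.span_le (p := (Submodule.span F {x | IsBracket f x}).comap (commutatorMap F (f t)))).2 ?_ hy
  exact fun x hx => Submodule.subset_span (IsBracket.step t x hx)

variable {f L₀} (h₂ : ∀ z ∈ L₀, ∀ t, ∃ c : F, z * f t - f t * z = c • f t)
include h₂

theorem zero_commutator_mem {z : A} (hz : z ∈ L₀) {x : A} (hx : IsBracket f x) :
    z * x - x * z ∈ Submodule.span F {x | IsBracket f x} := by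
  induction hx with
  | base t =>
    obtain ⟨c, hc⟩ := h₂ z hz t
    rw [hc]
    exact Submodule.smul_mem _ _ (Submodule.subset_span (IsBracket.base t))
  | step t x hx ih =>
    obtain ⟨c, hc⟩ := h₂ z hz t
    have e1 : z * (f t * x - x * f t) - (f t * x - x * f t) * z =
        ((z * f t - f t * z) * x - x * (z * f t - f t * z)) + (f t * (z * x - x * z) - (z * x - x * z) * f t) := by
      noncomm_ring
    rw [e1, hc, smul_mul_assoc, mul_smul_comm, ← smul_sub]
    exact Submodule.add_mem _ (Submodule.smul_mem _ _ (Submodule.subset_span (IsBracket.step t x hx)))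
      (commutator_mem_span f ih t)

theorem commutator_mem {e : A} (h₁ : ∀ t, e * f t - f t * e ∈ L₀) {x : A} (hx : IsBracket f x) :
    e * x - x * e ∈ L₀ ⊔ Submodule.span F {x | IsBracket f x} := by
  induction hx with
  | base t => exact Submodule.mem_sup_left (h₁ t)
  | step t x hx ih =>
    have e1 : e * (f t * x - x * f t) - (f t * x - x * f t) * e =
        ((e * f t - f t * e) * x - x * (e * f t - f t * e)) + (f t * (e * x - x * e) - (e * x - x * e) * f t) := by
      noncomm_ring
    rw [e1]
    refine Submodule.add_mem _ (Submodule.mem_sup_right (zero_commutator_mem h₂ (h₁ t) hx)) (Submodule.mem_sup_right ?_)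
    obtain ⟨z, hz, w, hw, he⟩ := Submodule.mem_sup.1 ih
    obtain ⟨c, hc⟩ := h₂ z hz t
    have e2 : f t * (z + w) - (z + w) * f t = -(z * f t - f t * z) + (f t * w - w * f t) := by noncomm_ring
    rw [← he, e2, hc]
    exact Submodule.add_mem _ (Submodule.neg_mem _ (Submodule.smul_mem _ _ (Submodule.subset_span (IsBracket.base t))))
      (commutator_mem_span f hw t)

end Algebra

variable {B ι F : Type*} [DecidableEq B] [Fintype ι] [DecidableEq ι] [Field F] {wt : ι → B → ℤ} {e : B → Matrix ι ι F}

theorem exists_isHom (he : ∀ i, WtMatrix.IsHom wt (root i) (e i)) {x : Matrix ι ι F} (hx : IsBracket e x) :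
    ∃ δ, WtMatrix.IsHom wt δ x ∧ 0 ≤ δ ∧ δ ≠ 0 ∧ ((∃ s, x = e s ∧ δ = root s) ∨ ∀ (s : B) (k : ℤ), δ = k • root s → x = 0) := by
  have hroot : ∀ i : B, (0 : B → ℤ) ≤ root i := fun i => by simp [root]
  induction hx with
  | base s => exact ⟨root s, he s, hroot s, by simp [root], Or.inl ⟨s, rfl, rfl⟩⟩
  | step t x hx ih =>
    obtain ⟨δ, hδ, h0, h0', h⟩ := ih
    refine ⟨root t + δ, (he t).commutator hδ, add_nonneg (hroot t) h0, ?_, Or.inr fun s k hk => ?_⟩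
    · intro h'
      exact h0' (le_antisymm (by rw [← h']; exact le_add_of_nonneg_left (hroot t)) h0)
    · have hts : t = s := by
        by_contra hts
        have h1 := congrFun hk t
        have h2 := h0 t
        simp [root, hts] at h1 h2
        omega
      subst hts
      rcases h with ⟨u, rfl, rfl⟩ | h
      · have : t = u := by
          by_contra htu
          have h1 := congrFun hk u
          simp [root, Ne.symm htu] at h1
        rw [this, sub_self]
      · rw [h t (k - 1) (by rw [sub_smul, ← hk, one_smul, add_sub_cancel_left])]
        simp

end IsBracket

namespace WtMatrix

variable {ι B F : Type*} [DecidableEq ι] [Field F]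

/-- The diagonal matrix recording the `j`-th weight coordinate. -/
def wtDiag (F : Type*) [Field F] (wt : ι → B → ℤ) (j : B) : Matrix ι ι F := Matrix.diagonal fun b => (wt b j : F)

variable [Fintype B] [DecidableEq B]

/-- The matrix of the simple coroot of index `i`, shifted by one. -/
def corootDiag (F : Type*) [Field F] (a : B → B → ℤ) (wt : ι → B → ℤ) (i : B) : Matrix ι ι F :=
  Matrix.diagonal fun b => ((1 + coroot a i (wt b) : ℤ) : F)

omit [DecidableEq B] in
theorem corootDiag_eq (a : B → B → ℤ) (wt : ι → B → ℤ) (i : B) :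
    corootDiag F a wt i = 1 + ∑ j, (a i j : F) • wtDiag F wt j := by
  ext b c
  by_cases h : b = c
  · subst h
    simp [corootDiag, wtDiag, coroot_apply, Matrix.sum_apply, mul_comm]
  · simp [corootDiag, wtDiag, Matrix.sum_apply, h]

variable [Fintype ι]

omit [DecidableEq B] [Fintype B] in
theorem IsHom.wtDiag_commutator {wt : ι → B → ℤ} {δ : B → ℤ} {x : Matrix ι ι F} (hx : IsHom wt δ x) (j : B) :
    wtDiag F wt j * x - x * wtDiag F wt j = (δ j : F) • x := by
  ext b c
  rw [Matrix.sub_apply, wtDiag, Matrix.diagonal_mul, Matrix.mul_diagonal, Matrix.smul_apply, smul_eq_mul]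
  by_cases h : wt b - wt c = δ
  · rw [← h]; simp; ring
  · rw [hx.eq_zero h]; simp

omit [DecidableEq B] in
theorem IsHom.corootDiag_commutator {a : B → B → ℤ} {wt : ι → B → ℤ} {δ : B → ℤ} {x : Matrix ι ι F}
    (hx : IsHom wt δ x) (i : B) :
    corootDiag F a wt i * x - x * corootDiag F a wt i = (coroot a i δ : F) • x := by
  ext b c
  rw [Matrix.sub_apply, corootDiag, Matrix.diagonal_mul, Matrix.mul_diagonal, Matrix.smul_apply, smul_eq_mul]
  by_cases h : wt b - wt c = δ
  · rw [← h]; simp; ring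
  · rw [hx.eq_zero h]; simp

/-- Matrices satisfying the defining relations of a semisimple Lie algebra with Cartan matrix `a`, acting on a space
with basis `ι` of weights `wt`, where the weights are measured relative to a highest weight equal to the Weyl
vector. -/
structure IsChevalleyRep (a : B → B → ℤ) (wt : ι → B → ℤ) (e f : B → Matrix ι ι F) : Prop where
  hom_e : ∀ i, IsHom wt (root i) (e i)
  hom_f : ∀ i, IsHom wt (-root i) (f i)
  comm : ∀ i j, e i * f j - f j * e i = if i = j then corootDiag F a wt i else 0
  e_ne_zero : ∀ i, e i ≠ 0

/-- The Lie algebra generated by the weight matrices, the `e s` and the `f s`. -/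
def lieSpan (wt : ι → B → ℤ) (e f : B → Matrix ι ι F) : Submodule F (Matrix ι ι F) :=
  Submodule.span F (Set.range (wtDiag F wt) ∪ {1}) ⊔ Submodule.span F {x | IsBracket e x} ⊔
    Submodule.span F {x | IsBracket f x}

namespace IsChevalleyRep

variable {a : B → B → ℤ} {wt : ι → B → ℤ} {e f : B → Matrix ι ι F} (h : IsChevalleyRep a wt e f)

omit [Fintype B] [DecidableEq B] in
theorem exists_commutator_eq {δ : B → B → ℤ} {e : B → Matrix ι ι F} (he : ∀ i, IsHom wt (δ i) (e i)) (z)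
    (hz : z ∈ Submodule.span F (Set.range (wtDiag F wt) ∪ {1})) (t : B) :
    ∃ c : F, z * e t - e t * z = c • e t := by
  induction hz using Submodule.span_induction with
  | mem x hx =>
    rcases hx with ⟨j, rfl⟩ | rfl
    · exact ⟨_, (he t).wtDiag_commutator j⟩
    · exact ⟨0, by simp⟩
  | zero => exact ⟨0, by simp⟩
  | add x y _ _ hx hy =>
    obtain ⟨c, hc⟩ := hx
    obtain ⟨d, hd⟩ := hy
    exact ⟨c + d, by rw [add_smul, ← hc, ← hd]; noncomm_ring⟩
  | smul r x _ hx =>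
    obtain ⟨c, hc⟩ := hx
    exact ⟨r * c, by rw [mul_smul, ← hc]; simp [smul_sub]⟩

omit [Fintype ι] [DecidableEq B] in
theorem corootDiag_mem (i : B) : corootDiag F a wt i ∈ Submodule.span F (Set.range (wtDiag F wt) ∪ {1}) := by
  rw [corootDiag_eq]
  exact Submodule.add_mem _ (Submodule.subset_span (Or.inr rfl))
    (Submodule.sum_mem _ fun j _ => Submodule.smul_mem _ _ (Submodule.subset_span (Or.inl ⟨j, rfl⟩)))

omit [Fintype B] [DecidableEq B] in
theorem wtDiag_mem (j : B) : wtDiag F wt j ∈ lieSpan wt e f :=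
  Submodule.mem_sup_left (Submodule.mem_sup_left (Submodule.subset_span (Or.inl ⟨j, rfl⟩)))

include h

theorem commutator_e_mem (s : B) {y : Matrix ι ι F} (hy : y ∈ lieSpan wt e f) :
    e s * y - y * e s ∈ lieSpan wt e f := by
  refine (show lieSpan wt e f ≤ (lieSpan wt e f).comap (commutatorMap F (e s)) from ?_) hy
  refine sup_le (sup_le ?_ ?_) ?_
  · intro z hz
    obtain ⟨c, hc⟩ := exists_commutator_eq h.hom_e z hz s
    rw [Submodule.mem_comap, commutatorMap_apply, ← neg_sub, hc]
    exact neg_mem (Submodule.smul_mem _ _ (Submodule.mem_sup_left (Submodule.mem_sup_right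
      (Submodule.subset_span (IsBracket.base s)))))
  · intro z hz
    exact Submodule.mem_sup_left (Submodule.mem_sup_right (IsBracket.commutator_mem_span e hz s))
  · refine Submodule.span_le.2 fun z hz => ?_
    have := IsBracket.commutator_mem (exists_commutator_eq h.hom_f) (e := e s) (fun t => ?_) hz
    · refine (sup_le (le_sup_of_le_left le_sup_left) le_sup_right :
        Submodule.span F (Set.range (wtDiag F wt) ∪ {1}) ⊔ _ ≤ lieSpan wt e f) this
    · rw [h.comm]
      split_ifs
      · exact corootDiag_mem _
      · exact zero_mem _

theorem commutator_f_mem (s : B) {y : Matrix ι ι F} (hy : y ∈ lieSpan wt e f) :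
    f s * y - y * f s ∈ lieSpan wt e f := by
  refine (show lieSpan wt e f ≤ (lieSpan wt e f).comap (commutatorMap F (f s)) from ?_) hy
  refine sup_le (sup_le ?_ ?_) ?_
  · intro z hz
    obtain ⟨c, hc⟩ := exists_commutator_eq h.hom_f z hz s
    rw [Submodule.mem_comap, commutatorMap_apply, ← neg_sub, hc]
    exact neg_mem (Submodule.smul_mem _ _ (Submodule.mem_sup_right (Submodule.subset_span (IsBracket.base s))))
  · refine Submodule.span_le.2 fun z hz => ?_
    have := IsBracket.commutator_mem (exists_commutator_eq h.hom_e) (e := f s) (fun t => ?_) hz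
    · exact Submodule.mem_sup_left this
    · rw [← neg_sub, h.comm]
      split_ifs
      · exact neg_mem (corootDiag_mem _)
      · exact neg_mem (zero_mem _)
  · intro z hz
    exact Submodule.mem_sup_right (IsBracket.commutator_mem_span f hz s)

theorem lieSpan_le {p : Submodule F (Matrix ι ι F)}
    (hp : ∀ δ x, x ∈ lieSpan wt e f → IsHom wt δ x → (0 ≤ δ ∨ δ ≤ 0) →
      (∀ (s : B) (k : ℤ), 0 < k → δ = k • root s → x = 0 ∨ k = 1 ∧ x = e s) → x ∈ p) : lieSpan wt e f ≤ p := by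
  have hr : ∀ s : B, (root s : B → ℤ) s = 1 := fun s => by simp [root]
  refine sup_le (sup_le ?_ ?_) ?_
  · refine Submodule.span_le.2 fun x hx => hp 0 x (Submodule.mem_sup_left (Submodule.mem_sup_left
      (Submodule.subset_span hx))) ?_ (Or.inl le_rfl) fun s k hk h0 => ?_
    · rcases hx with ⟨j, rfl⟩ | rfl
      · exact isHom_diagonal _
      · exact isHom_one
    · have := congrFun h0 s
      rw [Pi.smul_apply, hr] at this
      simp at this
      omega
  · refine Submodule.span_le.2 fun x hx => ?_
    obtain ⟨δ, hδ, h0, -, h1⟩ := IsBracket.exists_isHom h.hom_e hx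
    refine hp δ x (Submodule.mem_sup_left (Submodule.mem_sup_right (Submodule.subset_span hx))) hδ (Or.inl h0)
      fun s k hk hs => ?_
    rcases h1 with ⟨t, rfl, rfl⟩ | h1
    · right
      have h2 := congrFun hs t
      rw [hr] at h2
      have hts : t = s := by
        by_contra hts
        simp [root, hts] at h2
      subst hts
      rw [Pi.smul_apply, hr] at h2
      exact ⟨by simpa using h2.symm, rfl⟩
    · exact Or.inl (h1 s k hs)
  · refine Submodule.span_le.2 fun x hx => ?_
    obtain ⟨δ, hδ, h0, -, h1⟩ := IsBracket.exists_isHom (wt := -wt) (fun i => isHom_neg_wt.2 (h.hom_f i)) hx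
    refine hp (-δ) x (Submodule.mem_sup_right (Submodule.subset_span hx)) (isHom_neg_wt.1 hδ)
      (Or.inr (neg_nonpos.2 h0)) fun s k hk hs => ?_
    have h2 := congrFun hs s
    have h3 := h0 s
    rw [Pi.smul_apply, hr, Pi.neg_apply] at h2
    simp at h2 h3
    omega

theorem comp_mem {x : Matrix ι ι F} (hx : x ∈ lieSpan wt e f) (δ : B → ℤ) : comp wt δ x ∈ lieSpan wt e f := by
  refine h.lieSpan_le (p := (lieSpan wt e f).comap (comp wt δ)) (fun δ' y hy hδ' _ _ => ?_) hx
  by_cases hd : δ' = δ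
  · subst hd
    rwa [Submodule.mem_comap, hδ'.comp_eq]
  · rw [Submodule.mem_comap, hδ'.comp_eq_zero hd]
    exact zero_mem _

theorem nonneg_or_nonpos {x : Matrix ι ι F} (hx : x ∈ lieSpan wt e f) {δ : B → ℤ} (h0 : comp wt δ x ≠ 0) :
    0 ≤ δ ∨ δ ≤ 0 := by
  by_contra hd
  refine h0 (h.lieSpan_le (p := LinearMap.ker (comp wt δ)) (fun δ' y hy hδ' hd' _ => ?_) hx)
  exact hδ'.comp_eq_zero fun h' => hd (h' ▸ hd')

theorem comp_smul_root {x : Matrix ι ι F} (hx : x ∈ lieSpan wt e f) (s : B) {k : ℤ} (hk : 1 < k) :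
    comp wt (k • root s) x = 0 := by
  refine h.lieSpan_le (p := LinearMap.ker (comp wt (k • root s))) (fun δ' y hy hδ' hd' h1 => ?_) hx
  by_cases hd : δ' = k • root s
  · rcases h1 s k (by omega) hd with rfl | ⟨rfl, -⟩
    · exact zero_mem _
    · omega
  · exact hδ'.comp_eq_zero hd

theorem comp_root {x : Matrix ι ι F} (hx : x ∈ lieSpan wt e f) (s : B) :
    ∃ c : F, comp wt (root s) x = c • e s := by
  suffices comp wt (root s) x ∈ Submodule.span F {e s} by
    obtain ⟨c, hc⟩ := Submodule.mem_span_singleton.1 this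
    exact ⟨c, hc.symm⟩
  refine h.lieSpan_le (p := (Submodule.span F {e s}).comap (comp wt (root s))) (fun δ' y hy hδ' hd' h1 => ?_) hx
  rw [Submodule.mem_comap]
  by_cases hd : δ' = root s
  · subst hd
    rw [hδ'.comp_eq]
    rcases h1 s 1 one_pos (one_smul _ _).symm with rfl | ⟨-, rfl⟩
    · exact zero_mem _
    · exact Submodule.mem_span_singleton_self _
  · rw [hδ'.comp_eq_zero hd]
    exact zero_mem _

end IsChevalleyRep

end WtMatrix

end

section

namespace CoxeterSystem

variable {B W : Type*} [Group W] {M : CoxeterMatrix B} {cs : CoxeterSystem M W}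

theorem hasBuilding_of_subgroup {G F : Type*} [Group G] [Finite G] {P : Subgroup G} {n : B → G} {x : B → F → G}
    (one : cs.redProd n 1 ∈ P)
    (simple_mul : ∀ s w, (cs.redProd n (cs.simple s * w))⁻¹ * n s * cs.redProd n w ∈ P)
    (of_not_descent : ∀ s w, ¬ cs.IsLeftDescent w s → ∀ b ∈ P, ∃ b₁ ∈ P, ∃ b₂ ∈ P,
      n s * b * cs.redProd n w = b₁ * n s * cs.redProd n w * b₂)
    (simple : ∀ s, ∀ b ∈ P, n s * b * n s ∈ P ∨ ∃ b₁ ∈ P, ∃ b₂ ∈ P, n s * b * n s = b₁ * n s * b₂)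
    (not_mem : ∀ w, w ≠ 1 → cs.redProd n w ∉ P)
    (mem : ∀ s t, x s t ∈ P)
    (existsUnique : ∀ s, ∀ b ∈ P, ∃! t, n s * (x s t)⁻¹ * b * (n s)⁻¹ ∈ P)
    [Fintype B] {a : B → B → ℤ} (ha : IsCartanOf M a) [Fintype W] [DecidableEq W] : cs.HasBuilding (Nat.card F) := by
  set Γ : Subgroup G := Subgroup.closure (P ∪ Set.range n) with hΓ
  have hP : ∀ {b}, b ∈ P → b ∈ Γ := fun h => Subgroup.subset_closure (Or.inl h)
  let n' : B → Γ := fun s => ⟨n s, Subgroup.subset_closure (Or.inr ⟨s, rfl⟩)⟩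
  have hν : ∀ w, ((cs.redProd n' w : Γ) : G) = cs.redProd n w := fun w => cs.map_redProd Γ.subtype w
  have : cs.IsBNPair (P.subgroupOf Γ) n' (cs.redProd n') fun s t => ⟨x s t, hP (mem s t)⟩ :=
    { one := by simpa [Subgroup.mem_subgroupOf, hν] using one
      simple_mul := fun s w => by simpa [Subgroup.mem_subgroupOf, hν] using simple_mul s w
      of_not_descent := fun s w h b hb => by
        obtain ⟨b₁, h₁, b₂, h₂, he⟩ := of_not_descent s w h b hb
        exact ⟨⟨b₁, hP h₁⟩, h₁, ⟨b₂, hP h₂⟩, h₂, Subtype.ext (by simpa [hν] using he)⟩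
      simple := fun s b hb => by
        refine (simple s b hb).imp (fun h => h) ?_
        rintro ⟨b₁, h₁, b₂, h₂, he⟩
        exact ⟨⟨b₁, hP h₁⟩, h₁, ⟨b₂, hP h₂⟩, h₂, Subtype.ext he⟩
      not_mem := fun w hw => by simpa [Subgroup.mem_subgroupOf, hν] using not_mem w hw
      mem := mem
      existsUnique := fun s b hb => existsUnique s b hb
      gen := by
        have h := Subgroup.closure_closure_coe_preimage (k := (P ∪ Set.range n : Set G))
        rw [← h]
        congr 1
        ext g
        simp only [Set.mem_union, Set.mem_preimage, SetLike.mem_coe, Subgroup.mem_subgroupOf, Set.mem_range]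
        exact or_congr Iff.rfl (exists_congr fun s => Subtype.ext_iff) }
  exact this.hasBuilding ha

end CoxeterSystem

namespace WtMatrix

open CartanRep

variable {ι Λ F : Type*} [Fintype ι] [DecidableEq ι] [AddCommGroup Λ] [Field F]

theorem conj_truncExp {A : Type*} [Ring A] [Algebra F A] (g : Aˣ) (m : ℕ) (x : A) :
    (g : A) * truncExp F m x * ↑g⁻¹ = truncExp F m (g * x * ↑g⁻¹) := by
  simp only [truncExp, Finset.mul_sum, Finset.sum_mul, Units.conj_pow, mul_smul_comm, smul_mul_assoc]

/-- The group of matrices of nonnegative degree which normalise `L`. -/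
def parabolic [PartialOrder Λ] [IsOrderedAddMonoid Λ] (wt : ι → Λ) (L : Submodule F (Matrix ι ι F)) :
    Subgroup (Matrix ι ι F)ˣ where
  carrier := {g | (∀ y ∈ L, g.val * y * (g⁻¹).val ∈ L) ∧ (∀ y ∈ L, (g⁻¹).val * y * g.val ∈ L) ∧
    IsNonneg wt g.val ∧ IsNonneg wt (g⁻¹).val}
  mul_mem' := by
    rintro g k ⟨h1, h2, h3, h4⟩ ⟨k1, k2, k3, k4⟩
    refine ⟨fun y hy => ?_, fun y hy => ?_, ?_, ?_⟩
    · simpa [mul_assoc] using h1 _ (k1 y hy)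
    · simpa [mul_assoc] using k2 _ (h2 y hy)
    · simpa using h3.mul k3
    · simpa using k4.mul h4
  one_mem' := by
    refine ⟨by simp, by simp, ?_, ?_⟩ <;> simpa using (isHom_one (wt := wt)).isNonneg le_rfl
  inv_mem' := by
    rintro g ⟨h1, h2, h3, h4⟩
    exact ⟨h2, by simpa using h1, h4, by simpa using h3⟩

/-- An invertible matrix normalising `L` and permuting the degrees through `σ`. -/
structure IsLift (wt : ι → Λ) (L : Submodule F (Matrix ι ι F)) {W : Type*} [Group W] (ρ : W →* Module.End ℤ Λ)
    (w : W) (g : (Matrix ι ι F)ˣ) : Prop where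
  mem : ∀ y ∈ L, g.val * y * (g⁻¹).val ∈ L
  inv_mem : ∀ y ∈ L, (g⁻¹).val * y * g.val ∈ L
  isHom : ∀ δ y, IsHom wt δ y → IsHom wt (ρ w δ) (g.val * y * (g⁻¹).val)
  inv_isHom : ∀ δ y, IsHom wt δ y → IsHom wt (ρ w⁻¹ δ) ((g⁻¹).val * y * g.val)

namespace IsLift

variable {wt : ι → Λ} {L : Submodule F (Matrix ι ι F)} {W : Type*} [Group W] {ρ : W →* Module.End ℤ Λ} {u w : W}
  {g k : (Matrix ι ι F)ˣ}

theorem inv (hg : IsLift wt L ρ w g) : IsLift wt L ρ w⁻¹ g⁻¹ :=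
  ⟨hg.inv_mem, by simpa using hg.mem, hg.inv_isHom, by simpa using hg.isHom⟩

theorem one : IsLift wt L ρ 1 1 := ⟨by simp, by simp, by simp, by simp⟩

theorem mul (hg : IsLift wt L ρ u g) (hk : IsLift wt L ρ w k) : IsLift wt L ρ (u * w) (g * k) := by
  refine ⟨fun y hy => ?_, fun y hy => ?_, fun δ y hy => ?_, fun δ y hy => ?_⟩
  · simpa [mul_assoc] using hg.mem _ (hk.mem y hy)
  · simpa [mul_assoc] using hk.inv_mem _ (hg.inv_mem y hy)
  · simpa [mul_assoc] using hg.isHom _ _ (hk.isHom δ y hy)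
  · simpa [mul_assoc] using hk.inv_isHom _ _ (hg.inv_isHom δ y hy)

theorem comp_conj (hg : IsLift wt L ρ w g) (δ : Λ) (y : Matrix ι ι F) :
    comp wt (ρ w δ) (g.val * y * (g⁻¹).val) = g.val * comp wt δ y * (g⁻¹).val := by
  induction y using Matrix.induction_on' with
  | h_zero => simp
  | h_add p q hp hq => simp only [mul_add, add_mul, map_add, hp, hq]
  | h_std_basis a b c =>
    have h := isHom_single (wt := wt) a b c
    by_cases hd : wt a - wt b = δ
    · subst hd
      rw [h.comp_eq, (hg.isHom _ _ h).comp_eq]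
    · rw [h.comp_eq_zero hd, (hg.isHom _ _ h).comp_eq_zero, mul_zero, zero_mul]
      intro h'
      apply hd
      have := congrArg (ρ w⁻¹) h'
      rwa [← Module.End.mul_apply, ← Module.End.mul_apply, ← map_mul, inv_mul_cancel, map_one] at this

theorem isNonneg_conj [LE Λ] (hg : IsLift wt L ρ w g) {y : Matrix ι ι F} (h : ∀ δ, comp wt δ y ≠ 0 → 0 ≤ ρ w δ) :
    IsNonneg wt (g.val * y * (g⁻¹).val) := by
  intro a b hab
  have h1 : ρ w (ρ w⁻¹ (wt a - wt b)) = wt a - wt b := by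
    rw [← Module.End.mul_apply, ← map_mul, mul_inv_cancel, map_one, Module.End.one_apply]
  rw [← h1]
  refine h _ fun h2 => hab ?_
  have h3 := hg.comp_conj (ρ w⁻¹ (wt a - wt b)) y
  rw [h2, mul_zero, zero_mul, h1] at h3
  have h4 := comp_apply_of_eq (wt := wt) (x := g.val * y * (g⁻¹).val) (a := a) (b := b) rfl
  rw [← h4, h3]
  rfl

end IsLift

variable {B : Type*} {wt : ι → B → ℤ} {L : Submodule F (Matrix ι ι F)} {W : Type*} [Group W]
  {ρ : W →* Module.End ℤ (B → ℤ)} {w : W}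

theorem nonpos_of_isHom_unit [Nonempty ι] {δ : B → ℤ} {g : (Matrix ι ι F)ˣ} (hg : IsHom wt δ g.val) :
    δ ≤ 0 := by
  intro j
  obtain ⟨b, hb⟩ := Finite.exists_max fun b => wt b j
  have : ∃ a, g.val a b ≠ 0 := by
    by_contra! h
    have h1 := congrFun (congrFun (Units.inv_mul g) b) b
    rw [Matrix.mul_apply, Finset.sum_eq_zero fun c _ => by rw [h c, mul_zero], Matrix.one_apply_eq] at h1
    exact zero_ne_one h1
  obtain ⟨a, ha⟩ := this
  have h1 := congrFun (hg a b ha) j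
  have h2 := hb a
  simp at h1 ⊢
  omega

theorem IsLift.isNonneg {g : (Matrix ι ι F)ˣ} (hg : IsLift wt L ρ 1 g) : IsNonneg wt g.val := by
  intro a c hac
  have : Nonempty ι := ⟨a⟩
  have h : IsHom wt (-(wt a - wt c)) (g⁻¹).val := by
    intro d b hdb
    have h1 := hg.isHom _ _ (isHom_single (wt := wt) c d (1 : F)) a b
    rw [Matrix.mul_apply, Finset.sum_eq_single d, Matrix.mul_apply, Finset.sum_eq_single c] at h1
    · have h2 := h1 (by rw [Matrix.single_apply_same, mul_one]; exact mul_ne_zero hac hdb)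
      rw [map_one, Module.End.one_apply] at h2
      rw [neg_sub, sub_eq_sub_iff_add_eq_add] at *
      rw [add_comm, ← h2, add_comm]
    · intro e _ he
      rw [Matrix.single_apply_of_row_ne he.symm, mul_zero]
    · simp
    · intro e _ he
      rw [Matrix.mul_apply, Finset.sum_eq_zero, zero_mul]
      intro e' _
      rw [Matrix.single_apply_of_col_ne _ _ he.symm, mul_zero]
    · simp
  simpa using nonpos_of_isHom_unit h

theorem IsLift.mem_parabolic {g : (Matrix ι ι F)ˣ} (hg : IsLift wt L ρ 1 g) : g ∈ parabolic wt L :=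
  ⟨hg.mem, hg.inv_mem, hg.isNonneg, (inv_one (G := W) ▸ hg.inv).isNonneg⟩

theorem isLift_redProd {M : CoxeterMatrix B} (cs : CoxeterSystem M W) {n : B → (Matrix ι ι F)ˣ}
    (hn : ∀ s, IsLift wt L ρ (cs.simple s) (n s)) (w : W) : IsLift wt L ρ w (cs.redProd n w) := by
  obtain ⟨ω, -, h, hp⟩ := cs.exists_redProd_eq w
  rw [hp, h]
  clear h hp
  induction ω with
  | nil => simpa using IsLift.one
  | cons s ω ih => simpa [cs.wordProd_cons] using (hn s).mul ih

end WtMatrix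

end

section

open Module

namespace WtMatrix

open CartanRep

section General

variable {ι B F : Type*} [Fintype ι] [DecidableEq ι] [Field F] {wt : ι → B → ℤ}

theorem eq_root_or_of_add_eq_root [DecidableEq B] {δ γ : B → ℤ} {s : B} (hδ : 0 ≤ δ) (hγ : 0 ≤ γ)
    (h : δ + γ = root s) : δ = 0 ∨ γ = 0 := by
  have h1 : ∀ j, j ≠ s → δ j = 0 ∧ γ j = 0 := fun j hj => by
    have h1 := congrFun h j
    have h2 := hδ j
    have h3 := hγ j
    simp [root, hj] at h1 h2 h3
    omega
  have h2 : δ s = 0 ∨ γ s = 0 := by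
    have h1 := congrFun h s
    have h2 := hδ s
    have h3 := hγ s
    simp [root] at h1 h2 h3
    omega
  refine h2.imp (fun h2 => ?_) fun h2 => ?_ <;> ext j <;> by_cases hj : j = s
  · rw [hj, h2]; rfl
  · exact (h1 j hj).1
  · rw [hj, h2]; rfl
  · exact (h1 j hj).2

theorem root_ne_zero [DecidableEq B] (s : B) : (root s : B → ℤ) ≠ 0 := by
  simp [root]

theorem root_nonneg [DecidableEq B] (s : B) : 0 ≤ (root s : B → ℤ) := by
  simp [root]

omit [DecidableEq ι] in
theorem comp_root_mul [DecidableEq B] {x y : Matrix ι ι F} (hx : IsNonneg wt x) (hy : IsNonneg wt y) (s : B) :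
    comp wt (root s) (x * y) = comp wt (root s) x * comp wt 0 y + comp wt 0 x * comp wt (root s) y := by
  refine comp_mul_of_forall (root_ne_zero s) fun a c b hab hca hcb => ?_
  by_contra h0
  rcases eq_root_or_of_add_eq_root (hx a c (left_ne_zero_of_mul h0)) (hy c b (right_ne_zero_of_mul h0))
    (by rw [sub_add_sub_cancel, hab]) with h | h
  · exact hca (sub_eq_zero.1 h).symm
  · exact hcb (sub_eq_zero.1 h)

theorem comp_zero_truncExp {δ : B → ℤ} {x : Matrix ι ι F} (hx : IsHom wt δ x) (h : δ ≠ 0) {m : ℕ} (hm : 1 ≤ m) :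
    comp wt 0 (truncExp F m x) = 1 := by
  rw [truncExp, map_sum, Finset.sum_eq_single_of_mem 0 (Finset.mem_range.2 hm)]
  · simpa using (isHom_one (wt := wt)).comp_eq
  · intro k _ hk
    exact ((hx.pow k).smul _).comp_eq_zero fun h' => h ((nsmul_eq_zero_iff_right hk).1 h')

theorem comp_zero_mul_inv {L : Submodule F (Matrix ι ι F)} {g : (Matrix ι ι F)ˣ} (hg : g ∈ parabolic wt L) :
    comp wt 0 g.val * comp wt 0 (g⁻¹).val = 1 := by
  rw [← hg.2.2.1.comp_zero_mul hg.2.2.2, Units.mul_inv, isHom_one.comp_eq]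

end General

section

variable {ι B W F : Type*} [Fintype ι] [DecidableEq ι] [Fintype B] [DecidableEq B] [Field F] [Group W]
  {M : CoxeterMatrix B} (cs : CoxeterSystem M W) {a : B → B → ℤ} (ha : IsCartanOf M a)

/-- The reduction of weights to the field `F` is faithful enough to detect the Weyl group action. -/
structure IsFaithfulWt (F : Type*) [Field F] (a : B → B → ℤ) (wt : ι → B → ℤ) : Prop where
  zero : ∀ b c, (∀ j, ((wt b - wt c) j : F) = 0) → wt b - wt c = 0
  refl : ∀ s b c b' c', (∀ j, ((preReflection (root s) (coroot a s) (wt b - wt c)) j : F) = ((wt b' - wt c') j : F)) →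
    preReflection (root s) (coroot a s) (wt b - wt c) = wt b' - wt c'

namespace IsChevalleyRep

variable {wt : ι → B → ℤ} {e f : B → Matrix ι ι F} (h : IsChevalleyRep a wt e f) {m n : ℕ}
  (hb : ExpBound F m n) (he : ∀ s, e s ^ n = 0) (hf : ∀ s, f s ^ n = 0) (hw : IsFaithfulWt F a wt)

include h

theorem e_commutator_f (s : B) : e s * f s - f s * e s = corootDiag F a wt s := by
  rw [h.comm, if_pos rfl]

include ha

theorem corootDiag_commutator_e (s : B) :
    corootDiag F a wt s * e s - e s * corootDiag F a wt s = (2 : F) • e s := by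
  rw [(h.hom_e s).corootDiag_commutator, coroot_root, ha.diag]
  simp

theorem corootDiag_commutator_f (s : B) :
    corootDiag F a wt s * f s - f s * corootDiag F a wt s = -(2 : F) • f s := by
  rw [(h.hom_f s).corootDiag_commutator, map_neg, coroot_root, ha.diag]
  simp

theorem weylUnit_isHom (hw : IsFaithfulWt F a wt) (s : B) {t : F} (ht : t ≠ 0) {δ : B → ℤ} {y : Matrix ι ι F} (hy : IsHom wt δ y) :
    IsHom wt (rep ha cs (cs.simple s) δ)
      ((hb.weylUnit (he s) (hf s) t).val * y * (hb.weylUnit (he s) (hf s) t)⁻¹.val) := by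
  intro b c hbc
  set w := hb.weylUnit (he s) (hf s) t with hwdef
  have hy0 : ∃ b' c', y b' c' ≠ 0 := by
    by_contra! h0
    rw [show y = 0 from Matrix.ext h0] at hbc
    simp at hbc
  obtain ⟨b', c', h'⟩ := hy0
  have hδ := hy b' c' h'
  have key : preReflection (root s) (coroot a s) (wt b - wt c) = wt b' - wt c' := by
    refine hw.refl s b c b' c' fun j => ?_
    have h1 := hb.conj_weylUnit_of_commutator (he s) (hf s) (h.e_commutator_f s) (h.corootDiag_commutator_e ha s)
      (h.corootDiag_commutator_f ha s) ht ((h.hom_e s).wtDiag_commutator j)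
      (by simpa using (h.hom_f s).wtDiag_commutator j)
    rw [← hwdef] at h1
    have h2 : (w.val * wtDiag F wt j * (w⁻¹).val) * (w.val * y * (w⁻¹).val) -
        (w.val * y * (w⁻¹).val) * (w.val * wtDiag F wt j * (w⁻¹).val) = (δ j : F) • (w.val * y * (w⁻¹).val) := by
      rw [← ExpBound.conj_smul, ← hy.wtDiag_commutator j]
      simp only [mul_sub, sub_mul, mul_assoc, Units.inv_mul_cancel_left]
    rw [h1] at h2
    have h3 := congrFun (congrFun h2 b) c
    rw [hδ, preReflection_apply]
    rw [Matrix.smul_apply, smul_eq_mul] at h3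
    refine mul_right_cancel₀ hbc (Eq.trans ?_ h3)
    simp only [Matrix.sub_apply, sub_mul, mul_sub, smul_mul_assoc, mul_smul_comm, Matrix.smul_apply, wtDiag,
      corootDiag, Matrix.diagonal_mul, Matrix.mul_diagonal, smul_eq_mul, Pi.sub_apply, Pi.smul_apply, map_sub]
    push_cast
    ring
  rw [rep_simple, ← hδ, ← key]
  exact (involutive_preReflection (by rw [coroot_root, ha.diag]) _).symm

theorem weylUnit_isLift (hw : IsFaithfulWt F a wt) (s : B) {t : F} (ht : t ≠ 0) : IsLift wt (lieSpan wt e f) (rep ha cs) (cs.simple s)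
    (hb.weylUnit (he s) (hf s) t) := by
  refine ⟨fun y => hb.conj_weylUnit_mem _ _ t (fun y => h.commutator_e_mem s) (fun y => h.commutator_f_mem s),
    fun y hy => ?_, fun δ y => h.weylUnit_isHom cs ha hb he hf hw s ht, fun δ y hy => ?_⟩
  · have := hb.conj_weylUnit_mem (he s) (hf s) (-t) (fun y => h.commutator_e_mem s) (fun y => h.commutator_f_mem s) hy
    rwa [ExpBound.weylUnit_neg, inv_inv] at this
  · have := h.weylUnit_isHom cs ha hb he hf hw s (neg_ne_zero.2 ht) hy
    rwa [ExpBound.weylUnit_neg, inv_inv, ← cs.inv_simple] at this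

end IsChevalleyRep

end

end WtMatrix

end

section

open Module

namespace WtMatrix

open CartanRep

variable {ι B W F : Type*} [Fintype ι] [DecidableEq ι] [Fintype B] [DecidableEq B] [Field F] [Group W]
  {M : CoxeterMatrix B} (cs : CoxeterSystem M W) {a : B → B → ℤ} (ha : IsCartanOf M a)

namespace IsChevalleyRep

variable {wt : ι → B → ℤ} {e f : B → Matrix ι ι F} (h : IsChevalleyRep a wt e f) {m n : ℕ}
  (hb : ExpBound F m n) (he : ∀ s, e s ^ n = 0) (hf : ∀ s, f s ^ n = 0) (hw : IsFaithfulWt F a wt)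

include h

theorem oneParam_mem (s : B) (t : F) : hb.oneParam (he s) t ∈ parabolic wt (lieSpan wt e f) := by
  have h1 : ∀ t, IsNonneg wt (hb.oneParam (he s) t).val := fun t => by
    rw [hb.coe_oneParam]
    exact isNonneg_truncExp ((h.hom_e s).smul t) (root_nonneg s) m
  refine ⟨fun y hy => hb.conj_oneParam_mem _ t (fun y => h.commutator_e_mem s) hy, fun y hy => ?_, h1 t, ?_⟩
  · have := hb.conj_oneParam_mem (he s) (-t) (fun y => h.commutator_e_mem s) hy
    rwa [ExpBound.oneParam_neg, inv_inv] at this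
  · rw [← ExpBound.oneParam_neg]
    exact h1 _

theorem comp_oneParam (s : B) (t : F) : comp wt (root s) (hb.oneParam (he s) t).val = t • e s := by
  rw [hb.coe_oneParam, comp_truncExp ((h.hom_e s).smul t) (root_ne_zero s) (by have := hb.three; omega)]

theorem comp_zero_oneParam (s : B) (t : F) : comp wt 0 (hb.oneParam (he s) t).val = 1 := by
  rw [hb.coe_oneParam, comp_zero_truncExp ((h.hom_e s).smul t) (root_ne_zero s) (by have := hb.three; omega)]

omit [Fintype B] [DecidableEq B] h in
theorem conj_wtDiag_comp_zero {g : (Matrix ι ι F)ˣ} (hg : g ∈ parabolic wt (lieSpan wt e f)) (j : B) :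
    comp wt 0 (g.val * wtDiag F wt j * (g⁻¹).val) = wtDiag F wt j := by
  have hD : IsHom wt 0 (wtDiag F wt j) := isHom_diagonal _
  have h1 := (isHom_comp (wt := wt) (δ := 0) (x := g.val)).wtDiag_commutator j
  rw [Pi.zero_apply, Int.cast_zero, zero_smul, sub_eq_zero] at h1
  rw [mul_assoc, hg.2.2.1.comp_zero_mul ((hD.isNonneg le_rfl).mul hg.2.2.2),
    (hD.isNonneg le_rfl).comp_zero_mul hg.2.2.2, hD.comp_eq, ← mul_assoc, ← h1, mul_assoc, comp_zero_mul_inv hg,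
    mul_one]

omit [Fintype B] [DecidableEq B] h in
theorem isNonneg_conj_wtDiag {g : (Matrix ι ι F)ˣ} (hg : g ∈ parabolic wt (lieSpan wt e f)) (j : B) :
    IsNonneg wt (g.val * wtDiag F wt j * (g⁻¹).val) :=
  (hg.2.2.1.mul ((isHom_diagonal _).isNonneg le_rfl)).mul hg.2.2.2

theorem exists_comp_root {g : (Matrix ι ι F)ˣ} (hg : g ∈ parabolic wt (lieSpan wt e f)) (s : B) :
    ∃ c : F, comp wt (root s) g.val = c • (e s * comp wt 0 g.val) := by
  have hD : IsHom wt 0 (wtDiag F wt s) := isHom_diagonal _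
  obtain ⟨c, hc⟩ := h.comp_root (hg.1 _ (wtDiag_mem s)) s
  have h1 : (g.val * wtDiag F wt s * (g⁻¹).val) * g.val = g.val * wtDiag F wt s := by
    rw [mul_assoc, Units.inv_mul, mul_one]
  have h2 := congrArg (comp wt (root s)) h1
  rw [comp_root_mul (isNonneg_conj_wtDiag hg s) hg.2.2.1, comp_mul_of_isHom_zero hD, conj_wtDiag_comp_zero hg,
    hc] at h2
  have h3 := (isHom_comp (wt := wt) (δ := root s) (x := g.val)).wtDiag_commutator s
  have h4 : ((root s : B → ℤ) s : F) = 1 := by simp [root]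
  rw [h4, one_smul] at h3
  refine ⟨-c, ?_⟩
  rw [← h3, neg_smul, ← smul_mul_assoc, eq_neg_iff_add_eq_zero, ← sub_eq_zero.2 h2]
  abel

omit [Fintype B] h in
theorem comp_root_inv {g : (Matrix ι ι F)ˣ} (hg : g ∈ parabolic wt (lieSpan wt e f)) {s : B}
    (h0 : comp wt (root s) g.val = 0) : comp wt (root s) (g⁻¹).val = 0 := by
  have h1 := comp_root_mul hg.2.2.1 hg.2.2.2 s
  rw [Units.mul_inv, isHom_one.comp_eq_zero (root_ne_zero s).symm, h0, zero_mul, zero_add] at h1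
  have h2 := comp_zero_mul_inv (inv_mem hg)
  rw [inv_inv] at h2
  rw [← one_mul (comp _ _ _), ← h2, mul_assoc, ← h1, mul_zero]

variable {cs}
include ha hw

theorem comp_eq_zero_of_bad {g : (Matrix ι ι F)ˣ} (hg : g ∈ parabolic wt (lieSpan wt e f)) {s : B}
    (h0 : comp wt (root s) g.val = 0) {w : (Matrix ι ι F)ˣ}
    (hlift : IsLift wt (lieSpan wt e f) (rep ha cs) (cs.simple s) w) {δ : B → ℤ} (hδ : 0 ≤ δ)
    (hs : (rep ha cs (cs.simple s) δ) s < 0) :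
    comp wt δ g.val = 0 ∧ ∀ j, comp wt δ (g.val * wtDiag F wt j * (g⁻¹).val) = 0 := by
  induction hN : (∑ j, δ j).toNat using Nat.strong_induction_on generalizing δ with
  | _ N ih =>
  have hlt : ∀ γ γ' : B → ℤ, 0 ≤ γ → 0 ≤ γ' → γ' ≠ 0 → γ + γ' = δ → (∑ j, γ j).toNat < N := by
    intro γ γ' h1 h2 h3 h4
    have h5 : 0 < ∑ j, γ' j := by
      obtain ⟨j, hj⟩ := Function.ne_iff.1 h3
      exact Finset.sum_pos' (fun j _ => h2 j) ⟨j, Finset.mem_univ j, lt_of_le_of_ne (h2 j) hj.symm⟩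
    have h6 : ∑ j, δ j = ∑ j, γ j + ∑ j, γ' j := by rw [← h4, ← Finset.sum_add_distrib]; rfl
    have h7 : 0 ≤ ∑ j, γ j := Finset.sum_nonneg fun j _ => h1 j
    omega
  have hδ0 : δ ≠ 0 := by rintro rfl; simp at hs
  have main : ∀ j, comp wt δ (g.val * wtDiag F wt j * (g⁻¹).val) * comp wt 0 g.val = -(δ j : F) • comp wt δ g.val := by
    intro j
    have hD : IsHom wt 0 (wtDiag F wt j) := isHom_diagonal _
    have h1 : (g.val * wtDiag F wt j * (g⁻¹).val) * g.val = g.val * wtDiag F wt j := by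
      rw [mul_assoc, Units.inv_mul, mul_one]
    have h2 := congrArg (comp wt δ) h1
    rw [comp_mul_of_forall hδ0, comp_mul_of_isHom_zero hD, conj_wtDiag_comp_zero hg] at h2
    · have h3 := (isHom_comp (wt := wt) (δ := δ) (x := g.val)).wtDiag_commutator j
      rw [neg_smul, ← h3, ← sub_eq_zero, ← sub_eq_zero.2 h2]
      abel
    · intro b c d hbd hcb hcd
      by_contra hne
      have n1 := isNonneg_conj_wtDiag hg j b c (left_ne_zero_of_mul hne)
      have n2 := hg.2.2.1 c d (right_ne_zero_of_mul hne)
      have hsum : (wt b - wt c) + (wt c - wt d) = δ := by rw [sub_add_sub_cancel, hbd]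
      have z1 : wt b - wt c ≠ 0 := fun h' => hcb (sub_eq_zero.1 h').symm
      have z2 : wt c - wt d ≠ 0 := fun h' => hcd (sub_eq_zero.1 h')
      have h3 : (rep ha cs (cs.simple s) (wt b - wt c)) s + (rep ha cs (cs.simple s) (wt c - wt d)) s < 0 := by
        rw [← Pi.add_apply, ← map_add, hsum]; exact hs
      rcases lt_or_ge ((rep ha cs (cs.simple s) (wt b - wt c)) s) 0 with h4 | h4
      · have := (ih _ (hlt _ _ n1 n2 z2 hsum) n1 h4 rfl).2 j
        rw [← comp_apply_of_eq (wt := wt) (x := g.val * wtDiag F wt j * (g⁻¹).val) (a := b) (b := c) rfl, this] at hne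
        simp at hne
      · have := (ih _ (hlt _ _ n2 n1 z1 (by rw [add_comm, hsum])) n2 (by omega) rfl).1
        rw [← comp_apply_of_eq (wt := wt) (x := g.val) (a := c) (b := d) rfl, this] at hne
        simp at hne
  have hcomm : ∀ j, comp wt δ (g.val * wtDiag F wt j * (g⁻¹).val) = 0 := by
    intro j
    by_contra hne
    have hy := hg.1 _ (wtDiag_mem (F := F) (wt := wt) (e := e) (f := f) j)
    have h1 := hlift.mem _ (h.comp_mem hy δ)
    have h2 : comp wt (rep ha cs (cs.simple s) δ) (w.val * comp wt δ (g.val * wtDiag F wt j * (g⁻¹).val) * (w⁻¹).val) ≠ 0 := by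
      rw [hlift.comp_conj, isHom_comp.comp_eq]
      intro h3
      refine hne ?_
      have h4 := congrArg (fun z => (w⁻¹).val * z * w.val) h3
      simpa [mul_assoc] using h4
    rcases h.nonneg_or_nonpos h1 h2 with h3 | h3
    · exact absurd (h3 s) (not_le.2 hs)
    · have h4 : δ = δ s • root s := by
        ext j
        by_cases hj : j = s
        · subst hj; simp [root]
        · have h4 := h3 j
          have h5 := hδ j
          rw [rep_simple, preReflection_apply] at h4
          simp [root, hj] at h4 h5 ⊢
          omega
      have h5 := hδ s
      have h6 : δ s ≠ 0 := fun h' => hδ0 (by rw [h4, h', zero_smul])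
      rcases eq_or_ne (δ s) 1 with h7 | h7
      · rw [h7, one_smul] at h4
        have h8 := main j
        rw [h4, h0, smul_zero] at h8
        refine hne ?_
        rw [h4, ← mul_one (comp _ _ _), ← comp_zero_mul_inv hg, ← mul_assoc, h8, zero_mul]
      · refine hne ?_
        rw [h4]
        exact h.comp_smul_root hy s (by simp at h5; omega)
  refine ⟨?_, hcomm⟩
  by_contra hne
  obtain ⟨b, c, hbc⟩ : ∃ b c, comp wt δ g.val b c ≠ 0 := by
    by_contra! h'
    exact hne (Matrix.ext h')
  have hd := isHom_comp b c hbc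
  refine hδ0 (hd ▸ hw.zero b c fun j => ?_)
  have h1 := congrFun (congrFun (main j) b) c
  rw [hcomm j, zero_mul, Matrix.smul_apply, smul_eq_mul, Matrix.zero_apply] at h1
  rw [hd]
  simpa [hbc] using h1.symm

theorem conj_mem {g : (Matrix ι ι F)ˣ} (hg : g ∈ parabolic wt (lieSpan wt e f)) {s : B}
    (h0 : comp wt (root s) g.val = 0) {w : (Matrix ι ι F)ˣ}
    (hlift : IsLift wt (lieSpan wt e f) (rep ha cs) (cs.simple s) w) :
    w * g * w⁻¹ ∈ parabolic wt (lieSpan wt e f) := by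
  have key : ∀ g ∈ parabolic wt (lieSpan wt e f), comp wt (root s) g.val = 0 →
      IsNonneg wt (w.val * g.val * (w⁻¹).val) := by
    intro g hg h0
    refine hlift.isNonneg_conj fun δ hδ => ?_
    have hδ0 : 0 ≤ δ := by
      obtain ⟨b, c, hbc⟩ : ∃ b c, comp wt δ g.val b c ≠ 0 := by
        by_contra! h'
        exact hδ (Matrix.ext h')
      have hd := isHom_comp b c hbc
      rw [comp_apply_of_eq hd] at hbc
      rw [← hd]
      exact hg.2.2.1 b c hbc
    intro j
    by_cases hj : j = s
    · subst hj
      by_contra hlt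
      exact hδ (h.comp_eq_zero_of_bad ha hw hg h0 hlift hδ0 (not_le.1 hlt)).1
    · have := hδ0 j
      rw [rep_simple, preReflection_apply]
      simpa [root, hj] using this
  refine ⟨fun y hy => ?_, fun y hy => ?_, by simpa using key g hg h0, ?_⟩
  · simpa [mul_assoc] using hlift.mem _ (hg.1 _ (hlift.inv_mem y hy))
  · simpa [mul_assoc] using hlift.mem _ (hg.2.1 _ (hlift.inv_mem y hy))
  · simpa [mul_assoc] using key g⁻¹ (inv_mem hg) (comp_root_inv hg h0)

omit h hw in
theorem comp_root_of_conj_mem {g : (Matrix ι ι F)ˣ} {s : B} {w : (Matrix ι ι F)ˣ}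
    (hlift : IsLift wt (lieSpan wt e f) (rep ha cs) (cs.simple s) w)
    (hg : w * g * w⁻¹ ∈ parabolic wt (lieSpan wt e f)) : comp wt (root s) g.val = 0 := by
  by_contra hne
  have h1 : comp wt (rep ha cs (cs.simple s) (root s)) (w.val * g.val * (w⁻¹).val) ≠ 0 := by
    rw [hlift.comp_conj]
    intro h3
    refine hne ?_
    have h4 := congrArg (fun z => (w⁻¹).val * z * w.val) h3
    simpa [mul_assoc] using h4
  obtain ⟨b, c, hbc⟩ : ∃ b c, comp wt (rep ha cs (cs.simple s) (root s)) (w.val * g.val * (w⁻¹).val) b c ≠ 0 := by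
    by_contra! h'
    exact h1 (Matrix.ext h')
  have hd := isHom_comp b c hbc
  rw [comp_apply_of_eq hd] at hbc
  have h2 := hg.2.2.1 b c (by simpa using hbc) s
  rw [hd, rep_simple_root_self] at h2
  simp [root] at h2

theorem existsUnique_conj_mem {g : (Matrix ι ι F)ˣ} (hg : g ∈ parabolic wt (lieSpan wt e f)) {s : B}
    {w : (Matrix ι ι F)ˣ} (hlift : IsLift wt (lieSpan wt e f) (rep ha cs) (cs.simple s) w) :
    ∃! t, w * (hb.oneParam (he s) t)⁻¹ * g * w⁻¹ ∈ parabolic wt (lieSpan wt e f) := by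
  obtain ⟨c, hc⟩ := h.exists_comp_root hg s
  have h1 : ∀ t, comp wt (root s) ((hb.oneParam (he s) t)⁻¹ * g).val = (c - t) • (e s * comp wt 0 g.val) := by
    intro t
    rw [← ExpBound.oneParam_neg, Units.val_mul, comp_root_mul (h.oneParam_mem hb he s _).2.2.1 hg.2.2.1,
      h.comp_oneParam, h.comp_zero_oneParam, hc, one_mul, smul_mul_assoc, ← add_smul]
    congr 1
    ring
  refine ⟨c, ?_, fun t ht => ?_⟩
  · beta_reduce
    rw [mul_assoc w]
    refine h.conj_mem ha hw (mul_mem (inv_mem (h.oneParam_mem hb he s c)) hg) ?_ hlift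
    rw [h1, sub_self, zero_smul]
  · beta_reduce at ht
    rw [mul_assoc w] at ht
    have h2 := comp_root_of_conj_mem ha hlift ht
    rw [h1, smul_eq_zero] at h2
    rcases h2 with h2 | h2
    · exact (sub_eq_zero.1 h2).symm
    · refine absurd ?_ (h.e_ne_zero s)
      rw [← mul_one (e s), ← comp_zero_mul_inv hg, ← mul_assoc, h2, zero_mul]

variable (cs) [Finite F] [Fintype W] [DecidableEq W]
include hb he hf

theorem hasBuilding : cs.HasBuilding (Nat.card F) := by
  have hlift : ∀ s t, t ≠ 0 → IsLift wt (lieSpan wt e f) (rep ha cs) (cs.simple s) (hb.weylUnit (he s) (hf s) t) :=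
    fun s t => h.weylUnit_isLift cs ha hb he hf hw s
  set n : B → (Matrix ι ι F)ˣ := fun s => hb.weylUnit (he s) (hf s) 1 with hn
  have hs : ∀ s, IsLift wt (lieSpan wt e f) (rep ha cs) (cs.simple s) (n s) := fun s => hlift s 1 one_ne_zero
  have hν := isLift_redProd cs hs
  have hleft : ∀ s, ∀ b ∈ parabolic wt (lieSpan wt e f), ∃ t, ∃ k ∈ parabolic wt (lieSpan wt e f),
      n s * b = k * n s * hb.oneParam (he s) t := by
    intro s b hbP
    obtain ⟨t, ht, -⟩ := h.existsUnique_conj_mem ha hb he hw (inv_mem hbP) (hs s)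
    refine ⟨-t, _, inv_mem ht, ?_⟩
    rw [ExpBound.oneParam_neg]
    group
  refine CoxeterSystem.hasBuilding_of_subgroup (P := parabolic wt (lieSpan wt e f)) (n := n)
    (x := fun s t => hb.oneParam (he s) t) (IsLift.mem_parabolic (hν 1)) (fun s w => ?_) (fun s w hd b hbP => ?_)
    (fun s b hbP => ?_) (fun w hw1 hmem => ?_) (fun s t => h.oneParam_mem hb he s t)
    (fun s b hbP => h.existsUnique_conj_mem ha hb he hw hbP (hs s)) ha
  · apply IsLift.mem_parabolic (ρ := rep ha cs)
    have := ((hν (cs.simple s * w)).inv.mul (hs s)).mul (hν w)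
    rwa [mul_assoc, inv_mul_cancel] at this
  · obtain ⟨t, k, hk, hkt⟩ := hleft s b hbP
    refine ⟨k, hk, (cs.redProd n w)⁻¹ * hb.oneParam (he s) t * cs.redProd n w, ?_, by rw [hkt]; group⟩
    have hm := h.oneParam_mem hb he s t
    have key : ∀ t, IsNonneg wt (((cs.redProd n w)⁻¹).val * (hb.oneParam (he s) t).val * (cs.redProd n w).val) := by
      intro t
      have h1 := conj_truncExp (F := F) (cs.redProd n w)⁻¹ m (t • e s)
      rw [inv_inv] at h1
      rw [hb.coe_oneParam, h1]
      refine isNonneg_truncExp ((hν w).inv_isHom _ _ ((h.hom_e s).smul t)) (rep_root_nonneg ha cs ?_) m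
      rwa [cs.isRightDescent_inv_iff]
    refine ⟨fun y hy => ?_, fun y hy => ?_, by simpa using key t, ?_⟩
    · simpa [mul_assoc] using (hν w).inv_mem _ (hm.1 _ ((hν w).mem y hy))
    · simpa [mul_assoc] using (hν w).inv_mem _ (hm.2.1 _ ((hν w).mem y hy))
    · simpa [mul_assoc, ExpBound.oneParam_neg] using key (-t)
  · obtain ⟨t, k, hk, hkt⟩ := hleft s b hbP
    have hnn : n s * n s ∈ parabolic wt (lieSpan wt e f) := by
      have := (hs s).mul (hs s)
      rw [cs.simple_mul_simple_self] at this
      exact this.mem_parabolic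
    rcases eq_or_ne t 0 with rfl | ht
    · left
      rw [hkt, ExpBound.oneParam_zero, mul_one, mul_assoc]
      exact mul_mem hk hnn
    · right
      have hp : (n s)⁻¹ * hb.weylUnit (he s) (hf s) t⁻¹ ∈ parabolic wt (lieSpan wt e f) := by
        apply IsLift.mem_parabolic (ρ := rep ha cs)
        have := (hs s).inv.mul (hlift s t⁻¹ (inv_ne_zero ht))
        rwa [inv_mul_cancel] at this
      have hconj : n s * hb.oneParam (he s) t * (n s)⁻¹ = hb.oneParam (hf s) (-t) := by
        ext1
        have h1 := conj_truncExp (F := F) (n s) m (t • e s)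
        have h2 := hb.conj_weylUnit_e (he s) (hf s) (h.e_commutator_f s) (h.corootDiag_commutator_e ha s)
          (h.corootDiag_commutator_f ha s) one_ne_zero
        rw [Units.val_mul, Units.val_mul, hb.coe_oneParam, hb.coe_oneParam, h1, ExpBound.conj_smul, hn, h2]
        simp
      have hw' : hb.oneParam (hf s) (-t) = hb.oneParam (he s) (-t⁻¹) * hb.weylUnit (he s) (hf s) t⁻¹ *
          hb.oneParam (he s) (-t⁻¹) := by
        rw [ExpBound.weylUnit, inv_inv, hb.oneParam_neg (F := F) (he s)]
        group
      refine ⟨k * hb.oneParam (he s) (-t⁻¹), mul_mem hk (h.oneParam_mem hb he s _),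
        ((n s)⁻¹ * hb.weylUnit (he s) (hf s) t⁻¹) * hb.oneParam (he s) (-t⁻¹) * (n s * n s),
        mul_mem (mul_mem hp (h.oneParam_mem hb he s _)) hnn, ?_⟩
      have h3 : hb.oneParam (he s) (-t⁻¹) * hb.weylUnit (he s) (hf s) t⁻¹ * hb.oneParam (he s) (-t⁻¹) * n s =
        n s * hb.oneParam (he s) t := by rw [← hw', ← hconj]; group
      rw [hkt, mul_assoc k, ← h3]
      group
  · obtain ⟨s, hs1⟩ := cs.exists_rightDescent_of_ne_one hw1
    have h1 := rep_root_nonpos ha cs hs1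
    have h2 := (hν w).isHom _ _ (h.hom_e s)
    have h3 : IsNonneg wt ((cs.redProd n w).val * e s * ((cs.redProd n w)⁻¹).val) :=
      (hmem.2.2.1.mul ((h.hom_e s).isNonneg (root_nonneg s))).mul hmem.2.2.2
    have h4 : (cs.redProd n w).val * e s * ((cs.redProd n w)⁻¹).val ≠ 0 := by
      intro h3
      refine h.e_ne_zero s ?_
      have h4 := congrArg (fun z => ((cs.redProd n w)⁻¹).val * z * (cs.redProd n w).val) h3
      simpa [mul_assoc] using h4
    obtain ⟨b, c, hbc⟩ : ∃ b c, ((cs.redProd n w).val * e s * ((cs.redProd n w)⁻¹).val) b c ≠ 0 := by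
      by_contra! h'
      exact h4 (Matrix.ext h')
    have h5 := h3 b c hbc
    rw [h2 b c hbc] at h5
    exact rep_root_ne_zero ha cs w s (le_antisymm h1 h5)

end IsChevalleyRep

end WtMatrix

end

section

open Module

section Ring

variable {A : Type*} [Ring A] {e f h g : A} {c : ℤ}

theorem commutator_iterate_of_weight (hhf : h * f - f * h = (-2 : ℤ) • f) (hhg : h * g - g * h = c • g) (n : ℕ) :
    h * (fun x => f * x - x * f)^[n] g - (fun x => f * x - x * f)^[n] g * h =
      (c - 2 * n) • (fun x => f * x - x * f)^[n] g := by
  induction n with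
  | zero => simpa using hhg
  | succ n ih =>
    rw [Function.iterate_succ_apply']
    set x := (fun x => f * x - x * f)^[n] g
    have e1 : h * (f * x - x * f) - (f * x - x * f) * h =
        ((h * f - f * h) * x - x * (h * f - f * h)) + (f * (h * x - x * h) - (h * x - x * h) * f) := by
      noncomm_ring
    rw [e1, hhf, ih]
    simp only [smul_mul_assoc, mul_smul_comm, ← smul_sub, ← add_smul]
    congr 1
    push_cast
    ring

theorem commutator_iterate_succ (hef : e * f - f * e = h) (heg : e * g - g * e = 0)
    (hhf : h * f - f * h = (-2 : ℤ) • f) (hhg : h * g - g * h = c • g) (n : ℕ) :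
    e * (fun x => f * x - x * f)^[n + 1] g - (fun x => f * x - x * f)^[n + 1] g * e =
      ((n + 1) * (c - n)) • (fun x => f * x - x * f)^[n] g := by
  have step : ∀ x, e * (f * x - x * f) - (f * x - x * f) * e =
      (h * x - x * h) + (f * (e * x - x * e) - (e * x - x * e) * f) := by
    intro x
    rw [← hef]
    noncomm_ring
  induction n with
  | zero => simpa [step, heg] using hhg
  | succ n ih =>
    rw [Function.iterate_succ_apply', step, ih, commutator_iterate_of_weight hhf hhg, mul_smul_comm, smul_mul_assoc,
      ← smul_sub, ← Function.iterate_succ_apply' (fun x => f * x - x * f), ← add_smul]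
    congr 1
    push_cast
    ring

end Ring

section SlTwo

variable {V : Type*} [AddCommGroup V] [Module ℚ V] {e f h : End ℚ V}

theorem pow_apply_of_weight (hhf : h * f - f * h = (-2 : ℤ) • f) {v : V} {m : ℤ} (hv : h v = m • v) (k : ℕ) :
    h ((f ^ k) v) = (m - 2 * k) • (f ^ k) v := by
  induction k with
  | zero => simpa using hv
  | succ k ih =>
    have h1 := LinearMap.congr_fun hhf ((f ^ k) v)
    simp only [LinearMap.sub_apply, Module.End.mul_apply, LinearMap.smul_apply, ih, map_zsmul] at h1
    rw [pow_succ', Module.End.mul_apply, sub_eq_iff_eq_add.1 h1, ← add_smul]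
    congr 1
    push_cast
    ring

theorem apply_pow_succ_of_weight (hef : e * f - f * e = h) (hhf : h * f - f * h = (-2 : ℤ) • f) {v : V} {m : ℤ}
    (hv : h v = m • v) (k : ℕ) :
    e ((f ^ (k + 1)) v) = (f ^ (k + 1)) (e v) + ((k + 1) * (m - k)) • (f ^ k) v := by
  have h1 : ∀ w, e (f w) = h w + f (e w) := fun w => by
    rw [← hef]; simp
  induction k with
  | zero => simp [h1, hv, add_comm]
  | succ k ih =>
    have h2 : ∀ (j : ℕ) (w : V), f ((f ^ j) w) = (f ^ (j + 1)) w := fun j w => by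
      rw [pow_succ', Module.End.mul_apply]
    rw [← h2, h1, pow_apply_of_weight hhf hv, ih, map_add, map_zsmul, h2, h2, add_left_comm, ← add_smul]
    congr 2
    push_cast
    ring

theorem pow_apply_ne_zero_of_weight (hef : e * f - f * e = h) (hhe : h * e - e * h = (2 : ℤ) • e)
    (hhf : h * f - f * h = (-2 : ℤ) • f) {p : ℕ} {v : V} {m : ℕ} (hv : h v = (m : ℤ) • v) (hp : (e ^ p) v = 0)
    (h0 : v ≠ 0) : (f ^ m) v ≠ 0 := by
  induction p generalizing v m with
  | zero => exact absurd (by simpa using hp) h0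
  | succ p ih =>
    by_cases hev : e v = 0
    · suffices ∀ k ≤ m, (f ^ k) v ≠ 0 from this m le_rfl
      intro k hk
      induction k with
      | zero => simpa using h0
      | succ k ihk =>
        intro h1
        have h2 := apply_pow_succ_of_weight hef hhf hv k
        rw [h1, hev, map_zero, map_zero, zero_add, eq_comm, ← Int.cast_smul_eq_zsmul ℚ, smul_eq_zero] at h2
        rcases h2 with h2 | h2
        · have h3 := Int.cast_eq_zero.1 h2
          rcases mul_eq_zero.1 h3 with h3 | h3 <;> omega
        · exact ihk (by omega) h2
    · intro h1
      have hew : h (e v) = ((m + 2 : ℕ) : ℤ) • e v := by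
        have h2 := LinearMap.congr_fun hhe v
        simp only [LinearMap.sub_apply, Module.End.mul_apply, LinearMap.smul_apply, hv, map_zsmul] at h2
        rw [sub_eq_iff_eq_add.1 h2, ← add_smul]
        congr 1
        push_cast
        ring
      refine ih hew (by rw [← Module.End.mul_apply, ← pow_succ, hp]) hev ?_
      have h2 := apply_pow_succ_of_weight hef hhf hv (m + 1)
      have h3 : ∀ k, (f ^ (m + k)) v = 0 := fun k => by
        rw [add_comm, pow_add, Module.End.mul_apply, h1, map_zero]
      rw [show m + 1 + 1 = m + 2 from rfl, h3, h3, map_zero, smul_zero, add_zero] at h2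
      exact h2.symm

end SlTwo

section LocallyNilpotent

variable {R V : Type*} [CommRing R] [AddCommGroup V] [Module R V] {f g : End R V}

theorem exists_pow_apply_eq_zero_of_commutator {N : ℕ} (hN : (fun x => f * x - x * f)^[N] g = 0) {p : ℕ} {v : V}
    (hv : (f ^ p) v = 0) : ∃ q, (f ^ q) (g v) = 0 := by
  have key : ∀ (d l : ℕ), l + d = N → ∀ (p : ℕ) (v : V), (f ^ p) v = 0 →
      ∃ q, (f ^ q) ((fun x => f * x - x * f)^[l] g v) = 0 := by
    intro d
    induction d with
    | zero =>
      rintro l rfl p v -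
      exact ⟨0, by rw [add_zero] at hN; rw [hN]; simp⟩
    | succ d ih =>
      intro l hl p
      induction p with
      | zero =>
        intro v hv
        rw [pow_zero, Module.End.one_apply] at hv
        exact ⟨0, by rw [hv]; simp⟩
      | succ p ihp =>
        intro v hv
        obtain ⟨q, hq⟩ := ihp (f v) (by rw [← Module.End.mul_apply, ← pow_succ, hv])
        obtain ⟨q', hq'⟩ := ih (l + 1) (by omega) (p + 1) v hv
        rw [Function.iterate_succ_apply', LinearMap.sub_apply, Module.End.mul_apply, Module.End.mul_apply] at hq'
        have h1 : ∀ k, (f ^ (k + q)) ((fun x => f * x - x * f)^[l] g (f v)) = 0 := fun k => by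
          rw [pow_add, Module.End.mul_apply, hq, map_zero]
        have h2 := congrArg (f ^ q) hq'
        rw [← Module.End.mul_apply, ← pow_add, map_sub, map_zero, sub_eq_zero, add_comm q q', h1,
          ← Module.End.mul_apply, ← pow_succ] at h2
        exact ⟨_, h2⟩
  exact key N 0 (zero_add N) p v hv

end LocallyNilpotent

end

section

open Module CartanRep

set_option linter.unusedSectionVars false

theorem commutator_commutator {A : Type*} [Ring A] (e f x : A) :
    e * (f * x - x * f) - (f * x - x * f) * e =
      (f * (e * x - x * e) - (e * x - x * e) * f) + ((e * f - f * e) * x - x * (e * f - f * e)) := by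
  noncomm_ring

theorem commutator_sub_smul {A : Type*} [Ring A] {e f h d : A} {c : ℤ} (b : ℤ) (he : h * e - e * h = c • e)
    (hd : e * f - f * e = d) : e * (h * f - f * h - b • f) - (h * f - f * h - b • f) * e =
      (h * d - d * h) - (c + b) • d := by
  have h1 : e * h - h * e = -(c • e) := by rw [← he, neg_sub]
  rw [mul_sub, sub_mul, sub_sub_sub_comm, commutator_commutator, h1, hd, mul_smul_comm, smul_mul_assoc, neg_mul, mul_neg,
    mul_smul_comm, smul_mul_assoc, ← smul_sub, hd, add_smul, neg_sub_neg, ← smul_sub, ← neg_sub (e * f), hd, smul_neg]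
  abel

namespace WordRep

section Basic

variable (R : Type*) [CommRing R] {B : Type*} [Fintype B] [DecidableEq B] (a : B → B → ℤ)

/-- The number of occurrences of each letter in a word. -/
def content : List B → B → ℤ
  | [] => 0
  | j :: u => root j + content u

/-- Precomposition with prepending the letter `j`. -/
def lower (j : B) : End R (List B → R) where
  toFun φ u := φ (j :: u)
  map_add' _ _ := rfl
  map_smul' _ _ := rfl

/-- The diagonal operator whose value at a word is determined by its content. -/
def cartan (i : B) : End R (List B → R) where
  toFun φ u := ((1 - coroot a i (content u) : ℤ) : R) * φ u
  map_add' _ _ := by ext; simp [mul_add]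
  map_smul' _ _ := by ext; simp [mul_left_comm]

variable {R} in
/-- The evaluation of `raise` at a word. -/
def raiseAux (i : B) : List B → (List B → R) → R
  | [], _ => 0
  | j :: u, φ => raiseAux i u (lower R j φ) + if i = j then cartan R a i φ u else 0

theorem raiseAux_add (i : B) (u : List B) (φ ψ : List B → R) :
    raiseAux a i u (φ + ψ) = raiseAux a i u φ + raiseAux a i u ψ := by
  induction u generalizing φ ψ with
  | nil => simp [raiseAux]
  | cons j u ih =>
    simp only [raiseAux, map_add, ih, Pi.add_apply]
    split_ifs <;> ring

theorem raiseAux_smul (i : B) (u : List B) (c : R) (φ : List B → R) :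
    raiseAux a i u (c • φ) = c * raiseAux a i u φ := by
  induction u generalizing φ with
  | nil => simp [raiseAux]
  | cons j u ih =>
    simp only [raiseAux, map_smul, ih, Pi.smul_apply, smul_eq_mul]
    split_ifs <;> ring

/-- The operator determined by its commutators with the operators `lower j` and by vanishing at the empty word. -/
def raise (i : B) : End R (List B → R) where
  toFun φ u := raiseAux a i u φ
  map_add' _ _ := funext fun u => raiseAux_add R a i u _ _
  map_smul' c _ := funext fun u => raiseAux_smul R a i u c _

/-- The indicator function of the empty word. -/
def vac : List B → R := Pi.single [] 1

/-- The function obtained from `vac` by applying the raising operators along a word. -/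
def word : List B → List B → R
  | [] => vac R
  | j :: u => raise R a j (word u)

end Basic

section Relations

variable {R : Type*} [CommRing R] {B : Type*} [Fintype B] [DecidableEq B] {a : B → B → ℤ}

@[simp] theorem content_nil : content ([] : List B) = 0 := rfl

@[simp] theorem content_cons (j : B) (u : List B) : content (j :: u) = root j + content u := rfl

theorem content_nonneg (u : List B) : 0 ≤ content u := by
  induction u with
  | nil => exact le_rfl
  | cons j u ih => exact add_nonneg (Pi.single_nonneg.2 zero_le_one) ih

theorem sum_content (u : List B) : ∑ j, content u j = u.length := by
  induction u with
  | nil => simp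
  | cons j u ih => simp [Finset.sum_add_distrib, ih, root, add_comm]

@[simp] theorem lower_apply (j : B) (φ : List B → R) (u : List B) : lower R j φ u = φ (j :: u) := rfl

@[simp] theorem cartan_apply (i : B) (φ : List B → R) (u : List B) :
    cartan R a i φ u = ((1 - coroot a i (content u) : ℤ) : R) * φ u := rfl

@[simp] theorem raise_nil (i : B) (φ : List B → R) : raise R a i φ [] = 0 := rfl

theorem lower_mul_raise (i j : B) :
    lower R j * raise R a i - raise R a i * lower R j = if i = j then cartan R a i else 0 := by
  rw [sub_eq_iff_eq_add']
  refine LinearMap.ext fun φ => funext fun u => ?_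
  change raiseAux a i u (lower R j φ) + (if i = j then cartan R a i φ u else 0) = _
  split_ifs <;> rfl

theorem lower_raise (i j : B) (φ : List B → R) : lower R j (raise R a i φ) =
    raise R a i (lower R j φ) + if i = j then cartan R a i φ else 0 := by
  have := LinearMap.congr_fun (lower_mul_raise (a := a) (R := R) i j) φ
  rw [LinearMap.sub_apply, sub_eq_iff_eq_add'] at this
  rw [← Module.End.mul_apply, this]
  split_ifs <;> rfl

theorem cartan_mul_lower (i j : B) :
    cartan R a i * lower R j - lower R j * cartan R a i = a i j • lower R j := by
  refine LinearMap.ext fun φ => funext fun u => ?_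
  simp [coroot_root]
  ring

theorem cartan_mul_cartan (i j : B) : cartan R a i * cartan R a j = cartan R a j * cartan R a i := by
  refine LinearMap.ext fun φ => funext fun u => ?_
  simp
  ring

theorem eq_zero_of_lower {φ : List B → R} (h0 : φ [] = 0) (h : ∀ j, lower R j φ = 0) : φ = 0 := by
  funext u
  cases u with
  | nil => exact h0
  | cons j u => exact congrFun (h j) u

theorem eq_zero_of_commutator {x : End R (List B → R)} (h0 : ∀ φ, x φ [] = 0)
    (h : ∀ j, lower R j * x - x * lower R j = 0) : x = 0 := by
  refine LinearMap.ext fun φ => funext fun u => ?_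
  induction u generalizing φ with
  | nil => exact h0 φ
  | cons j u ih =>
    have h1 := LinearMap.congr_fun (sub_eq_zero.1 (h j)) φ
    exact (congrFun h1 u).trans (ih _)

theorem cartan_mul_raise (i j : B) :
    cartan R a i * raise R a j - raise R a j * cartan R a i = (-a i j) • raise R a j := by
  rw [← sub_eq_zero]
  refine eq_zero_of_commutator (fun φ => by simp) fun k => ?_
  rw [commutator_sub_smul _ (cartan_mul_lower i k) (lower_mul_raise j k)]
  split_ifs with hjk
  · subst hjk
    rw [cartan_mul_cartan i j]
    simp
  · simp

theorem lower_mul_iterate {e f g : End R (List B → R)} (hef : e * f - f * e = 0) (n : ℕ) :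
    e * (fun x => f * x - x * f)^[n] g - (fun x => f * x - x * f)^[n] g * e =
      (fun x => f * x - x * f)^[n] (e * g - g * e) := by
  induction n with
  | zero => rfl
  | succ n ih =>
    rw [Function.iterate_succ_apply', Function.iterate_succ_apply', ← ih]
    set x := (fun x => f * x - x * f)^[n] g
    rw [commutator_commutator, hef]
    simp

variable {M : CoxeterMatrix B}

theorem iterate_commutator_zero (f : End R (List B → R)) (n : ℕ) :
    (fun x => f * x - x * f)^[n] 0 = 0 :=
  Function.iterate_fixed (by simp) n

/-- The Serre relations for the raising operators. -/
theorem serre (ha : IsCartanOf M a) {i j : B} (hij : i ≠ j) :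
    (fun x => raise R a i * x - x * raise R a i)^[(1 - a i j).toNat] (raise R a j) = 0 := by
  have hle := ha.off_nonpos hij
  obtain ⟨n, hn⟩ : ∃ n : ℕ, a i j = -n := ⟨(-a i j).toNat, by omega⟩
  rw [show (1 - a i j).toNat = n + 1 by omega]
  refine eq_zero_of_commutator (fun φ => ?_) fun k => ?_
  · generalize n + 1 = l
    induction l generalizing φ with
    | zero => simp
    | succ l ih =>
      rw [Function.iterate_succ_apply', LinearMap.sub_apply, Pi.sub_apply, Module.End.mul_apply, Module.End.mul_apply,
        raise_nil, ih, sub_zero]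
  · by_cases hk : i = k
    · subst hk
      have h1 := commutator_iterate_succ (e := lower R i) (f := raise R a i) (h := cartan R a i) (g := raise R a j)
        (c := -a i j) (by rw [lower_mul_raise, if_pos rfl]) (by rw [lower_mul_raise, if_neg hij.symm])
        (by rw [cartan_mul_raise, ha.diag]) (cartan_mul_raise i j) n
      rw [h1, hn, neg_neg, sub_self, mul_zero, zero_smul]
    · rw [lower_mul_iterate (by rw [lower_mul_raise, if_neg hk]), lower_mul_raise]
      split_ifs with hjk
      · have h1 : raise R a i * cartan R a j - cartan R a j * raise R a i = a j i • raise R a i := by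
          rw [← neg_sub, cartan_mul_raise, neg_smul, neg_neg]
        rw [Function.iterate_succ_apply, h1]
        cases n with
        | zero =>
          have : a j i = 0 := by
            have := ha.off i j hij
            omega
          simp [this]
        | succ n =>
          rw [Function.iterate_succ_apply, mul_smul_comm, smul_mul_assoc, sub_self, iterate_commutator_zero]
      · exact iterate_commutator_zero _ _

theorem lower_vac (j : B) : lower R j (vac R) = 0 := by
  funext u
  simp [vac]

theorem cartan_vac (i : B) : cartan R a i (vac R) = vac R := by
  funext u
  cases u <;> simp [vac]

end Relations

end WordRep

end

section

open Module CartanRep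

set_option linter.unusedSectionVars false

theorem neg_mul_sub_mul_neg {A : Type*} [Ring A] (x y : A) : -x * y - y * -x = -(x * y - y * x) := by
  noncomm_ring

namespace WordRep

section Span

variable (R : Type*) [CommRing R] {B : Type*} [Fintype B] [DecidableEq B] (a : B → B → ℤ)

/-- The span of the word vectors of a given content. -/
def wordSpan (κ : B → ℤ) : Submodule R (List B → R) :=
  Submodule.span R {φ | ∃ u, content u = κ ∧ word R a u = φ}

variable {R a}

theorem word_mem_wordSpan (u : List B) : word R a u ∈ wordSpan R a (content u) :=
  Submodule.subset_span ⟨u, rfl, rfl⟩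

theorem raise_mem_wordSpan {i : B} {κ : B → ℤ} {φ : List B → R} (h : φ ∈ wordSpan R a κ) :
    raise R a i φ ∈ wordSpan R a (κ + root i) := by
  suffices wordSpan R a κ ≤ (wordSpan R a (κ + root i)).comap (raise R a i) from this h
  refine Submodule.span_le.2 ?_
  rintro _ ⟨u, rfl, rfl⟩
  exact Submodule.subset_span ⟨i :: u, add_comm _ _, rfl⟩

/-- Functions supported on words of a given content. -/
def homog (R : Type*) [CommRing R] (κ : B → ℤ) : Submodule R (List B → R) where
  carrier := {φ | ∀ v, content v ≠ κ → φ v = 0}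
  zero_mem' _ _ := rfl
  add_mem' h h' v hv := by simp [h v hv, h' v hv]
  smul_mem' c φ h v hv := by simp [h v hv]

theorem raise_mem_homog {i : B} {κ : B → ℤ} {φ : List B → R} (h : φ ∈ homog R κ) :
    raise R a i φ ∈ homog R (κ + root i) := by
  intro v hv
  induction v generalizing φ κ with
  | nil => rfl
  | cons j u ih =>
    rw [content_cons] at hv
    rw [← lower_apply j (raise R a i φ) u, lower_raise, Pi.add_apply,
      ih (φ := lower R j φ) (κ := κ - root j) (fun v' hv' => h _ fun h' => hv' (by rw [← h', content_cons]; abel))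
        fun h' => hv (by rw [h']; abel), zero_add]
    split_ifs with hij
    · subst hij
      rw [cartan_apply, h _ fun h' => hv (by rw [h', add_comm]), mul_zero]
    · rfl

theorem vac_mem_homog : vac R ∈ homog R (0 : B → ℤ) := by
  intro v hv
  cases v with
  | nil => exact absurd rfl hv
  | cons => simp [vac]

theorem word_mem_homog (u : List B) : word R a u ∈ homog R (content u) := by
  induction u with
  | nil => exact vac_mem_homog
  | cons j u ih =>
    rw [content_cons, add_comm]
    exact raise_mem_homog ih

theorem wordSpan_le_homog (κ : B → ℤ) : wordSpan R a κ ≤ homog R κ := by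
  refine Submodule.span_le.2 ?_
  rintro _ ⟨u, rfl, rfl⟩
  exact word_mem_homog u

theorem cartan_of_mem_homog {i : B} {κ : B → ℤ} {φ : List B → R} (h : φ ∈ homog R κ) :
    cartan R a i φ = ((1 - coroot a i κ : ℤ) : R) • φ := by
  funext v
  by_cases hv : content v = κ
  · simp [hv]
  · simp [h v hv]

theorem lower_word_mem (j : B) (u : List B) : lower R j (word R a u) ∈ wordSpan R a (content u - root j) := by
  induction u with
  | nil =>
    change lower R j (vac R) ∈ _
    rw [lower_vac]
    exact zero_mem _
  | cons i u ih =>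
    change lower R j (raise R a i (word R a u)) ∈ _
    rw [lower_raise]
    refine add_mem ?_ ?_
    · have := raise_mem_wordSpan (i := i) ih
      rwa [sub_add_eq_add_sub, add_comm (content u)] at this
    · split_ifs with hij
      · subst hij
        rw [cartan_of_mem_homog (word_mem_homog u), content_cons, add_sub_cancel_left]
        exact Submodule.smul_mem _ _ (word_mem_wordSpan u)
      · exact zero_mem _

theorem lower_mem_wordSpan {j : B} {κ : B → ℤ} {φ : List B → R} (h : φ ∈ wordSpan R a κ) :
    lower R j φ ∈ wordSpan R a (κ - root j) := by
  suffices wordSpan R a κ ≤ (wordSpan R a (κ - root j)).comap (lower R j) from this h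
  refine Submodule.span_le.2 ?_
  rintro _ ⟨u, rfl, rfl⟩
  exact lower_word_mem j u

theorem raise_pow_mem_wordSpan {i : B} {κ : B → ℤ} {φ : List B → R} (h : φ ∈ wordSpan R a κ) (n : ℕ) :
    (raise R a i ^ n) φ ∈ wordSpan R a (κ + (n : ℤ) • root i) := by
  induction n with
  | zero => simpa using h
  | succ n ih =>
    rw [pow_succ', Module.End.mul_apply]
    have := raise_mem_wordSpan (i := i) ih
    rwa [add_assoc, ← add_one_zsmul, ← Nat.cast_succ] at this

theorem lower_pow_mem_wordSpan {i : B} {κ : B → ℤ} {φ : List B → R} (h : φ ∈ wordSpan R a κ) (n : ℕ) :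
    (lower R i ^ n) φ ∈ wordSpan R a (κ - (n : ℤ) • root i) := by
  induction n with
  | zero => simpa using h
  | succ n ih =>
    rw [pow_succ', Module.End.mul_apply]
    have := lower_mem_wordSpan (j := i) ih
    rwa [sub_sub, ← add_one_zsmul, ← Nat.cast_succ] at this

theorem lower_pow_apply (i : B) (n : ℕ) (φ : List B → R) (v : List B) :
    (lower R i ^ n) φ v = φ (List.replicate n i ++ v) := by
  induction n generalizing φ with
  | zero => rfl
  | succ n ih => rw [pow_succ, Module.End.mul_apply, ih]; rfl

theorem lower_pow_eq_zero_of_mem {i : B} {κ : B → ℤ} {φ : List B → R} (h : φ ∈ homog R κ) {n : ℕ} (hn : κ i < n) :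
    (lower R i ^ n) φ = 0 := by
  funext v
  rw [lower_pow_apply]
  refine h _ fun h' => ?_
  have key : content (List.replicate n i ++ v) i = n + content v i := by
    clear hn h'
    induction n with
    | zero => simp
    | succ n ih =>
      rw [List.replicate_succ, List.cons_append, content_cons, Pi.add_apply, ih, root, Pi.single_eq_same]
      push_cast
      ring
  have := content_nonneg v i
  rw [h'] at key
  simp only [Pi.zero_apply] at this
  omega

end Span

section Rat

variable {B : Type*} [Fintype B] [DecidableEq B] {a : B → B → ℤ} {M : CoxeterMatrix B}

theorem raise_sq_vac (ha : IsCartanOf M a) (i : B) : (raise ℚ a i ^ 2) (vac ℚ) = 0 := by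
  refine eq_zero_of_lower (by rw [pow_two]; rfl) fun j => ?_
  by_cases hij : i = j
  · subst hij
    have := apply_pow_succ_of_weight (e := lower ℚ i) (f := raise ℚ a i) (h := cartan ℚ a i) (m := 1) (v := vac ℚ)
      (by rw [lower_mul_raise, if_pos rfl]) (by rw [cartan_mul_raise, ha.diag])
      (by rw [cartan_vac, one_smul]) 1
    rw [this, lower_vac]
    simp
  · rw [pow_two, Module.End.mul_apply, lower_raise, lower_raise, lower_vac]
    simp [hij]

theorem exists_raise_pow_word_eq_zero (ha : IsCartanOf M a) (i : B) (u : List B) :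
    ∃ p, (raise ℚ a i ^ p) (word ℚ a u) = 0 := by
  induction u with
  | nil => exact ⟨2, raise_sq_vac ha i⟩
  | cons j u ih =>
    obtain ⟨p, hp⟩ := ih
    change ∃ p, (raise ℚ a i ^ p) (raise ℚ a j (word ℚ a u)) = 0
    by_cases hij : i = j
    · subst hij
      refine ⟨p, ?_⟩
      rw [← Module.End.mul_apply, ← pow_succ, pow_succ', Module.End.mul_apply, hp, map_zero]
    · exact exists_pow_apply_eq_zero_of_commutator (serre ha hij) hp

theorem wordSpan_ne_bot_iff {κ : B → ℤ} :
    wordSpan ℚ a κ ≠ ⊥ ↔ ∃ u, content u = κ ∧ word ℚ a u ≠ 0 := by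
  rw [wordSpan, Ne, Submodule.span_eq_bot]
  push Not
  constructor
  · rintro ⟨_, ⟨u, hu, rfl⟩, h⟩
    exact ⟨u, hu, h⟩
  · rintro ⟨u, hu, h⟩
    exact ⟨_, ⟨u, hu, rfl⟩, h⟩

theorem wordSpan_ne_bot_reflect (ha : IsCartanOf M a) (i : B) {κ : B → ℤ} (h : wordSpan ℚ a κ ≠ ⊥) :
    wordSpan ℚ a (preReflection (root i) (coroot a i) κ + root i) ≠ ⊥ := by
  obtain ⟨u, rfl, hu⟩ := wordSpan_ne_bot_iff.1 h
  have hc : cartan ℚ a i (word ℚ a u) = (1 - coroot a i (content u)) • word ℚ a u := by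
    rw [cartan_of_mem_homog (word_mem_homog u), Int.cast_smul_eq_zsmul]
  have hef : lower ℚ i * raise ℚ a i - raise ℚ a i * lower ℚ i = cartan ℚ a i := by rw [lower_mul_raise, if_pos rfl]
  have hhe : cartan ℚ a i * lower ℚ i - lower ℚ i * cartan ℚ a i = (2 : ℤ) • lower ℚ i := by
    rw [cartan_mul_lower, ha.diag]
  have hhf : cartan ℚ a i * raise ℚ a i - raise ℚ a i * cartan ℚ a i = (-2 : ℤ) • raise ℚ a i := by
    rw [cartan_mul_raise, ha.diag]
  rw [preReflection_apply]
  rcases le_total 0 (1 - coroot a i (content u)) with hm | hm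
  · obtain ⟨m, hm⟩ := Int.eq_ofNat_of_zero_le hm
    rw [hm] at hc
    have h0 := lower_pow_eq_zero_of_mem (i := i) (n := (content u i).toNat + 1) (word_mem_homog (R := ℚ) (a := a) u)
      (by push_cast; omega)
    have h1 := pow_apply_ne_zero_of_weight hef hhe hhf hc h0 hu
    have h2 := raise_pow_mem_wordSpan (i := i) (word_mem_wordSpan (R := ℚ) (a := a) u) m
    rw [show content u - coroot a i (content u) • root i + root i = content u + (m : ℤ) • root i by
      rw [← hm]; module]
    exact fun h3 => h1 (by rwa [h3] at h2)
  · obtain ⟨m, hm⟩ := Int.eq_ofNat_of_zero_le (neg_nonneg.2 hm)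
    obtain ⟨p, hp⟩ := exists_raise_pow_word_eq_zero ha i u
    have h1 := pow_apply_ne_zero_of_weight (e := raise ℚ a i) (f := lower ℚ i) (h := -cartan ℚ a i) (m := m)
      (by rw [← hef, neg_sub])
      ((neg_mul_sub_mul_neg _ _).trans (by rw [hhf, neg_smul, neg_neg]))
      ((neg_mul_sub_mul_neg _ _).trans (by rw [hhe, neg_smul]))
      (by rw [LinearMap.neg_apply, hc, ← neg_smul, hm]) hp hu
    have h2 := lower_pow_mem_wordSpan (i := i) (word_mem_wordSpan (R := ℚ) (a := a) u) m
    rw [show content u - coroot a i (content u) • root i + root i = content u - (m : ℤ) • root i by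
      rw [← hm]; module]
    exact fun h3 => h1 (by rwa [h3] at h2)

variable {W : Type*} [Group W] (cs : CoxeterSystem M W)

theorem exists_wordSpan_ne_bot_add (ha : IsCartanOf M a) (w : W) :
    ∃ c, ∀ κ, wordSpan ℚ a κ ≠ ⊥ → wordSpan ℚ a (rep ha cs w κ + c) ≠ ⊥ := by
  induction w using cs.simple_induction_left with
  | one => exact ⟨0, fun κ h => by simpa using h⟩
  | mul_simple_left w i ih =>
    obtain ⟨c, hc⟩ := ih
    refine ⟨preReflection (root i) (coroot a i) c + root i, fun κ h => ?_⟩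
    have := wordSpan_ne_bot_reflect ha i (hc κ h)
    rw [← rep_simple ha cs]
    rwa [map_add, add_assoc, ← rep_simple ha cs, ← Module.End.mul_apply, ← map_mul] at this

theorem exists_forall_isRightDescent [Finite W] : ∃ w, ∀ i, cs.IsRightDescent w i := by
  obtain ⟨w, hw⟩ := Finite.exists_max cs.length
  refine ⟨w, fun i => lt_of_le_of_ne (hw _) (cs.length_mul_simple_ne w i)⟩

theorem exists_word_rat_eq_zero (cs : CoxeterSystem M W) [Finite W] (ha : IsCartanOf M a) :
    ∃ N, ∀ u : List B, N < u.length → word ℚ a u = 0 := by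
  obtain ⟨w, hw⟩ := exists_forall_isRightDescent cs
  obtain ⟨c, hc⟩ := exists_wordSpan_ne_bot_add cs ha w
  refine ⟨(∑ j, c j).toNat, fun u hu => ?_⟩
  by_contra h0
  have h1 := hc _ (wordSpan_ne_bot_iff.2 ⟨u, rfl, h0⟩)
  obtain ⟨v, hv, -⟩ := wordSpan_ne_bot_iff.1 h1
  have h2 : ∀ i, ∑ j, rep ha cs w (root i) j ≤ -1 := by
    intro i
    have hle := rep_root_nonpos ha cs (hw i)
    refine Int.le_sub_one_of_lt (Finset.sum_neg' (fun j _ => hle j) ?_)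
    by_contra! h
    exact rep_root_ne_zero ha cs w i (funext fun j => le_antisymm (hle j) (h j (Finset.mem_univ j)))
  have h3 : ∀ u : List B, ∑ j, rep ha cs w (content u) j ≤ -u.length := by
    intro u
    induction u with
    | nil => simp
    | cons i u ih =>
      rw [content_cons, map_add]
      simp only [Pi.add_apply, Finset.sum_add_distrib, List.length_cons]
      have := h2 i
      push_cast
      omega
  have h4 := sum_content v
  rw [hv] at h4
  simp only [Pi.add_apply, Finset.sum_add_distrib] at h4
  have := h3 u
  omega

end Rat

section Map

variable {R S : Type*} [CommRing R] [CommRing S] {B : Type*} [Fintype B] [DecidableEq B] {a : B → B → ℤ}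

theorem raise_map (g : R →+* S) (i : B) (φ : List B → R) :
    raise S a i (g ∘ φ) = g ∘ raise R a i φ := by
  funext u
  induction u generalizing φ with
  | nil => simp
  | cons j u ih =>
    rw [← lower_apply j (raise S a i _) u, lower_raise, Function.comp_apply, ← lower_apply j (raise R a i φ) u, lower_raise, Pi.add_apply, Pi.add_apply,
      map_add]
    congr 1
    · exact ih _
    · split_ifs <;> simp

theorem word_map (g : R →+* S) (u : List B) : word S a u = g ∘ word R a u := by
  induction u with
  | nil =>
    funext v
    cases v <;> simp [word, vac]
  | cons j u ih =>
    change raise S a j (word S a u) = _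
    rw [ih, raise_map]
    rfl

theorem exists_word_eq_zero {M : CoxeterMatrix B} {W : Type*} [Group W] [Finite W] (cs : CoxeterSystem M W)
    (ha : IsCartanOf M a) :
    ∃ N, ∀ (R : Type) [CommRing R] (u : List B), N < u.length → word R a u = 0 := by
  obtain ⟨N, hN⟩ := exists_word_rat_eq_zero cs ha
  refine ⟨N, fun R _ u hu => ?_⟩
  have h1 : word ℤ a u = 0 := by
    funext v
    have := congrFun (hN u hu) v
    rw [word_map (Int.castRingHom ℚ)] at this
    simpa using this
  rw [word_map (Int.castRingHom R), h1]
  funext v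
  simp

end Map

end WordRep

end

section

open Module CartanRep WtMatrix

namespace WordRep

variable {B : Type*} [Fintype B] [DecidableEq B] {a : B → B → ℤ}

theorem content_apply_le (u : List B) (i : B) : content u i ≤ u.length := by
  rw [← sum_content]
  exact Finset.single_le_sum (fun j _ => content_nonneg u j) (Finset.mem_univ i)

section Field

variable {F : Type*} [Field F] {ι : Type*} [Fintype ι]

section Represents

variable {V : Type*} [AddCommGroup V] [Module F V]

/-- The matrix `A` describes the action of `T` on the family `w`. -/
def Represents (w : ι → V) (A : Matrix ι ι F) (T : End F V) : Prop := ∀ k, ∑ l, A l k • w l = T (w k)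

variable {w : ι → V} {A A' : Matrix ι ι F} {T T' : End F V}

theorem Represents.mul (h : Represents w A T) (h' : Represents w A' T') : Represents w (A * A') (T * T') := by
  intro k
  rw [Module.End.mul_apply, ← h' k, map_sum]
  simp only [map_smul, ← h _, Matrix.mul_apply, Finset.sum_smul, Finset.smul_sum, smul_smul]
  rw [Finset.sum_comm]
  simp only [mul_comm]

theorem Represents.sub (h : Represents w A T) (h' : Represents w A' T') : Represents w (A - A') (T - T') := by
  intro k
  simp [sub_smul, Finset.sum_sub_distrib, h k, h' k]

theorem Represents.unique (hw : LinearIndependent F w) (h : Represents w A T) (h' : Represents w A' T) : A = A' := by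
  ext l k
  have h1 := Fintype.linearIndependent_iff.1 hw (fun l => A l k - A' l k)
    (by simp [sub_smul, Finset.sum_sub_distrib, h k, h' k]) l
  exact sub_eq_zero.1 h1

theorem exists_represents (hT : ∀ k, T (w k) ∈ Submodule.span F (Set.range w)) : ∃ A, Represents w A T := by
  choose A hA using fun k => (Submodule.mem_span_range_iff_exists_fun F).1 (hT k)
  exact ⟨fun l k => A k l, hA⟩

end Represents

variable {q : ι → List B}

theorem Represents.content_eq (hw : LinearIndependent F fun k => word F a (q k)) {A : Matrix ι ι F}
    {T : End F (List B → F)} (h : Represents (fun k => word F a (q k)) A T) {κ : B → ℤ} {k : ι}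
    (hT : T (word F a (q k)) ∈ homog F κ) {l : ι} (hl : A l k ≠ 0) : content (q l) = κ := by
  by_contra hne
  refine hl ?_
  have h1 := Fintype.linearIndependent_iff.1 hw (fun l => if content (q l) = κ then 0 else A l k) ?_ l
  · simpa [hne] using h1
  · funext v
    by_cases hv : content v = κ
    · rw [Finset.sum_apply]
      refine Finset.sum_eq_zero fun l _ => ?_
      by_cases hl : content (q l) = κ
      · simp [hl]
      · simp [word_mem_homog (R := F) (a := a) (q l) v fun h => hl (h.symm.trans hv)]
    · have h2 := congrFun (h k) v
      rw [hT v hv, Finset.sum_apply] at h2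
      rw [Finset.sum_apply, Pi.zero_apply, ← h2]
      refine Finset.sum_congr rfl fun l _ => ?_
      by_cases hl : content (q l) = κ
      · simp [word_mem_homog (R := F) (a := a) (q l) v fun h => hv (h.trans hl)]
      · simp [hl]

theorem raise_mem_span {i : B} {φ : List B → F} (h : φ ∈ Submodule.span F (Set.range (word F a))) :
    raise F a i φ ∈ Submodule.span F (Set.range (word F a)) := by
  suffices Submodule.span F (Set.range (word F a)) ≤ (Submodule.span F (Set.range (word F a))).comap (raise F a i) from
    this h
  refine Submodule.span_le.2 ?_
  rintro _ ⟨u, rfl⟩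
  exact Submodule.subset_span ⟨i :: u, rfl⟩

theorem lower_mem_span {i : B} {φ : List B → F} (h : φ ∈ Submodule.span F (Set.range (word F a))) :
    lower F i φ ∈ Submodule.span F (Set.range (word F a)) := by
  suffices Submodule.span F (Set.range (word F a)) ≤ (Submodule.span F (Set.range (word F a))).comap (lower F i) from
    this h
  refine Submodule.span_le.2 ?_
  rintro _ ⟨u, rfl⟩
  refine Submodule.span_mono ?_ (lower_word_mem i u)
  rintro _ ⟨v, -, rfl⟩
  exact ⟨v, rfl⟩

theorem exists_isChevalleyRep [DecidableEq ι] (hw : LinearIndependent F fun k => word F a (q k))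
    (hs : Submodule.span F (Set.range fun k => word F a (q k)) = Submodule.span F (Set.range (word F a))) :
    ∃ e f : B → Matrix ι ι F, IsChevalleyRep a (fun k => -content (q k)) e f := by
  have hmem : ∀ k, word F a (q k) ∈ Submodule.span F (Set.range (word F a)) := fun k => Submodule.subset_span ⟨_, rfl⟩
  choose e he using fun i => exists_represents (w := fun k => word F a (q k)) (T := lower F i)
    fun k => hs.symm ▸ lower_mem_span (hmem k)
  choose f hf using fun i => exists_represents (w := fun k => word F a (q k)) (T := raise F a i)
    fun k => hs.symm ▸ raise_mem_span (hmem k)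
  refine ⟨e, f, fun i l k hlk => ?_, fun i l k hlk => ?_, fun i j => ?_, fun i hi => ?_⟩
  · rw [(he i).content_eq hw (wordSpan_le_homog _ (lower_word_mem i (q k))) hlk]
    abel
  · rw [(hf i).content_eq hw (raise_mem_homog (word_mem_homog (q k))) hlk]
    abel
  · refine (((he i).mul (hf j)).sub ((hf j).mul (he i))).unique hw ?_
    rw [lower_mul_raise]
    intro k
    by_cases hij : i = j
    · subst hij
      simp only [if_true]
      rw [cartan_of_mem_homog (word_mem_homog (q k)), Finset.sum_eq_single k]
      · simp [corootDiag, sub_eq_add_neg]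
      · intro l _ hl
        simp [corootDiag, Matrix.diagonal_apply_ne _ hl]
      · simp
    · simp [hij, Ne.symm hij]
  · have h1 : Submodule.span F (Set.range (word F a)) ≤ LinearMap.ker (lower F i) := by
      rw [← hs, Submodule.span_le]
      rintro _ ⟨k, rfl⟩
      have := he i k
      rw [hi] at this
      simpa using this.symm
    have h2 : lower F i (word F a [i]) = 0 := h1 (Submodule.subset_span ⟨_, rfl⟩)
    have h3 : lower F i (raise F a i (vac F)) = 0 := h2
    rw [lower_raise, lower_vac, map_zero, zero_add, if_pos rfl, cartan_vac] at h3
    have h4 := congrFun h3 []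
    simp [vac] at h4

end Field

theorem exists_hasBuilding {M : CoxeterMatrix B} {W : Type*} [Group W] [Fintype W] [DecidableEq W]
    (cs : CoxeterSystem M W) (ha : IsCartanOf M a) : ∃ C, ∀ r : ℕ, r.Prime → C < r → cs.HasBuilding r := by
  obtain ⟨N, hN⟩ := exists_word_eq_zero cs ha
  let Q := {u : List B // u.length ≤ N}
  have hQ : Finite Q := (List.finite_length_le B N).to_subtype
  obtain ⟨C₁, hC₁⟩ := (Set.finite_range fun x : B × Q × Q =>
    ((-content x.2.1.1 - -content x.2.2.1) x.1).natAbs).bddAbove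
  obtain ⟨C₂, hC₂⟩ := (Set.finite_range fun x : B × B × Q × Q × Q × Q =>
    (preReflection (root x.1) (coroot a x.1) (-content x.2.2.1.1 - -content x.2.2.2.1.1) x.2.1 -
      (-content x.2.2.2.2.1.1 - -content x.2.2.2.2.2.1) x.2.1).natAbs).bddAbove
  refine ⟨2 * N + 3 + C₁ + C₂, fun r hr hCr => ?_⟩
  have : Fact r.Prime := ⟨hr⟩
  have hzero : ∀ z : ℤ, z.natAbs < r → (z : ZMod r) = 0 → z = 0 := fun z hz h =>
    Int.eq_zero_of_dvd_of_natAbs_lt_natAbs ((ZMod.intCast_zmod_eq_zero_iff_dvd z r).1 h) (by simpa using hz)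
  obtain ⟨ι, q, hq, hs, hw⟩ := exists_linearIndependent' (ZMod r) fun u : Q => word (ZMod r) a u.1
  have : Finite ι := Finite.of_injective q hq
  classical
  have : Fintype ι := Fintype.ofFinite ι
  have hspan : Submodule.span (ZMod r) (Set.range fun u : Q => word (ZMod r) a u.1) =
      Submodule.span (ZMod r) (Set.range (word (ZMod r) a)) := by
    refine le_antisymm (Submodule.span_mono ?_) (Submodule.span_le.2 ?_)
    · rintro _ ⟨u, rfl⟩
      exact ⟨u.1, rfl⟩
    · rintro _ ⟨u, rfl⟩
      by_cases hu : u.length ≤ N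
      · exact Submodule.subset_span ⟨⟨u, hu⟩, rfl⟩
      · rw [hN _ u (not_le.1 hu)]
        exact zero_mem _
  obtain ⟨e, f, h⟩ := exists_isChevalleyRep (q := fun k => (q k).1) hw (hs.trans hspan)
  have hpow : ∀ (s : B) (z : ℤ) (x : Matrix ι ι (ZMod r)), z.natAbs = 1 →
      IsHom (fun k => -content (q k).1) (z • root s) x → x ^ (N + 1) = 0 := by
    intro s z x hz hx
    ext l k
    refine (hx.pow (N + 1)).eq_zero fun heq => ?_
    have h1 := congrFun heq s
    simp only [Pi.sub_apply, Pi.neg_apply, Pi.smul_apply, root, Pi.single_eq_same, nsmul_eq_mul, smul_eq_mul] at h1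
    have h2 := content_apply_le (q k).1 s
    have h3 := content_apply_le (q l).1 s
    have h4 := content_nonneg (q k).1 s
    have h5 := content_nonneg (q l).1 s
    have h6 := (q k).2
    have h7 := (q l).2
    simp only [Pi.zero_apply] at h4 h5
    push_cast at h1
    rcases Int.natAbs_eq z with h8 | h8 <;> rw [hz] at h8 <;> subst h8 <;> simp at h1 <;> omega
  have hb : ExpBound (ZMod r) (2 * N + 3) (N + 1) := by
    refine ⟨fun k hk h0 => ?_, by omega, by omega⟩
    have := (hr.dvd_factorial).1 ((ZMod.natCast_eq_zero_iff _ _).1 h0)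
    omega
  have hwt : IsFaithfulWt (ZMod r) a fun k => -content (q k).1 := by
    refine ⟨fun b c h0 => funext fun j => hzero _ ?_ (h0 j), fun s b c b' c' h0 => funext fun j => ?_⟩
    · have := hC₁ ⟨(j, q b, q c), rfl⟩
      exact lt_of_le_of_lt this (by omega)
    · refine sub_eq_zero.1 (hzero _ ?_ (by rw [Int.cast_sub, h0 j, sub_self]))
      have := hC₂ ⟨(s, j, q b, q c, q b', q c'), rfl⟩
      exact lt_of_le_of_lt this (by omega)
  have := h.hasBuilding cs ha hb (fun s => hpow s 1 _ rfl (by simpa using h.hom_e s))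
    (fun s => hpow s (-1) _ rfl (by simpa using h.hom_f s)) hwt
  rwa [Nat.card_zmod] at this

end WordRep

end

/-- **Gyoja–Uno semisimplicity criterion.**
Let `(W, S)` be a finite crystallographic Coxeter system (a finite Weyl group), `k` a field
of characteristic zero and `ξ ∈ k` nonzero.  Let `H_k(W, ξ)` be the `k`-algebra presented by
generators `T_s` with the quadratic relations `T_s² = ξ·1 + (ξ−1)·T_s` and the braid
relations.  If the Poincaré polynomial value `Σ_{w ∈ W} ξ^{ℓ(w)}` is nonzero in `k`,
then `H_k(W, ξ)` is a semisimple ring. -/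
theorem hecke_semisimple_of_poincare_ne_zero
    {B : Type*} {W : Type*} [Group W] [Fintype W] (M : CoxeterMatrix B)
    (cs : CoxeterSystem M W)
    (hcrys : ∀ i j : B, i ≠ j →
      orderOf (cs.simple i * cs.simple j) ∈ ({2, 3, 4, 6} : Set ℕ))
    (k : Type*) [Field k] [CharZero k] (ξ : k) (hξ : ξ ≠ 0)
    (hP : ∑ w : W, ξ ^ cs.length w ≠ 0) :
    IsSemisimpleRing (RingQuot (heckeRel k M ξ)) := by
  classical
  have hinj : Function.Injective cs.simple := by
    intro i j hij
    by_contra hne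
    have := hcrys i j hne
    rw [hij, cs.simple_mul_simple_self, orderOf_one] at this
    simp at this
  have : Finite B := Finite.of_injective _ hinj
  have := Fintype.ofFinite B
  have hM : ∀ i j, i ≠ j → M i j = 2 ∨ M i j = 3 ∨ M i j = 4 ∨ M i j = 6 := by
    intro i j hij
    have h := hcrys i j hij
    rw [cs.orderOf_simple_mul_simple i j (by rintro h0; rw [h0] at h; simp at h)] at h
    simpa using h
  obtain ⟨a, ha⟩ := exists_isCartanOf M hM
  obtain ⟨C, hC⟩ := WordRep.exists_hasBuilding cs ha
  exact HeckeAlg.isSemisimpleRing cs ha C hC hξ hP
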